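/- arXiv:2512.20767 — 2 statements merged into one kernel-verified Lean document; each statement's English description precedes it below -/
import Mathlib

section
/- Let d ≥ 2, let Γ be a finitely generated subgroup of F_d, let S be a finite subset of F_d, and let ε > 0. Then there exists a boomerang subgroup Δ of F_d such that (for every g ∈ S, g ∈ Δ ↔ g ∈ Γ) and δ(Γ) ≤ δ(Δ) ≤ δ(Γ) + ε. (The sets {Δ' : ∀ g ∈ S, g ∈ Δ' ↔ g ∈ Γ} for finite S form a neighborhood basis of Γ in the Chabauty space, so this is the statement that boomerang subgroups with critical exponent in [δ(Γ), δ(Γ)+ε] exist in every Chabauty neighborhood of Γ.) -/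
open Filter

/-- The number of elements of `Γ` of word length at most `R`. -/
noncomputable def growthCount {d : ℕ} (Γ : Subgroup (FreeGroup (Fin d))) (R : ℕ) : ℕ :=
  Nat.card {g : FreeGroup (Fin d) // g ∈ Γ ∧ FreeGroup.norm g ≤ R}

/-- The critical exponent `δ(Γ) = limsup_R log(c_Γ(R))/R`. -/
noncomputable def critExp {d : ℕ} (Γ : Subgroup (FreeGroup (Fin d))) : ℝ :=
  Filter.atTop.limsup fun R : ℕ => Real.log (growthCount Γ R : ℝ) / (R : ℝ)

/-- Chabauty convergence of a sequence of subgroups. -/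
def ChabautyTendsto {G : Type*} [Group G] (H : ℕ → Subgroup G) (L : Subgroup G) : Prop :=
  ∀ g : G, ∀ᶠ n in Filter.atTop, (g ∈ H n ↔ g ∈ L)

/-- A boomerang subgroup. -/
def IsBoomerang {G : Type*} [Group G] (Δ : Subgroup G) : Prop :=
  ∀ g : G, ∃ n : ℕ → ℕ, StrictMono n ∧
    ChabautyTendsto (fun k => Subgroup.map (MulAut.conj (g ^ n k)).toMonoidHom Δ) Δ

open FreeGroup in
/-- The product `x * y` is reduced as written. -/
def Rd {α : Type*} [DecidableEq α] (x y : FreeGroup α) : Prop := FreeGroup.norm (x * y) = FreeGroup.norm x + FreeGroup.norm y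

section FreeGroupPart

open FreeGroup

variable {α : Type*} [DecidableEq α]

set_option linter.unusedSectionVars false

lemma Rd.toWord_eq {x y : FreeGroup α} (h : Rd x y) : (x * y).toWord = x.toWord ++ y.toWord := by
  apply (toWord_mul_sublist x y).eq_of_length
  simpa [Rd, FreeGroup.norm] using h

lemma Rd_iff {x y : FreeGroup α} : Rd x y ↔ IsReduced (x.toWord ++ y.toWord) := by
  constructor
  · intro h
    rw [← h.toWord_eq]
    exact isReduced_toWord
  · intro h
    have := h.reduce_eq
    rw [← toWord_mul] at this
    simp [Rd, FreeGroup.norm, this]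

lemma Rd.inv {x y : FreeGroup α} (h : Rd x y) : Rd y⁻¹ x⁻¹ := by
  unfold Rd at *
  rw [← mul_inv_rev, norm_inv_eq, norm_inv_eq, norm_inv_eq, h, add_comm]

lemma Rd.one_left (x : FreeGroup α) : Rd 1 x := by simp [Rd]

lemma Rd.one_right (x : FreeGroup α) : Rd x 1 := by simp [Rd]

lemma Rd.trans_right {x y z : FreeGroup α} (h1 : Rd x y) (h2 : Rd y z) (hy : y ≠ 1) :
    Rd x (y * z) := by
  rw [Rd_iff, h2.toWord_eq, ← List.append_assoc]
  rw [Rd_iff] at h1 h2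
  exact h1.append_overlap h2 (by simpa using hy)

lemma Rd.trans_left {x y z : FreeGroup α} (h1 : Rd x y) (h2 : Rd y z) (hy : y ≠ 1) :
    Rd (x * y) z := by
  have := h1.trans_right h2 hy
  unfold Rd at *
  rw [mul_assoc]
  omega

/-- `u` is a prefix of `x`. -/
def Pf (u x : FreeGroup α) : Prop := Rd u (u⁻¹ * x)

lemma mk_toWord_of_reduced {L : List (α × Bool)} (h : IsReduced L) : (mk L).toWord = L := by
  rw [toWord_mk, h.reduce_eq]

lemma Pf_iff {u x : FreeGroup α} : Pf u x ↔ u.toWord <+: x.toWord := by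
  constructor
  · intro h
    have := Rd.toWord_eq h
    rw [mul_inv_cancel_left] at this
    rw [this]
    exact List.prefix_append _ _
  · rintro ⟨R, hR⟩
    have hR' : IsReduced R :=
      (isReduced_toWord (x := x)).infix (by rw [← hR]; exact (List.suffix_append _ _).isInfix)
    have hx : u⁻¹ * x = mk R := by
      rw [inv_mul_eq_iff_eq_mul, ← mk_toWord (x := x), ← hR, ← mul_mk, mk_toWord]
    rw [Pf, Rd_iff, hx, mk_toWord_of_reduced hR', hR]
    exact isReduced_toWord

lemma exists_prefix_norm {u : FreeGroup α} {j : ℕ} (hj : j ≤ FreeGroup.norm u) :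
    ∃ v, FreeGroup.norm v = j ∧ Pf v u := by
  have hr : IsReduced (u.toWord.take j) :=
    (isReduced_toWord (x := u)).infix (List.take_prefix _ _).isInfix
  refine ⟨mk (u.toWord.take j), ?_, ?_⟩
  · rw [FreeGroup.norm, mk_toWord_of_reduced hr, List.length_take]
    exact min_eq_left hj
  · rw [Pf_iff, mk_toWord_of_reduced hr]
    exact List.take_prefix _ _

lemma Pf.trans {u v x : FreeGroup α} (h1 : Pf u v) (h2 : Pf v x) : Pf u x := by
  rw [Pf_iff] at *
  exact h1.trans h2

lemma Pf_one (x : FreeGroup α) : Pf 1 x := by simp [Pf, Rd]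

lemma Pf.norm_le {u x : FreeGroup α} (h : Pf u x) : FreeGroup.norm u ≤ FreeGroup.norm x := by
  rw [Pf_iff] at h
  exact h.length_le

lemma exists_first_letter {v : FreeGroup α} (hv : v ≠ 1) : ∃ x, FreeGroup.norm x = 1 ∧ Pf x v := by
  apply exists_prefix_norm
  rw [Nat.one_le_iff_ne_zero]
  simpa using hv

lemma letter_dichotomy {x : FreeGroup α} (hx : FreeGroup.norm x = 1) (z : FreeGroup α) :
    Rd x⁻¹ z ∨ Pf x z := by
  obtain ⟨⟨c, b⟩, hc⟩ : ∃ c, x.toWord = [c] := List.length_eq_one_iff.1 hx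
  rw [Rd_iff, Pf_iff, toWord_inv, hc]
  have hz := isReduced_toWord (x := z)
  cases hL : z.toWord with
  | nil => left; simp [invRev]
  | cons y L =>
    obtain ⟨c', b'⟩ := y
    rw [hL] at hz
    by_cases h : c = c' ∧ b = b'
    · right
      obtain ⟨rfl, rfl⟩ := h
      exact ⟨L, rfl⟩
    · left
      simp only [invRev, List.map_cons, List.map_nil, List.reverse_singleton,
        List.singleton_append]
      unfold FreeGroup.IsReduced at *
      rw [List.isChain_cons_cons]
      refine ⟨?_, hz⟩
      simp only
      intro hcc
      have hbb : b ≠ b' := fun hb => h ⟨hcc, hb⟩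
      revert hbb
      cases b <;> cases b' <;> simp

lemma prefix_append_cases {β : Type*} {P A B : List β} (h : P <+: A ++ B) :
    P <+: A ∨ ∃ R, P = A ++ R ∧ R <+: B := by
  rcases le_total P.length A.length with hl | hl
  · exact Or.inl (List.prefix_of_prefix_length_le h (List.prefix_append _ _) hl)
  · obtain ⟨R, rfl⟩ := List.prefix_of_prefix_length_le (List.prefix_append A B) h hl
    exact Or.inr ⟨R, rfl, (List.prefix_append_right_inj _).1 h⟩

lemma red_prefix {L1 L2 : List (α × Bool)} (h : Red L1 L2) :
    ∀ P, P <+: L2 → ∃ P', P' <+: L1 ∧ mk P' = mk P := by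
  induction h with
  | refl => intro P hP; exact ⟨P, hP, rfl⟩
  | tail _ hs ih =>
    intro P hP
    cases hs with
    | @not A B c b =>
      replace hP := prefix_append_cases hP
      rcases hP with hP | ⟨R, rfl, hR⟩
      · exact ih P (hP.trans (List.prefix_append _ _))
      · obtain ⟨P', h1, h2⟩ := ih (A ++ (c, b) :: (c, !b) :: R) (by
          obtain ⟨T, rfl⟩ := hR
          exact ⟨T, by simp⟩)
        refine ⟨P', h1, h2.trans ?_⟩
        exact Quot.sound Red.Step.not

lemma prefix_mul {u x y : FreeGroup α} (h : Pf u (x * y)) :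
    Pf u x ∨ ∃ y', FreeGroup.norm y' ≤ FreeGroup.norm y ∧ u = x * y' := by
  rw [Pf_iff, toWord_mul] at h
  obtain ⟨P, hP, hu⟩ := red_prefix (reduce.red (L := x.toWord ++ y.toWord)) _ h
  rw [mk_toWord] at hu
  replace hP := prefix_append_cases hP
  rcases hP with hP | ⟨R, rfl, hR⟩
  · left
    rw [Pf_iff, ← hu, mk_toWord_of_reduced ((isReduced_toWord (x := x)).infix hP.isInfix)]
    exact hP
  · right
    refine ⟨mk R, norm_mk_le.trans hR.length_le, ?_⟩
    rw [← hu, ← mul_mk, mk_toWord]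

/-- finitely generated subgroups of free groups are quasiconvex -/
lemma quasiconvex {Γ : Subgroup (FreeGroup α)} (hΓ : Γ.FG) :
    ∃ M, ∀ γ ∈ Γ, ∀ u, Pf u γ → ∃ γ' ∈ Γ, ∃ s, FreeGroup.norm s ≤ M ∧ u = γ' * s := by
  obtain ⟨T, rfl⟩ := hΓ
  refine ⟨T.sup FreeGroup.norm, fun γ hγ => ?_⟩
  have key : ∀ x ∈ Subgroup.closure (T : Set (FreeGroup α)), ∀ y, FreeGroup.norm y ≤ T.sup FreeGroup.norm →
      (∀ u, Pf u x → ∃ γ' ∈ Subgroup.closure (T : Set (FreeGroup α)), ∃ s,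
        FreeGroup.norm s ≤ T.sup FreeGroup.norm ∧ u = γ' * s) →
      (∀ u, Pf u (x * y) → ∃ γ' ∈ Subgroup.closure (T : Set (FreeGroup α)), ∃ s,
        FreeGroup.norm s ≤ T.sup FreeGroup.norm ∧ u = γ' * s) := by
    intro x hx y hy ih u hu
    rcases prefix_mul hu with h | ⟨y', h1, h2⟩
    · exact ih u h
    · exact ⟨x, hx, y', h1.trans hy, h2⟩
  induction hγ using Subgroup.closure_induction_right with
  | one =>
    intro u hu
    have : u = 1 := by simpa using hu.norm_le
    exact ⟨1, one_mem _, 1, by simp, by simp [this]⟩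
  | mul_right x hx y hy ih => exact key x hx y (Finset.le_sup (f := FreeGroup.norm) hy) ih
  | mul_inv_cancel x hx y hy ih =>
    exact key x hx y⁻¹ (by rw [norm_inv_eq]; exact Finset.le_sup (f := FreeGroup.norm) hy) ih

lemma ball_finite [Finite α] (R : ℕ) : {x : FreeGroup α | FreeGroup.norm x ≤ R}.Finite :=
  (List.finite_length_le (α × Bool) R).preimage toWord_injective.injOn

lemma common_prefix_bounded [Finite α] {Γ : Subgroup (FreeGroup α)} (hΓ : Γ.FG) (g : FreeGroup α)
    (hg : ∀ m : ℕ, 0 < m → g ^ m ∉ Γ) :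
    ∃ K, ∀ n : ℤ, ∀ γ ∈ Γ, ∀ u, Pf u γ → Pf u (g ^ n) → FreeGroup.norm u ≤ K := by
  obtain ⟨M, hM⟩ := quasiconvex hΓ
  obtain ⟨M', hM'⟩ := quasiconvex (Γ := Subgroup.zpowers g)
    ⟨{g}, by simp [Subgroup.zpowers_eq_closure]⟩
  let T := (ball_finite (α := α) M).toFinset ×ˢ (ball_finite (α := α) M').toFinset
  refine ⟨T.card, fun n γ hγ u hu hun => ?_⟩
  by_contra! hcon
  have h1 : ∀ j : Fin (FreeGroup.norm u + 1), ∃ v γ' s t, ∃ i : ℤ, FreeGroup.norm v = j ∧ γ' ∈ Γ ∧ FreeGroup.norm s ≤ M ∧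
      FreeGroup.norm t ≤ M' ∧ v = γ' * s ∧ v = g ^ i * t := by
    intro j
    obtain ⟨v, hv1, hv2⟩ := exists_prefix_norm (u := u) (j := j) (by omega)
    obtain ⟨γ', h1, s, h2, h3⟩ := hM γ hγ v (hv2.trans hu)
    obtain ⟨k, ⟨i, rfl⟩, t, h4, h5⟩ := hM' (g ^ n) (Subgroup.zpow_mem_zpowers g n) v (hv2.trans hun)
    exact ⟨v, γ', s, t, i, hv1, h1, h2, h4, h3, h5⟩
  choose v γ' s t i hv hγ' hs ht hvs hvt using h1
  obtain ⟨j, -, k, -, hjk, he⟩ := Finset.exists_ne_map_eq_of_card_lt_of_maps_to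
    (s := Finset.univ) (t := T) (f := fun j => (s j, t j)) (by simp; omega)
    (by intro j _; simp [T, hs, ht])
  simp only [Prod.mk.injEq] at he
  have hmem : g ^ (i j - i k) ∈ Γ := by
    have : g ^ (i j - i k) = γ' j * (γ' k)⁻¹ := by
      have e1 : g ^ i j = γ' j * s j * (t j)⁻¹ := by rw [← hvs, hvt]; group
      have e2 : g ^ i k = γ' k * s k * (t k)⁻¹ := by rw [← hvs, hvt]; group
      rw [zpow_sub, e1, e2, he.1, he.2]; group
    rw [this]
    exact mul_mem (hγ' j) (inv_mem (hγ' k))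
  have hne : i j - i k ≠ 0 := by
    intro h0
    have : i j = i k := by omega
    apply hjk
    have hvv : v j = v k := by rw [hvt, hvt, this, he.2]
    have := hv j
    rw [hvv, hv k] at this
    exact Fin.ext this.symm
  apply hg (i j - i k).natAbs (by omega)
  rw [← zpow_natCast]
  rcases Int.natAbs_eq (i j - i k) with h | h
  · rwa [← h]
  · rw [h, zpow_neg] at hmem
    exact inv_mem_iff.1 hmem

/-- the maximal prefix of `h` which is a prefix of an element of `Γ` -/
lemma exists_max_prefix (Γ : Subgroup (FreeGroup α)) (h : FreeGroup α) :
    ∃ p, Pf p h ∧ (∃ γ ∈ Γ, Pf p γ) ∧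
      (p⁻¹ * h ≠ 1 → ∀ a ∈ Γ, a ≠ 1 → Rd (p⁻¹ * a * p) (p⁻¹ * h)) := by
  classical
  let Q : ℕ → Prop := fun k => ∃ p, FreeGroup.norm p = k ∧ Pf p h ∧ ∃ γ ∈ Γ, Pf p γ
  have hQ0 : Q 0 := ⟨1, by simp, Pf_one _, 1, one_mem _, Pf_one _⟩
  obtain ⟨p, hp1, hp2, hp3⟩ := Nat.findGreatest_spec (P := Q) (Nat.zero_le (FreeGroup.norm h)) hQ0
  have hmax : ∀ p', Pf p' h → (∃ γ ∈ Γ, Pf p' γ) → FreeGroup.norm p' ≤ FreeGroup.norm p := by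
    intro p' h1 h2
    rw [hp1]
    exact Nat.le_findGreatest h1.norm_le ⟨p', rfl, h1, h2⟩
  refine ⟨p, hp2, hp3, fun hv a ha ha1 => ?_⟩
  by_contra hR
  set v := p⁻¹ * h with hvdef
  obtain ⟨x, hx, hxv⟩ := exists_first_letter hv
  have hx1 : x ≠ 1 := by rintro rfl; simp at hx
  set b := (p⁻¹ * a * p)⁻¹ with hb
  have hpx : Rd p x := by
    have h1 : Rd p v := hp2
    have h2 : Rd x (x⁻¹ * v) := hxv
    unfold Rd at *
    have h3 := norm_mul_le (p * x) (x⁻¹ * v)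
    have h4 := norm_mul_le p x
    rw [mul_inv_cancel_left] at h2
    rw [show p * x * (x⁻¹ * v) = p * v by group] at h3
    omega
  have hxb : Pf x b := by
    rcases letter_dichotomy hx b with h1 | h1
    · exfalso
      apply hR
      have h2 := h1.inv
      rw [inv_inv, inv_inv] at h2
      have := h2.trans_right hxv hx1
      rwa [mul_inv_cancel_left] at this
    · exact h1
  -- shortest element of `p⁻¹ Γ`
  have hex : ∃ k, ∃ t, FreeGroup.norm t = k ∧ p * t ∈ Γ := by
    obtain ⟨γ, hγ, _⟩ := hp3
    exact ⟨_, p⁻¹ * γ, rfl, by simpa using hγ⟩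
  obtain ⟨t, ht1, ht2⟩ := Nat.find_spec hex
  have hmin : ∀ t', p * t' ∈ Γ → FreeGroup.norm t ≤ FreeGroup.norm t' := by
    intro t' ht'
    rw [ht1]
    exact Nat.find_min' hex ⟨t', rfl, ht'⟩
  have hbt : p * (b * t) ∈ Γ := by
    have : p * (b * t) = a⁻¹ * (p * t) := by rw [hb]; group
    rw [this]
    exact mul_mem (inv_mem ha) ht2
  have hb1 : b ≠ 1 := by
    intro h0
    apply ha1
    rw [hb, inv_eq_one] at h0
    have : a = p * (p⁻¹ * a * p) * p⁻¹ := by group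
    rw [this, h0]; group
  rcases letter_dichotomy hx (b * t) with h1 | h1
  · have h2 := h1.inv
    rw [inv_inv] at h2
    have h3 := h2.trans_right hxb hx1
    rw [mul_inv_cancel_left] at h3
    have h4 : FreeGroup.norm ((b * t)⁻¹ * b) = FreeGroup.norm (b * t)⁻¹ + FreeGroup.norm b := h3
    rw [show (b * t)⁻¹ * b = t⁻¹ by group, norm_inv_eq, norm_inv_eq] at h4
    have h5 := hmin _ hbt
    have h6 : FreeGroup.norm b ≠ 0 := by simpa using hb1
    omega
  · have h2 : Pf (p * x) (p * (b * t)) := by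
      have := hpx.trans_left h1 hx1
      unfold Pf
      rwa [show (p * x)⁻¹ * (p * (b * t)) = x⁻¹ * (b * t) by group]
    have h3 : Pf (p * x) h := by
      have := hpx.trans_left hxv hx1
      unfold Pf
      rwa [show (p * x)⁻¹ * h = x⁻¹ * v by rw [hvdef]; group]
    have h4 := hmax _ h3 ⟨_, hbt, h2⟩
    have h5 : FreeGroup.norm (p * x) = FreeGroup.norm p + FreeGroup.norm x := hpx
    omega

lemma exists_decomp [Finite α] {Γ : Subgroup (FreeGroup α)} (hΓ : Γ.FG) (g : FreeGroup α)
    (hg : ∀ m : ℕ, 0 < m → g ^ m ∉ Γ) :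
    ∃ K, ∀ L N : ℕ, ∃ n, N ≤ n ∧ ∃ p w q, g ^ n = p * w * q⁻¹ ∧ FreeGroup.norm p ≤ K ∧ FreeGroup.norm q ≤ K ∧
      L ≤ FreeGroup.norm w ∧ w ≠ 1 ∧ (∀ a ∈ Γ, a ≠ 1 → Rd (p⁻¹ * a * p) w) ∧
      (∀ b ∈ Γ, b ≠ 1 → Rd (q⁻¹ * b * q) w⁻¹) := by
  obtain ⟨K, hK⟩ := common_prefix_bounded hΓ g hg
  refine ⟨K, fun L N => ?_⟩
  obtain ⟨n, hn, hlen⟩ : ∃ n, N ≤ n ∧ 2 * K + L + 1 ≤ FreeGroup.norm (g ^ n) := by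
    by_contra! hcon
    have hinj : Function.Injective (fun n : ℕ => g ^ n) := by
      rw [injective_pow_iff_not_isOfFinOrder, isOfFinOrder_iff_pow_eq_one]
      rintro ⟨m, hm, h1⟩
      apply hg m hm
      rw [h1]; exact one_mem _
    have := (Set.Ici_infinite N).image (f := fun n : ℕ => g ^ n) hinj.injOn
    apply this
    apply (ball_finite (2 * K + L + 1)).subset
    rintro _ ⟨n, hn, rfl⟩
    exact (hcon n hn).le
  refine ⟨n, hn, ?_⟩
  obtain ⟨p, hp1, ⟨γ, hγ, hp2⟩, hp3⟩ := exists_max_prefix Γ (g ^ n)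
  obtain ⟨q, hq1, ⟨γ', hγ', hq2⟩, hq3⟩ := exists_max_prefix Γ (g ^ n)⁻¹
  have hpK := hK n γ hγ p hp2 (by simpa using hp1)
  have hqK := hK (-n) γ' hγ' q hq2 (by simpa using hq1)
  set h := g ^ n with hh
  have ep : FreeGroup.norm h = FreeGroup.norm p + FreeGroup.norm (p⁻¹ * h) := by
    have : FreeGroup.norm (p * (p⁻¹ * h)) = _ := hp1
    rwa [mul_inv_cancel_left] at this
  have eq : FreeGroup.norm h = FreeGroup.norm q + FreeGroup.norm (h * q) := by
    have : FreeGroup.norm (q * (q⁻¹ * h⁻¹)) = _ := hq1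
    rwa [mul_inv_cancel_left, norm_inv_eq, ← mul_inv_rev, norm_inv_eq] at this
  have hpf : Pf (h * q) h := by
    have := hq1.inv
    rwa [mul_inv_rev, inv_inv, inv_inv, show q⁻¹ = (h * q)⁻¹ * h by group] at this
  have hpp : Pf p (h * q) := by
    rw [Pf_iff] at *
    exact List.prefix_of_prefix_length_le hp1 hpf (by change FreeGroup.norm p ≤ FreeGroup.norm (h * q); omega)
  have ew : FreeGroup.norm (h * q) = FreeGroup.norm p + FreeGroup.norm (p⁻¹ * h * q) := by
    have : FreeGroup.norm (p * (p⁻¹ * (h * q))) = _ := hpp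
    rwa [mul_inv_cancel_left, ← mul_assoc] at this
  have hw1 : p⁻¹ * h * q ≠ 1 := by
    intro h0
    rw [h0, FreeGroup.norm_one] at ew
    omega
  have hv1 : p⁻¹ * h ≠ 1 := by
    intro h0
    rw [h0, FreeGroup.norm_one] at ep
    omega
  have hv2 : q⁻¹ * h⁻¹ ≠ 1 := by
    intro h0
    rw [← mul_inv_rev, inv_eq_one] at h0
    rw [h0, FreeGroup.norm_one] at eq
    omega
  refine ⟨p, p⁻¹ * h * q, q, by group, hpK, hqK, by omega, hw1, ?_, ?_⟩
  · intro a ha ha1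
    have h1 : FreeGroup.norm _ = _ := hp3 hv1 a ha ha1
    have h2 := norm_mul_le ((p⁻¹ * a * p) * (p⁻¹ * h * q)) q⁻¹
    have h3 := norm_mul_le (p⁻¹ * a * p) (p⁻¹ * h * q)
    rw [show (p⁻¹ * a * p) * (p⁻¹ * h * q) * q⁻¹ = p⁻¹ * a * p * (p⁻¹ * h) by group,
      norm_inv_eq] at h2
    unfold Rd
    omega
  · intro a ha ha1
    have h1 : FreeGroup.norm _ = _ := hq3 hv2 a ha ha1
    have h2 := norm_mul_le ((q⁻¹ * a * q) * (p⁻¹ * h * q)⁻¹) p⁻¹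
    have h3 := norm_mul_le (q⁻¹ * a * q) (p⁻¹ * h * q)⁻¹
    rw [show (q⁻¹ * a * q) * (p⁻¹ * h * q)⁻¹ * p⁻¹ = q⁻¹ * a * q * (q⁻¹ * h⁻¹) by group,
      norm_inv_eq] at h2
    have h4 : FreeGroup.norm (q⁻¹ * h⁻¹) = FreeGroup.norm (h * q) := by rw [← mul_inv_rev, norm_inv_eq]
    unfold Rd
    rw [norm_inv_eq] at *
    omega

end FreeGroupPart

section PingPong

open scoped ENNReal

variable {α : Type*} [DecidableEq α]

/-- Normal forms in `⟨A, w B w⁻¹⟩` with `k` syllables from `w B w⁻¹`. -/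
inductive NF (A B : Subgroup (FreeGroup α)) (w : FreeGroup α) : ℕ → FreeGroup α → Prop
  | base (a : FreeGroup α) (ha : a ∈ A) : NF A B w 0 a
  | step (k : ℕ) (a b u : FreeGroup α) (ha : a ∈ A) (hb : b ∈ B) (hb1 : b ≠ 1)
      (hu : NF A B w k u) (hr : Rd w⁻¹ u) : NF A B w (k + 1) (a * (w * (b * (w⁻¹ * u))))

lemma nf_rd {w a b u : FreeGroup α} (hw : w ≠ 1) (ha : Rd a w) (hb : Rd b⁻¹ w⁻¹) (hb' : Rd b w⁻¹)
    (hb1 : b ≠ 1) (hr : Rd w⁻¹ u) : Rd a (w * (b * (w⁻¹ * u))) ∧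
      FreeGroup.norm (w * (b * (w⁻¹ * u))) =
        FreeGroup.norm w + FreeGroup.norm b + FreeGroup.norm w + FreeGroup.norm u := by
  have h1 : Rd b (w⁻¹ * u) := hb'.trans_right hr (by simpa using hw)
  have h2 : Rd w b := by simpa using hb.inv
  have h3 := h2.trans_right h1 hb1
  refine ⟨ha.trans_right h3 hw, ?_⟩
  have e1 : FreeGroup.norm (w⁻¹ * u) = _ := hr
  have e2 : FreeGroup.norm (b * (w⁻¹ * u)) = _ := h1
  have e3 : FreeGroup.norm (w * (b * (w⁻¹ * u))) = _ := h3
  rw [FreeGroup.norm_inv_eq] at e1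
  omega

variable {A B : Subgroup (FreeGroup α)} {w : FreeGroup α}

lemma rd_all {A : Subgroup (FreeGroup α)} {w : FreeGroup α} (HA : ∀ a ∈ A, a ≠ 1 → Rd a w)
    {a : FreeGroup α} (ha : a ∈ A) : Rd a w := by
  by_cases h : a = 1
  · rw [h]; exact Rd.one_left _
  · exact HA a ha h

lemma nf_closed_left {k : ℕ} {u a : FreeGroup α} (h : NF A B w k u) (ha : a ∈ A) :
    NF A B w k (a * u) := by
  cases h with
  | base a' ha' => exact NF.base _ (mul_mem ha ha')
  | step k a' b u ha' hb hb1 hu hr =>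
    rw [← mul_assoc]
    exact NF.step k _ b u (mul_mem ha ha') hb hb1 hu hr

lemma nf_closed_right (hw : w ≠ 1) (HA : ∀ a ∈ A, a ≠ 1 → Rd a w)
    (HB : ∀ b ∈ B, b ≠ 1 → Rd b w⁻¹) {k : ℕ} {u b : FreeGroup α} (h : NF A B w k u) (hb : b ∈ B) :
    ∃ k', NF A B w k' (w * b * w⁻¹ * u) := by
  by_cases hb1 : b = 1
  · refine ⟨k, ?_⟩
    simpa [hb1] using h
  by_cases hr : Rd w⁻¹ u
  · refine ⟨k + 1, ?_⟩
    have := NF.step k 1 b u (one_mem _) hb hb1 h hr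
    simpa [mul_assoc] using this
  cases h with
  | base a ha =>
    exact absurd (by simpa using (rd_all HA (inv_mem ha)).inv) hr
  | step k a b' u' ha hb' hb1' hu hr' =>
    have ha1 : a = 1 := by
      by_contra ha1
      apply hr
      have h1 : Rd w⁻¹ a := by simpa using (rd_all HA (inv_mem ha)).inv
      exact h1.trans_right (nf_rd hw (rd_all HA ha) (rd_all HB (inv_mem hb')) (rd_all HB hb')
        hb1' hr').1 ha1
    have e : w * b * w⁻¹ * (a * (w * (b' * (w⁻¹ * u')))) = w * ((b * b') * (w⁻¹ * u')) := by
      rw [ha1]; group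
    rw [e]
    by_cases hbb : b * b' = 1
    · refine ⟨k, ?_⟩
      rw [hbb]
      simpa using hu
    · refine ⟨k + 1, ?_⟩
      have := NF.step k 1 (b * b') u' (one_mem _) (mul_mem hb hb') hbb hu hr'
      simpa using this

lemma nf_succ_norm (hw : w ≠ 1) (HA : ∀ a ∈ A, a ≠ 1 → Rd a w)
    (HB : ∀ b ∈ B, b ≠ 1 → Rd b w⁻¹) {k : ℕ} {x : FreeGroup α} (h : NF A B w (k + 1) x) :
    ∃ a ∈ A, ∃ b ∈ B, ∃ u, NF A B w k u ∧ x = a * (w * (b * (w⁻¹ * u))) ∧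
      FreeGroup.norm x = FreeGroup.norm a + FreeGroup.norm b + FreeGroup.norm u
        + 2 * FreeGroup.norm w := by
  cases h with
  | step k a b u ha hb hb1 hu hr =>
    obtain ⟨h1, h2⟩ := nf_rd hw (rd_all HA ha) (rd_all HB (inv_mem hb)) (rd_all HB hb) hb1 hr
    refine ⟨a, ha, b, hb, u, hu, rfl, ?_⟩
    have h3 : FreeGroup.norm _ = _ := h1
    omega

/-- Poincare series -/
noncomputable def Zs (t : ℝ≥0∞) (E : Set (FreeGroup α)) : ℝ≥0∞ :=
  ∑' x : E, t ^ FreeGroup.norm x.1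

lemma Zs_nf_succ (t : ℝ≥0∞) (hw : w ≠ 1) (HA : ∀ a ∈ A, a ≠ 1 → Rd a w)
    (HB : ∀ b ∈ B, b ≠ 1 → Rd b w⁻¹) (k : ℕ) :
    Zs t {x | NF A B w (k + 1) x} ≤
      Zs t (A : Set (FreeGroup α)) * (Zs t (B : Set (FreeGroup α)) * (Zs t {x | NF A B w k x} * t ^ (2 * FreeGroup.norm w))) := by
  have h : ∀ x : {x | NF A B w (k + 1) x}, ∃ y : A × B × {x | NF A B w k x}, x.1 = y.1.1 * (w * (y.2.1.1 * (w⁻¹ * y.2.2.1))) ∧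
      FreeGroup.norm x.1 = FreeGroup.norm y.1.1 + FreeGroup.norm y.2.1.1 + FreeGroup.norm y.2.2.1
        + 2 * FreeGroup.norm w := by
    rintro ⟨x, hx⟩
    obtain ⟨a, ha, b, hb, u, hu, h1, h2⟩ := nf_succ_norm hw HA HB hx
    exact ⟨⟨⟨a, ha⟩, ⟨b, hb⟩, ⟨u, hu⟩⟩, h1, h2⟩
  choose φ h1 h2 using h
  have hinj : Function.Injective φ := by
    intro x y hxy
    apply Subtype.ext
    rw [h1 x, h1 y, hxy]
  let G : A × B × {x | NF A B w k x} → ℝ≥0∞ :=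
    fun y => t ^ FreeGroup.norm y.1.1 * (t ^ FreeGroup.norm y.2.1.1 *
      (t ^ FreeGroup.norm y.2.2.1 * t ^ (2 * FreeGroup.norm w)))
  calc Zs t {x | NF A B w (k + 1) x} = ∑' x, G (φ x) := by
        unfold Zs
        congr 1
        funext x
        rw [h2 x]
        simp only [G]
        ring
    _ ≤ ∑' y, G y := ENNReal.tsum_comp_le_tsum_of_injective hinj G
    _ = _ := by
        rw [ENNReal.tsum_prod']
        simp only [G, ENNReal.tsum_mul_left, ENNReal.tsum_prod', ENNReal.tsum_mul_right]
        rfl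

lemma Zs_mono (t : ℝ≥0∞) {E F : Set (FreeGroup α)} (h : E ⊆ F) : Zs t E ≤ Zs t F :=
  ENNReal.tsum_mono_subtype (fun x => t ^ FreeGroup.norm x) h

lemma Zs_conj {t : ℝ≥0∞} (ht0 : t ≠ 0) (ht1 : t ≤ 1) {p : FreeGroup α} {K : ℕ}
    (hp : FreeGroup.norm p ≤ K) (E : Set (FreeGroup α)) :
    Zs t {x | p⁻¹ * x * p ∈ E} ≤ t⁻¹ ^ (2 * K) * Zs t E := by
  let f : {x | p⁻¹ * x * p ∈ E} → E := fun x => ⟨p⁻¹ * x.1 * p, x.2⟩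
  have hf : Function.Injective f := by
    intro x y hxy
    have : p⁻¹ * x.1 * p = p⁻¹ * y.1 * p := congrArg Subtype.val hxy
    apply Subtype.ext
    simpa using this
  unfold Zs
  rw [← ENNReal.tsum_mul_left]
  refine le_trans ?_ (ENNReal.tsum_comp_le_tsum_of_injective hf _)
  refine ENNReal.tsum_le_tsum fun x => ?_
  have h1 := FreeGroup.norm_mul_le (p⁻¹ * x.1) p
  have h2 := FreeGroup.norm_mul_le p⁻¹ x.1
  rw [FreeGroup.norm_inv_eq] at h2
  have htt : t ≠ ⊤ := (ht1.trans_lt ENNReal.one_lt_top).ne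
  calc t ^ FreeGroup.norm x.1 = t⁻¹ ^ (2 * K) * t ^ (2 * K + FreeGroup.norm x.1) := by
        rw [pow_add, ← mul_assoc, ← mul_pow, ENNReal.inv_mul_cancel ht0 htt, one_pow, one_mul]
    _ ≤ _ := by
        gcongr t⁻¹ ^ (2 * K) * ?_
        apply pow_le_pow_right_of_le_one' ht1
        simp only [f]
        omega

/-- The amalgam `⟨Γ, h Γ h⁻¹⟩`. -/
def amal (Γ : Subgroup (FreeGroup α)) (h : FreeGroup α) : Subgroup (FreeGroup α) :=
  Γ ⊔ Γ.map (MulAut.conj h).toMonoidHom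

lemma amal_fg {Γ : Subgroup (FreeGroup α)} (hΓ : Γ.FG) (h : FreeGroup α) : (amal Γ h).FG :=
  Subgroup.FG.sup hΓ (by
    obtain ⟨T, rfl⟩ := hΓ
    classical
    refine ⟨T.image (MulAut.conj h).toMonoidHom, ?_⟩
    rw [MonoidHom.map_closure, Finset.coe_image])

lemma amal_nf {Γ : Subgroup (FreeGroup α)} {h p w q : FreeGroup α} (hh : h = p * w * q⁻¹)
    (hw : w ≠ 1) (HA : ∀ a ∈ Γ.comap (MulAut.conj p).toMonoidHom, a ≠ 1 → Rd a w)
    (HB : ∀ b ∈ Γ.comap (MulAut.conj q).toMonoidHom, b ≠ 1 → Rd b w⁻¹) {x : FreeGroup α}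
    (hx : x ∈ amal Γ h) :
    ∃ k, NF (Γ.comap (MulAut.conj p).toMonoidHom) (Γ.comap (MulAut.conj q).toMonoidHom) w k
      (p⁻¹ * x * p) := by
  have hA : ∀ a, a ∈ Γ.comap (MulAut.conj p).toMonoidHom ↔ p * a * p⁻¹ ∈ Γ := fun a => by
    simp
  have hB : ∀ a, a ∈ Γ.comap (MulAut.conj q).toMonoidHom ↔ q * a * q⁻¹ ∈ Γ := fun a => by
    simp
  unfold amal at hx
  rw [← Subgroup.closure_eq Γ, MonoidHom.map_closure, ← Subgroup.closure_union] at hx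
  have hΓm : ∀ y ∈ Γ, ∀ x, (∃ k, NF (Γ.comap (MulAut.conj p).toMonoidHom)
      (Γ.comap (MulAut.conj q).toMonoidHom) w k (p⁻¹ * x * p)) → ∃ k, NF
      (Γ.comap (MulAut.conj p).toMonoidHom) (Γ.comap (MulAut.conj q).toMonoidHom) w k
      (p⁻¹ * (y * x) * p) := by
    rintro y hy x ⟨k, hk⟩
    refine ⟨k, ?_⟩
    have := nf_closed_left hk (a := p⁻¹ * y * p) (by
      rw [hA, show p * (p⁻¹ * y * p) * p⁻¹ = y by group]; exact hy)
    rwa [show p⁻¹ * y * p * (p⁻¹ * x * p) = p⁻¹ * (y * x) * p by group] at this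
  have hΓm' : ∀ y ∈ Γ, ∀ x, (∃ k, NF (Γ.comap (MulAut.conj p).toMonoidHom)
      (Γ.comap (MulAut.conj q).toMonoidHom) w k (p⁻¹ * x * p)) → ∃ k, NF
      (Γ.comap (MulAut.conj p).toMonoidHom) (Γ.comap (MulAut.conj q).toMonoidHom) w k
      (p⁻¹ * ((h * y * h⁻¹) * x) * p) := by
    rintro y hy x ⟨k, hk⟩
    have := nf_closed_right hw HA HB hk (b := q⁻¹ * y * q) (by
      rw [hB, show q * (q⁻¹ * y * q) * q⁻¹ = y by group]; exact hy)
    rwa [show w * (q⁻¹ * y * q) * w⁻¹ * (p⁻¹ * x * p) = p⁻¹ * ((h * y * h⁻¹) * x) * p by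
      rw [hh]; group] at this
  induction hx using Subgroup.closure_induction_left with
  | one => exact ⟨0, NF.base _ (by simp)⟩
  | mul_left y hy x hx ih =>
    rcases hy with hy | ⟨y, hy, rfl⟩
    · exact hΓm y hy x ih
    · exact hΓm' y hy x ih
  | inv_mul_cancel y hy x hx ih =>
    rcases hy with hy | ⟨y, hy, rfl⟩
    · exact hΓm y⁻¹ (inv_mem hy) x ih
    · have := hΓm' y⁻¹ (inv_mem hy) x ih
      simpa [mul_assoc] using this

lemma comap_rd {Γ : Subgroup (FreeGroup α)} {p w : FreeGroup α}
    (H : ∀ a ∈ Γ, a ≠ 1 → Rd (p⁻¹ * a * p) w) :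
    ∀ a ∈ Γ.comap (MulAut.conj p).toMonoidHom, a ≠ 1 → Rd a w := by
  intro a ha ha1
  have ha' : p * a * p⁻¹ ∈ Γ := by simpa using ha
  have := H _ ha' (by simpa using ha1)
  rwa [show p⁻¹ * (p * a * p⁻¹) * p = a by group] at this

lemma amal_ball {Γ : Subgroup (FreeGroup α)} {h p w q : FreeGroup α} (hh : h = p * w * q⁻¹)
    (hw : w ≠ 1) (HA : ∀ a ∈ Γ, a ≠ 1 → Rd (p⁻¹ * a * p) w)
    (HB : ∀ b ∈ Γ, b ≠ 1 → Rd (q⁻¹ * b * q) w⁻¹) {x : FreeGroup α}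
    (hx : x ∈ amal Γ h)
    (hn : FreeGroup.norm x + 2 * FreeGroup.norm p < 2 * FreeGroup.norm w) : x ∈ Γ := by
  obtain ⟨k, hk⟩ := amal_nf hh hw (comap_rd HA) (comap_rd HB) hx
  cases k with
  | zero =>
    cases hk with
    | base _ ha =>
      have : p * (p⁻¹ * x * p) * p⁻¹ ∈ Γ := ha
      rwa [show p * (p⁻¹ * x * p) * p⁻¹ = x by group] at this
  | succ k =>
    obtain ⟨a, ha, b, hb, u, hu, -, h2⟩ := nf_succ_norm hw (comap_rd HA) (comap_rd HB) hk
    have h3 := FreeGroup.norm_mul_le (p⁻¹ * x) p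
    have h4 := FreeGroup.norm_mul_le p⁻¹ x
    rw [FreeGroup.norm_inv_eq] at h4
    omega

lemma amal_Zs {Γ : Subgroup (FreeGroup α)} {h p w q : FreeGroup α} (hh : h = p * w * q⁻¹)
    (hw : w ≠ 1) (HA : ∀ a ∈ Γ, a ≠ 1 → Rd (p⁻¹ * a * p) w)
    (HB : ∀ b ∈ Γ, b ≠ 1 → Rd (q⁻¹ * b * q) w⁻¹) {t : ℝ≥0∞} (ht0 : t ≠ 0) (ht1 : t ≤ 1)
    {K L : ℕ} (hp : FreeGroup.norm p ≤ K) (hq : FreeGroup.norm q ≤ K)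
    (hL : L ≤ FreeGroup.norm w) {z : ℝ≥0∞} (hz : t⁻¹ ^ (2 * K) * Zs t (Γ : Set (FreeGroup α)) ≤ z)
    (hsmall : z * (z * t ^ L) ≤ 2⁻¹) :
    Zs t (amal Γ h : Set (FreeGroup α)) ≤ Zs t (Γ : Set (FreeGroup α)) + t⁻¹ ^ (2 * K) * (z * (z * (z * t ^ L) * 2)) := by
  set A := Γ.comap (MulAut.conj p).toMonoidHom with hA
  set B := Γ.comap (MulAut.conj q).toMonoidHom with hB
  have hZ : ∀ p : FreeGroup α, FreeGroup.norm p ≤ K →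
      Zs t (Γ.comap (MulAut.conj p).toMonoidHom : Set (FreeGroup α)) ≤ z := by
    intro p hp
    refine le_trans ?_ ((Zs_conj ht0 ht1 (p := p⁻¹) (by simpa using hp) Γ).trans hz)
    apply Zs_mono
    intro x hx
    simpa using hx
  set y := z * (z * t ^ L) with hy
  have hN : ∀ k, Zs t {x | NF A B w k x} ≤ z * y ^ k := by
    intro k
    induction k with
    | zero =>
      rw [pow_zero, mul_one]
      refine le_trans (Zs_mono t ?_) (hZ p hp)
      intro x hx
      cases hx with
      | base _ ha => exact ha
    | succ k ih =>
      refine (Zs_nf_succ t hw (comap_rd HA) (comap_rd HB) k).trans ?_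
      calc _ ≤ z * (z * (z * y ^ k * t ^ L)) := by
            have hwL : t ^ (2 * FreeGroup.norm w) ≤ t ^ L :=
              pow_le_pow_right_of_le_one' ht1 (by omega)
            exact mul_le_mul' (hZ p hp) (mul_le_mul' (hZ q hq) (mul_le_mul' ih hwL))
        _ = z * y ^ (k + 1) := by rw [hy]; ring
  have hsub : (amal Γ h : Set (FreeGroup α)) ⊆
      (Γ : Set (FreeGroup α)) ∪ ⋃ k, {x | p⁻¹ * x * p ∈ {x | NF A B w (k + 1) x}} := by
    intro x hx
    obtain ⟨k, hk⟩ := amal_nf hh hw (comap_rd HA) (comap_rd HB) hx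
    cases k with
    | zero =>
      left
      cases hk with
      | base _ ha =>
        have : p * (p⁻¹ * x * p) * p⁻¹ ∈ Γ := ha
        rwa [show p * (p⁻¹ * x * p) * p⁻¹ = x by group] at this
    | succ k =>
      right
      exact Set.mem_iUnion.2 ⟨k, hk⟩
  refine (Zs_mono t hsub).trans ((ENNReal.tsum_union_le
    (fun x : FreeGroup α => t ^ FreeGroup.norm x) _ _).trans ?_)
  refine add_le_add le_rfl ((ENNReal.tsum_iUnion_le_tsum
    (fun x : FreeGroup α => t ^ FreeGroup.norm x) _).trans ?_)
  calc _ ≤ ∑' k : ℕ, t⁻¹ ^ (2 * K) * (z * y ^ (k + 1)) := by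
        refine ENNReal.tsum_le_tsum fun k => ?_
        refine (Zs_conj ht0 ht1 hp _).trans ?_
        gcongr
        exact hN (k + 1)
    _ = t⁻¹ ^ (2 * K) * (z * (y * (1 - y)⁻¹)) := by
        rw [ENNReal.tsum_mul_left, ENNReal.tsum_mul_left, ENNReal.tsum_geometric_add_one]
    _ ≤ _ := by
        gcongr
        rw [ENNReal.inv_le_iff_inv_le]
        apply ENNReal.le_sub_of_add_le_right (hsmall.trans_lt (by simp)).ne
        calc 2⁻¹ + y ≤ 2⁻¹ + 2⁻¹ := by gcongr
          _ = 1 := ENNReal.inv_two_add_inv_two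

lemma step_exists [Finite α] {Γ : Subgroup (FreeGroup α)} (hΓ : Γ.FG) {t : ℝ≥0∞} (ht0 : t ≠ 0)
    (ht1 : t < 1) (hZ : Zs t (Γ : Set (FreeGroup α)) ≠ ⊤) (g : FreeGroup α) (ρ N : ℕ) {η : ℝ≥0∞}
    (hη : η ≠ 0) :
    ∃ Γ' : Subgroup (FreeGroup α), Γ ≤ Γ' ∧ Γ'.FG ∧ Zs t (Γ' : Set (FreeGroup α)) ≤ Zs t (Γ : Set (FreeGroup α)) + η ∧
      (∀ x ∈ Γ', FreeGroup.norm x ≤ ρ → x ∈ Γ) ∧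
      ∃ n, N ≤ n ∧ ∀ x, FreeGroup.norm x ≤ ρ → (g ^ n * x * (g ^ n)⁻¹ ∈ Γ' ↔ x ∈ Γ) := by
  by_cases hg : ∃ m : ℕ, 0 < m ∧ g ^ m ∈ Γ
  · obtain ⟨m, hm, hgm⟩ := hg
    refine ⟨Γ, le_rfl, hΓ, le_self_add, fun x hx _ => hx, m * N, Nat.le_mul_of_pos_left N hm, ?_⟩
    intro x _
    have : g ^ (m * N) ∈ Γ := by rw [pow_mul]; exact pow_mem hgm N
    rw [Subgroup.mul_mem_cancel_right _ (inv_mem this), Subgroup.mul_mem_cancel_left _ this]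
  push Not at hg
  obtain ⟨K, hK⟩ := exists_decomp hΓ g hg
  have htop : t ≠ ⊤ := (ht1.trans ENNReal.one_lt_top).ne
  set c := t⁻¹ ^ (2 * K) with hc
  have hctop : c ≠ ⊤ := ENNReal.pow_ne_top (ENNReal.inv_ne_top.2 ht0)
  set z := c * Zs t (Γ : Set (FreeGroup α)) with hz
  have hztop : z ≠ ⊤ := ENNReal.mul_ne_top hctop hZ
  have hlim : Tendsto (fun L : ℕ => t ^ L) atTop (nhds 0) :=
    ENNReal.tendsto_pow_atTop_nhds_zero_of_lt_one ht1
  have hl1 : Tendsto (fun L : ℕ => z * (z * t ^ L)) atTop (nhds 0) := by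
    have := ENNReal.Tendsto.const_mul (ENNReal.Tendsto.const_mul hlim (Or.inr hztop))
      (Or.inr hztop)
    simpa using this
  have hl2 : Tendsto (fun L : ℕ => c * (z * (z * (z * t ^ L) * 2))) atTop (nhds 0) := by
    have := ENNReal.Tendsto.const_mul (ENNReal.Tendsto.const_mul
      (ENNReal.Tendsto.mul_const hl1 (b := 2) (Or.inr (by simp))) (Or.inr hztop)) (Or.inr hctop)
    simpa using this
  have e1 := hl1.eventually_le_const (u := (2⁻¹ : ℝ≥0∞))
    (ENNReal.inv_pos.2 ENNReal.ofNat_ne_top)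
  have e2 := hl2.eventually_le_const (u := η) (pos_iff_ne_zero.2 hη)
  obtain ⟨L, hL1, hL2, hL3⟩ := (e1.and (e2.and (eventually_ge_atTop (ρ + 2 * K + 1)))).exists
  obtain ⟨n, hn, p, w, q, hgn, hp, hq, hw, hw1, HA, HB⟩ := hK L N
  refine ⟨amal Γ (g ^ n), le_sup_left, amal_fg hΓ _, ?_, ?_, n, hn, ?_⟩
  · exact (amal_Zs hgn hw1 HA HB ht0 ht1.le hp hq hw le_rfl hL1).trans (by gcongr)
  · intro x hx hxr
    exact amal_ball hgn hw1 HA HB hx (by omega)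
  · intro x hxr
    constructor
    · intro hx
      apply amal_ball (h := (g ^ n)⁻¹) (p := q) (w := w⁻¹) (q := p) (by rw [hgn]; group)
        (by simpa using hw1) HB (by rw [inv_inv]; exact HA) (x := x) ?_
        (by rw [FreeGroup.norm_inv_eq]; omega)
      have hle : (amal Γ (g ^ n)).map (MulAut.conj (g ^ n)⁻¹).toMonoidHom ≤ amal Γ (g ^ n)⁻¹ := by
        unfold amal
        rw [Subgroup.map_sup, Subgroup.map_map]
        apply sup_le le_sup_right
        refine le_trans ?_ le_sup_left
        rintro _ ⟨y, hy, rfl⟩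
        simpa [mul_assoc] using hy
      apply hle
      exact ⟨_, hx, by
        change (g ^ n)⁻¹ * (g ^ n * x * (g ^ n)⁻¹) * ((g ^ n)⁻¹)⁻¹ = x
        group⟩
    · intro hx
      exact (le_sup_right : _ ≤ amal Γ (g ^ n)) ⟨x, hx, rfl⟩

end PingPong

section Growth

open scoped ENNReal

variable {d : ℕ}

lemma growth_finite (Γ : Subgroup (FreeGroup (Fin d))) (R : ℕ) :
    {g : FreeGroup (Fin d) | g ∈ Γ ∧ FreeGroup.norm g ≤ R}.Finite :=
  (ball_finite R).subset fun _ h => h.2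

instance growth_inst (Γ : Subgroup (FreeGroup (Fin d))) (R : ℕ) :
    Finite {g : FreeGroup (Fin d) // g ∈ Γ ∧ FreeGroup.norm g ≤ R} := growth_finite Γ R

lemma growth_pos (Γ : Subgroup (FreeGroup (Fin d))) (R : ℕ) : 1 ≤ growthCount Γ R := by
  unfold growthCount
  have : Nonempty {g : FreeGroup (Fin d) // g ∈ Γ ∧ FreeGroup.norm g ≤ R} :=
    ⟨⟨1, one_mem _, by simp⟩⟩
  exact Nat.card_pos

lemma growth_mono {Γ Δ : Subgroup (FreeGroup (Fin d))} {R : ℕ}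
    (h : ∀ g ∈ Γ, FreeGroup.norm g ≤ R → g ∈ Δ) : growthCount Γ R ≤ growthCount Δ R := by
  unfold growthCount
  refine Nat.card_le_card_of_injective
    (fun x : {g : FreeGroup (Fin d) // g ∈ Γ ∧ FreeGroup.norm g ≤ R} =>
      (⟨x.1, h _ x.2.1 x.2.2, x.2.2⟩ : {g : FreeGroup (Fin d) // g ∈ Δ ∧ FreeGroup.norm g ≤ R})) ?_
  intro x y hxy
  apply Subtype.ext
  simpa using hxy

lemma growth_le (Γ : Subgroup (FreeGroup (Fin d))) (R : ℕ) :
    growthCount Γ R ≤ (d * 2 + 1) ^ R := by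
  unfold growthCount
  have : Nat.card (Fin R → Option (Fin d × Bool)) = (d * 2 + 1) ^ R := by
    simp
  rw [← this]
  refine Nat.card_le_card_of_injective (fun x i => x.1.toWord[(i : ℕ)]?) ?_
  intro x y hxy
  apply Subtype.ext
  apply FreeGroup.toWord_injective
  apply List.ext_getElem?
  intro i
  by_cases hi : i < R
  · exact congrFun hxy ⟨i, hi⟩
  · have hx : x.1.toWord.length ≤ R := x.2.2
    have hy : y.1.toWord.length ≤ R := y.2.2
    rw [List.getElem?_eq_none (by omega), List.getElem?_eq_none (by omega)]

lemma quot_nonneg (Γ : Subgroup (FreeGroup (Fin d))) (R : ℕ) :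
    0 ≤ Real.log (growthCount Γ R : ℝ) / (R : ℝ) := by
  have := growth_pos Γ R
  apply div_nonneg (Real.log_nonneg (by exact_mod_cast this)) (by positivity)

lemma quot_le (Γ : Subgroup (FreeGroup (Fin d))) (R : ℕ) :
    Real.log (growthCount Γ R : ℝ) / (R : ℝ) ≤ Real.log (d * 2 + 1) := by
  have h0 : 0 ≤ Real.log ((d : ℝ) * 2 + 1) := Real.log_nonneg (by
    have : (0 : ℝ) ≤ d := by positivity
    linarith)
  apply div_le_of_le_mul₀ (by positivity) h0
  rw [mul_comm, ← Real.log_pow]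
  have h1 := growth_pos Γ R
  apply Real.log_le_log (by exact_mod_cast h1)
  exact_mod_cast growth_le Γ R

lemma quot_bdd (Γ : Subgroup (FreeGroup (Fin d))) :
    IsBoundedUnder (· ≤ ·) atTop fun R : ℕ => Real.log (growthCount Γ R : ℝ) / (R : ℝ) :=
  isBoundedUnder_of ⟨_, quot_le Γ⟩

lemma quot_cobdd (Γ : Subgroup (FreeGroup (Fin d))) :
    IsCoboundedUnder (· ≤ ·) atTop fun R : ℕ => Real.log (growthCount Γ R : ℝ) / (R : ℝ) :=
  IsBoundedUnder.isCoboundedUnder_le (isBoundedUnder_of ⟨0, quot_nonneg Γ⟩)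

lemma critExp_nonneg (Γ : Subgroup (FreeGroup (Fin d))) : 0 ≤ critExp Γ :=
  le_limsup_of_frequently_le (Frequently.of_forall (quot_nonneg Γ)) (quot_bdd Γ)

lemma critExp_mono {Γ Δ : Subgroup (FreeGroup (Fin d))} (h : Γ ≤ Δ) : critExp Γ ≤ critExp Δ := by
  refine limsup_le_limsup (Eventually.of_forall fun R => ?_) (quot_cobdd Γ) (quot_bdd Δ)
  have h1 := growth_pos Γ R
  have h2 := growth_mono (R := R) (fun g hg (_ : FreeGroup.norm g ≤ R) => h hg)
  apply div_le_div_of_nonneg_right _ (by positivity)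
  apply Real.log_le_log (by exact_mod_cast h1)
  exact_mod_cast h2

lemma growth_mul (Γ : Subgroup (FreeGroup (Fin d))) (R : ℕ) (c : ℝ≥0∞) :
    ∑' _ : {g : FreeGroup (Fin d) | g ∈ Γ ∧ FreeGroup.norm g ≤ R}, c = growthCount Γ R * c := by
  have : Fintype {g : FreeGroup (Fin d) | g ∈ Γ ∧ FreeGroup.norm g ≤ R} :=
    (growth_finite Γ R).fintype
  rw [tsum_fintype, Finset.sum_const, nsmul_eq_mul]
  congr 2
  unfold growthCount
  rw [Finset.card_univ, ← Nat.card_eq_fintype_card]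
  rfl

lemma growth_le_Zs {t : ℝ≥0∞} (ht : t ≤ 1) (Γ : Subgroup (FreeGroup (Fin d))) (R : ℕ) :
    growthCount Γ R * t ^ R ≤ Zs t (Γ : Set (FreeGroup (Fin d))) := by
  rw [← growth_mul]
  refine le_trans (ENNReal.tsum_le_tsum fun x => ?_) (Zs_mono t
    (E := {g : FreeGroup (Fin d) | g ∈ Γ ∧ FreeGroup.norm g ≤ R}) fun x hx => hx.1)
  exact pow_le_pow_right_of_le_one' ht x.2.2

lemma Zs_le_growth (t : ℝ≥0∞) (Γ : Subgroup (FreeGroup (Fin d))) :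
    Zs t (Γ : Set (FreeGroup (Fin d))) ≤ ∑' R : ℕ, growthCount Γ R * t ^ R := by
  have hsub : (Γ : Set (FreeGroup (Fin d))) ⊆ ⋃ R : ℕ, {g | g ∈ Γ ∧ FreeGroup.norm g = R} := by
    intro x hx
    exact Set.mem_iUnion.2 ⟨_, hx, rfl⟩
  refine (Zs_mono t hsub).trans ((ENNReal.tsum_iUnion_le_tsum
    (fun x : FreeGroup (Fin d) => t ^ FreeGroup.norm x) _).trans ?_)
  refine ENNReal.tsum_le_tsum fun R => ?_
  rw [← growth_mul]
  calc ∑' x : {g | g ∈ Γ ∧ FreeGroup.norm g = R}, t ^ FreeGroup.norm x.1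
      = ∑' x : {g | g ∈ Γ ∧ FreeGroup.norm g = R}, t ^ R := by
        congr 1
        funext x
        rw [x.2.2]
    _ ≤ _ := ENNReal.tsum_mono_subtype (fun _ => t ^ R)
        (s := {g : FreeGroup (Fin d) | g ∈ Γ ∧ FreeGroup.norm g = R})
        (t := {g : FreeGroup (Fin d) | g ∈ Γ ∧ FreeGroup.norm g ≤ R})
        fun x hx => ⟨hx.1, hx.2.le⟩

lemma Zs_ne_top {Γ : Subgroup (FreeGroup (Fin d))} {s : ℝ} (hs : critExp Γ < s) :
    Zs (ENNReal.ofReal (Real.exp (-s))) (Γ : Set (FreeGroup (Fin d))) ≠ ⊤ := by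
  refine ne_top_of_le_ne_top ?_ (Zs_le_growth _ Γ)
  obtain ⟨s', h1, h2⟩ := exists_between hs
  have hev := eventually_lt_of_limsup_lt h1 (quot_bdd Γ)
  have hg : Summable fun R : ℕ => (Real.exp (s' - s)) ^ R :=
    summable_geometric_of_lt_one (Real.exp_pos _).le (by rw [Real.exp_lt_one_iff]; linarith)
  have hsum : Summable fun R : ℕ => (growthCount Γ R : ℝ) * Real.exp (-s) ^ R := by
    refine Summable.of_norm_bounded_eventually_nat hg ?_
    filter_upwards [hev, eventually_gt_atTop 0] with R hR hR0
    have hR0' : (0 : ℝ) < R := by exact_mod_cast hR0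
    rw [div_lt_iff₀ hR0'] at hR
    have hpos : (0 : ℝ) < growthCount Γ R := by
      have := growth_pos Γ R
      exact_mod_cast this
    have h3 : (growthCount Γ R : ℝ) ≤ Real.exp s' ^ R := by
      rw [← Real.exp_nat_mul, mul_comm, ← Real.log_le_iff_le_exp hpos]
      exact hR.le
    rw [Real.norm_of_nonneg (by positivity), sub_eq_add_neg, Real.exp_add, mul_pow]
    gcongr
  have := hsum.tsum_ofReal_ne_top
  convert this using 3 with R
  rw [ENNReal.ofReal_mul (by positivity), ENNReal.ofReal_pow (Real.exp_pos _).le,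
    ENNReal.ofReal_natCast]

lemma critExp_le {Δ : Subgroup (FreeGroup (Fin d))} {s : ℝ} {Z : ℝ≥0∞} (hZ : Z ≠ ⊤)
    (h : ∀ R, growthCount Δ R * (ENNReal.ofReal (Real.exp (-s))) ^ R ≤ Z) : critExp Δ ≤ s := by
  have hreal : ∀ R, Real.log (growthCount Δ R : ℝ) ≤ Real.log Z.toReal + R * s := by
    intro R
    have h1 := ENNReal.toReal_mono hZ (h R)
    rw [ENNReal.toReal_mul, ENNReal.toReal_pow, ENNReal.toReal_natCast,
      ENNReal.toReal_ofReal (Real.exp_pos _).le, ← Real.exp_nat_mul] at h1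
    have hpos : (0 : ℝ) < growthCount Δ R := by
      have := growth_pos Δ R
      exact_mod_cast this
    have h2 := Real.log_le_log (by positivity) h1
    rw [Real.log_mul hpos.ne' (Real.exp_pos _).ne', Real.log_exp] at h2
    linarith
  have hlim : Tendsto (fun R : ℕ => Real.log Z.toReal / (R : ℝ) + s) atTop (nhds s) := by
    have := (tendsto_const_div_atTop_nhds_zero_nat (Real.log Z.toReal)).add_const s
    simpa using this
  rw [← hlim.limsup_eq]
  refine limsup_le_limsup ?_ (quot_cobdd Δ) hlim.isBoundedUnder_le
  filter_upwards [eventually_gt_atTop 0] with R hR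
  have hR0' : (0 : ℝ) < R := by exact_mod_cast hR
  rw [div_le_iff₀ hR0', add_mul, div_mul_cancel₀ _ hR0'.ne']
  linarith [hreal R]

end Growth

theorem boomerang_close_to_fg_subgroup (d : ℕ) (hd : 2 ≤ d)
    (Γ : Subgroup (FreeGroup (Fin d))) (hΓ : Γ.FG)
    (S : Finset (FreeGroup (Fin d))) (ε : ℝ) (hε : 0 < ε) :
    ∃ Δ : Subgroup (FreeGroup (Fin d)), IsBoomerang Δ ∧
      (∀ g ∈ S, g ∈ Δ ↔ g ∈ Γ) ∧
      critExp Γ ≤ critExp Δ ∧ critExp Δ ≤ critExp Γ + ε := by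
  classical
  set s := critExp Γ + ε with hs
  have hspos : 0 < s := by have := critExp_nonneg Γ; linarith
  set t := ENNReal.ofReal (Real.exp (-s)) with ht
  have ht0 : t ≠ 0 := by simp [ht, Real.exp_pos]
  have ht1 : t < 1 := by
    rw [ht, ENNReal.ofReal_lt_one, Real.exp_lt_one_iff]
    linarith
  have hZ0 : Zs t (Γ : Set (FreeGroup (Fin d))) ≠ ⊤ := Zs_ne_top (by linarith)
  have hcount : Countable (FreeGroup (Fin d)) := FreeGroup.toWord_injective.countable
  obtain ⟨e0, he0⟩ := exists_surjective_nat (FreeGroup (Fin d))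
  let e : ℕ → FreeGroup (Fin d) := fun k => e0 (Nat.unpair k).1
  -- the inductive step
  have hstep : ∀ (k : ℕ) (P : {P : Subgroup (FreeGroup (Fin d)) × ℕ //
      P.1.FG ∧ Zs t (P.1 : Set (FreeGroup (Fin d))) ≠ ⊤}),
      ∃ Q : {P : Subgroup (FreeGroup (Fin d)) × ℕ //
        P.1.FG ∧ Zs t (P.1 : Set (FreeGroup (Fin d))) ≠ ⊤},
      P.1.1 ≤ Q.1.1 ∧ Zs t (Q.1.1 : Set (FreeGroup (Fin d))) ≤
        Zs t (P.1.1 : Set (FreeGroup (Fin d))) + 2⁻¹ ^ k ∧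
      (∀ x ∈ Q.1.1, FreeGroup.norm x ≤ P.1.2 → x ∈ P.1.1) ∧ P.1.2 + 1 ≤ Q.1.2 ∧
      ∃ n, k ≤ n ∧ ∀ x, FreeGroup.norm x ≤ P.1.2 →
        ((((e k)⁻¹ ^ n * x * ((e k)⁻¹ ^ n)⁻¹) ∈ Q.1.1 ↔ x ∈ P.1.1) ∧
          FreeGroup.norm ((e k)⁻¹ ^ n * x * ((e k)⁻¹ ^ n)⁻¹) ≤ Q.1.2) := by
    rintro k ⟨⟨Λ, ρ⟩, hFG, hZ⟩
    obtain ⟨Λ', h1, h2, h3, h4, n, hn, h5⟩ := step_exists hFG ht0 ht1 hZ (e k)⁻¹ ρ k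
      (η := 2⁻¹ ^ k) (by simp)
    refine ⟨⟨⟨Λ', ρ + 1 + 2 * FreeGroup.norm ((e k)⁻¹ ^ n)⟩, h2, ?_⟩, h1, h3, h4, ?_, n, hn, ?_⟩
    · exact ne_top_of_le_ne_top (ENNReal.add_ne_top.2 ⟨hZ, ENNReal.pow_ne_top (by simp)⟩) h3
    · simp only
      omega
    · intro x hx
      refine ⟨h5 x hx, ?_⟩
      have a1 := FreeGroup.norm_mul_le ((e k)⁻¹ ^ n * x) ((e k)⁻¹ ^ n)⁻¹
      have a2 := FreeGroup.norm_mul_le ((e k)⁻¹ ^ n) x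
      rw [FreeGroup.norm_inv_eq] at a1
      simp only at hx ⊢
      omega
  choose next hle hZs hball hrad hconj using hstep
  let f : ℕ → {P : Subgroup (FreeGroup (Fin d)) × ℕ //
      P.1.FG ∧ Zs t (P.1 : Set (FreeGroup (Fin d))) ≠ ⊤} :=
    fun k => Nat.rec ⟨⟨Γ, S.sup FreeGroup.norm⟩, hΓ, hZ0⟩ next k
  have hf0 : f 0 = ⟨⟨Γ, S.sup FreeGroup.norm⟩, hΓ, hZ0⟩ := rfl
  have hfs : ∀ k, f (k + 1) = next k (f k) := fun _ => rfl
  let G : ℕ → Subgroup (FreeGroup (Fin d)) := fun k => (f k).1.1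
  let ρ : ℕ → ℕ := fun k => (f k).1.2
  have hGmono : Monotone G := monotone_nat_of_le_succ fun k => by
    simp only [G]
    rw [hfs]
    exact hle k (f k)
  have hρs : ∀ k, ρ k + 1 ≤ ρ (k + 1) := fun k => by
    simp only [ρ]
    rw [hfs]
    exact hrad k (f k)
  have hρmono : Monotone ρ := monotone_nat_of_le_succ fun k => by have := hρs k; omega
  have hρk : ∀ k, k ≤ ρ k := by
    intro k
    induction k with
    | zero => exact Nat.zero_le _
    | succ k ih => have := hρs k; omega
  have hGball : ∀ k, ∀ x ∈ G (k + 1), FreeGroup.norm x ≤ ρ k → x ∈ G k := fun k x hx hxr => by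
    simp only [G] at hx
    rw [hfs] at hx
    exact hball k (f k) x hx hxr
  have hdesc : ∀ j k, ∀ x ∈ G (k + j), FreeGroup.norm x ≤ ρ k → x ∈ G k := by
    intro j
    induction j with
    | zero => intro k x hx _; exact hx
    | succ j ih =>
      intro k x hx hxr
      exact ih k x (hGball (k + j) x hx (hxr.trans (hρmono (Nat.le_add_right k j)))) hxr
  have hmem : ∀ x, x ∈ (⨆ k, G k) ↔ ∃ k, x ∈ G k := fun x =>
    Subgroup.mem_iSup_of_directed hGmono.directed_le
  have hΔ : ∀ k x, FreeGroup.norm x ≤ ρ k → (x ∈ (⨆ k, G k) ↔ x ∈ G k) := by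
    intro k x hxr
    rw [hmem]
    constructor
    · rintro ⟨m, hm⟩
      exact hdesc m k x (hGmono (Nat.le_add_left m k) hm) hxr
    · exact fun h => ⟨k, h⟩
  have hZk : ∀ k, Zs t (G k : Set (FreeGroup (Fin d))) ≤
      Zs t (Γ : Set (FreeGroup (Fin d))) + ∑ j ∈ Finset.range k, (2⁻¹ : ENNReal) ^ j := by
    intro k
    induction k with
    | zero => simp [G, hf0]
    | succ k ih =>
      rw [Finset.sum_range_succ, ← add_assoc]
      have h1 := hZs k (f k)
      rw [← hfs] at h1
      exact h1.trans (by gcongr)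
  refine ⟨⨆ k, G k, ?_, ?_, critExp_mono (le_iSup G 0), ?_⟩
  · intro g
    have hfreq : ∀ j : ℕ, ∃ᶠ n in atTop, ∀ x, FreeGroup.norm x ≤ j →
        (x ∈ Subgroup.map (MulAut.conj (g ^ n)).toMonoidHom (⨆ k, G k) ↔ x ∈ (⨆ k, G k)) := by
      intro j
      rw [frequently_atTop]
      intro N
      obtain ⟨i, hi⟩ := he0 g
      have hek : e (Nat.pair i (max j N)) = g := by simp [e, hi]
      set k := Nat.pair i (max j N) with hk
      have hkle : max j N ≤ k := Nat.right_le_pair _ _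
      obtain ⟨n, hn, hx⟩ := hconj k (f k)
      rw [hek, ← hfs] at hx
      refine ⟨n, (le_max_right j N).trans (hkle.trans hn), fun x hxj => ?_⟩
      have hxρ : FreeGroup.norm x ≤ ρ k :=
        hxj.trans ((le_max_left j N).trans (hkle.trans (hρk k)))
      obtain ⟨h1, h2⟩ := hx x hxρ
      rw [hΔ k x hxρ]
      refine Iff.trans ?_ h1
      refine Iff.trans ?_ (hΔ (k + 1) _ h2)
      constructor
      · rintro ⟨y, hy, rfl⟩
        have e : g⁻¹ ^ n * ((MulAut.conj (g ^ n)).toMonoidHom y) * (g⁻¹ ^ n)⁻¹ = y := by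
          change g⁻¹ ^ n * (g ^ n * y * (g ^ n)⁻¹) * (g⁻¹ ^ n)⁻¹ = y
          rw [inv_pow]
          group
        rw [e]
        exact hy
      · intro hy
        refine ⟨_, hy, ?_⟩
        change g ^ n * (g⁻¹ ^ n * x * (g⁻¹ ^ n)⁻¹) * (g ^ n)⁻¹ = x
        rw [inv_pow]
        group
    obtain ⟨φ, hφ, hP⟩ := extraction_forall_of_frequently hfreq
    refine ⟨φ, hφ, fun x => ?_⟩
    filter_upwards [eventually_ge_atTop (FreeGroup.norm x)] with j hj
    exact hP j x hj
  · intro x hx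
    exact hΔ 0 x (Finset.le_sup (f := FreeGroup.norm) hx)
  · refine critExp_le (Z := Zs t (Γ : Set (FreeGroup (Fin d))) + ∑' j : ℕ, (2⁻¹ : ENNReal) ^ j)
      (ENNReal.add_ne_top.2 ⟨hZ0, ?_⟩) ?_
    · rw [ENNReal.tsum_geometric]
      simp
    · intro R
      have h1 : growthCount (⨆ k, G k) R ≤ growthCount (G R) R :=
        growth_mono fun x hx hxr => (hΔ R x (hxr.trans (hρk R))).1 hx
      calc (growthCount (⨆ k, G k) R : ENNReal) * t ^ R ≤ growthCount (G R) R * t ^ R := by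
            gcongr
        _ ≤ Zs t (G R : Set (FreeGroup (Fin d))) := growth_le_Zs ht1.le _ _
        _ ≤ _ := hZk R
        _ ≤ _ := by
            gcongr
            exact ENNReal.sum_le_tsum _
end

section
/- Let d ≥ 2. The set of critical exponents of boomerang subgroups of F_d, i.e. {δ(Δ) : Δ a boomerang subgroup of F_d}, is dense in the interval [0, log(2d−1)]; equivalently, the set of growth rates {exp(δ(Δ)) : Δ a boomerang subgroup of F_d} is dense in [1, 2d−1]. -/
open Filter

section

open Filter
open scoped ENNReal
set_option autoImplicit false

abbrev FG (d : ℕ) := FreeGroup (Fin d)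

/-- Poincare series of a set. -/
noncomputable def pois {d : ℕ} (u : ℝ≥0∞) (X : Set (FG d)) : ℝ≥0∞ :=
  ∑' g : X, u ^ (FreeGroup.norm (g : FG d))

lemma ball_finite_s1 {d : ℕ} (R : ℕ) : {g : FG d | FreeGroup.norm g ≤ R}.Finite := by
  have h := List.finite_length_le (Fin d × Bool) R
  exact Set.Finite.of_injOn (f := FreeGroup.toWord) (fun g hg => hg)
    (FreeGroup.toWord_injective.injOn) h

lemma pois_mono {d : ℕ} (u : ℝ≥0∞) {X Y : Set (FG d)} (h : X ⊆ Y) : pois u X ≤ pois u Y := by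
  unfold pois
  exact ENNReal.tsum_mono_subtype (fun g : FG d => u ^ (FreeGroup.norm g)) h

lemma pois_mono_u {d : ℕ} {u v : ℝ≥0∞} (huv : u ≤ v) (X : Set (FG d)) : pois u X ≤ pois v X := by
  unfold pois
  exact ENNReal.tsum_le_tsum (fun g => pow_le_pow_left₀ (zero_le) huv _)

lemma growthCount_pos {d : ℕ} (Γ : Subgroup (FG d)) (R : ℕ) : 1 ≤ growthCount Γ R := by
  unfold growthCount
  have : Finite {g : FG d // g ∈ Γ ∧ FreeGroup.norm g ≤ R} :=
    ((ball_finite_s1 (d := d) R).subset (fun g hg => hg.2)).to_subtype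
  have : Nonempty {g : FG d // g ∈ Γ ∧ FreeGroup.norm g ≤ R} :=
    ⟨⟨1, Γ.one_mem, by simp⟩⟩
  exact Nat.card_pos

lemma growthCount_mul_le {d : ℕ} (Γ : Subgroup (FG d)) (R : ℕ) (u : ℝ≥0∞) (hu : u ≤ 1) :
    (growthCount Γ R : ℝ≥0∞) * u ^ R ≤ pois u (Γ : Set (FG d)) := by
  have hfin : ({g : FG d | g ∈ Γ ∧ FreeGroup.norm g ≤ R}).Finite :=
    ((ball_finite_s1 (d := d) R).subset (fun g hg => hg.2))
  have hfin' : Finite {g : FG d // g ∈ Γ ∧ FreeGroup.norm g ≤ R} := hfin.to_subtype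
  have : Fintype {g : FG d // g ∈ Γ ∧ FreeGroup.norm g ≤ R} := Fintype.ofFinite _
  calc (growthCount Γ R : ℝ≥0∞) * u ^ R
      = ∑' g : {g : FG d // g ∈ Γ ∧ FreeGroup.norm g ≤ R}, u ^ R := by
        rw [tsum_fintype]; simp [growthCount, Nat.card_eq_fintype_card]
    _ ≤ ∑' g : {g : FG d // g ∈ Γ ∧ FreeGroup.norm g ≤ R}, u ^ (FreeGroup.norm (g : FG d)) :=
        ENNReal.tsum_le_tsum (fun g => pow_le_pow_right_of_le_one' hu g.2.2)
    _ ≤ pois u (Γ : Set (FG d)) := by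
        exact ENNReal.tsum_mono_subtype (s := {g : FG d | g ∈ Γ ∧ FreeGroup.norm g ≤ R})
          (t := (Γ : Set (FG d))) (fun g : FG d => u ^ (FreeGroup.norm g)) (fun g hg => hg.1)

lemma log_growth_le {d : ℕ} (Γ : Subgroup (FG d)) (u : ℝ) (hu : 0 < u) (hu1 : u < 1)
    (h : pois (ENNReal.ofReal u) (Γ : Set (FG d)) ≠ ∞) (R : ℕ) (hR : 1 ≤ R) :
    Real.log (growthCount Γ R : ℝ) / (R : ℝ) ≤
      Real.log (pois (ENNReal.ofReal u) (Γ : Set (FG d))).toReal / R - Real.log u := by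
  have h1 := growthCount_mul_le Γ R (ENNReal.ofReal u) (by simpa using hu1.le)
  have h2 := ENNReal.toReal_mono h h1
  rw [ENNReal.toReal_mul, ENNReal.toReal_pow, ENNReal.toReal_ofReal hu.le] at h2
  simp only [ENNReal.toReal_natCast] at h2
  have hc : (0:ℝ) < growthCount Γ R := by exact_mod_cast growthCount_pos Γ R
  have h3 := Real.log_le_log (by positivity) h2
  rw [Real.log_mul (by positivity) (by positivity), Real.log_pow] at h3
  have hR' : (0:ℝ) < R := by exact_mod_cast hR
  rw [div_le_iff₀ hR', sub_mul, div_mul_cancel₀ _ hR'.ne']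
  linarith

lemma log_growth_nonneg {d : ℕ} (Γ : Subgroup (FG d)) (R : ℕ) :
    0 ≤ Real.log (growthCount Γ R : ℝ) / (R : ℝ) := by
  have hc : (1:ℝ) ≤ growthCount Γ R := by exact_mod_cast growthCount_pos Γ R
  have := Real.log_nonneg hc
  positivity

lemma tendsto_aux (b c : ℝ) : Tendsto (fun R : ℕ => b / (R:ℝ) - c) atTop (nhds (-c)) := by
  have := (tendsto_const_div_atTop_nhds_zero_nat b).sub_const c
  simpa using this

lemma critExp_le_s1 {d : ℕ} (Γ : Subgroup (FG d)) (u : ℝ) (hu : 0 < u) (hu1 : u < 1)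
    (h : pois (ENNReal.ofReal u) (Γ : Set (FG d)) ≠ ∞) : critExp Γ ≤ - Real.log u := by
  unfold critExp
  have ht := tendsto_aux (Real.log (pois (ENNReal.ofReal u) (Γ : Set (FG d))).toReal) (Real.log u)
  rw [← ht.limsup_eq]
  refine limsup_le_limsup ?_ ?_ ht.isBoundedUnder_le
  · filter_upwards [eventually_ge_atTop 1] with R hR
    exact log_growth_le Γ u hu hu1 h R hR
  · exact isCoboundedUnder_le_of_le _ (fun R => log_growth_nonneg Γ R)

lemma growth_bdd {d : ℕ} (Γ : Subgroup (FG d)) (u : ℝ) (hu : 0 < u) (hu1 : u < 1)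
    (h : pois (ENNReal.ofReal u) (Γ : Set (FG d)) ≠ ∞) :
    atTop.IsBoundedUnder (· ≤ ·) fun R : ℕ => Real.log (growthCount Γ R : ℝ) / (R : ℝ) := by
  have ht := tendsto_aux (Real.log (pois (ENNReal.ofReal u) (Γ : Set (FG d))).toReal) (Real.log u)
  refine ht.isBoundedUnder_le.mono_le ?_
  filter_upwards [eventually_ge_atTop 1] with R hR
  exact log_growth_le Γ u hu hu1 h R hR

lemma pois_le_tsum_growth {d : ℕ} (Γ : Subgroup (FG d)) (u : ℝ≥0∞) :
    pois u (Γ : Set (FG d)) ≤ ∑' R : ℕ, (growthCount Γ R : ℝ≥0∞) * u ^ R := by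
  unfold pois
  rw [← (Equiv.sigmaFiberEquiv (fun g : (Γ : Set (FG d)) => FreeGroup.norm (g : FG d))).tsum_eq,
    ENNReal.tsum_sigma']
  refine ENNReal.tsum_le_tsum (fun R => ?_)
  have hfin : ({g : FG d | g ∈ Γ ∧ FreeGroup.norm g ≤ R}).Finite :=
    ((ball_finite_s1 (d := d) R).subset (fun g hg => hg.2))
  have hfin' : Finite {g : FG d // g ∈ Γ ∧ FreeGroup.norm g ≤ R} := hfin.to_subtype
  let f : { g : (Γ : Set (FG d)) // FreeGroup.norm (g : FG d) = R } →
      {g : FG d // g ∈ Γ ∧ FreeGroup.norm g ≤ R} := fun g => ⟨g.1.1, g.1.2, g.2.le⟩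
  have hf : Function.Injective f := by
    intro a b hab
    apply Subtype.ext; apply Subtype.ext
    exact congrArg (fun x => x.1) hab
  have hfin2 := Finite.of_injective f hf
  have : Fintype { g : (Γ : Set (FG d)) // FreeGroup.norm (g : FG d) = R } := Fintype.ofFinite _
  have hcard := Nat.card_le_card_of_injective f hf
  calc _ = ∑' g : { g : (Γ : Set (FG d)) // FreeGroup.norm (g : FG d) = R }, u ^ R := by
        refine tsum_congr (fun g => ?_)
        have := g.2
        simp only [Equiv.sigmaFiberEquiv_apply]
        rw [this]
    _ = (Nat.card { g : (Γ : Set (FG d)) // FreeGroup.norm (g : FG d) = R } : ℝ≥0∞) * u ^ R := by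
        rw [tsum_fintype]; simp [Nat.card_eq_fintype_card]
    _ ≤ _ := by
        gcongr
        exact hcard

lemma le_critExp {d : ℕ} (Γ : Subgroup (FG d)) (u : ℝ) (hu : 0 < u) (hu1 : u < 1)
    (h : pois (ENNReal.ofReal u) (Γ : Set (FG d)) ≠ ∞) (v : ℝ) (hv : 0 < v)
    (hv' : pois (ENNReal.ofReal v) (Γ : Set (FG d)) = ∞) : - Real.log v ≤ critExp Γ := by
  by_contra! hlt
  obtain ⟨s, hs1, hs2⟩ := exists_between hlt
  have hev := eventually_lt_of_limsup_lt hs1 (growth_bdd Γ u hu hu1 h)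
  obtain ⟨N, hN⟩ := eventually_atTop.1 (hev.and (eventually_ge_atTop 1))
  have hle := pois_le_tsum_growth Γ (ENNReal.ofReal v)
  rw [hv', top_le_iff] at hle
  have hsv : Real.exp s * v < 1 := by
    rw [← Real.exp_log hv, ← Real.exp_add, Real.exp_lt_one_iff]
    linarith
  have hsum : Summable (fun R : ℕ => (growthCount Γ R : ℝ) * v ^ R) := by
    rw [← summable_nat_add_iff N]
    refine Summable.of_nonneg_of_le (fun R => by positivity) (fun R => ?_)
      ((summable_nat_add_iff N).2 (summable_geometric_of_lt_one (by positivity) hsv))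
    rw [mul_pow]
    gcongr
    obtain ⟨h1, h2⟩ := hN (R + N) (by omega)
    have hR : (0:ℝ) < ((R + N : ℕ) : ℝ) := by exact_mod_cast h2
    rw [div_lt_iff₀ hR] at h1
    have hc : (0:ℝ) < growthCount Γ (R+N) := by exact_mod_cast growthCount_pos Γ _
    rw [← Real.exp_log hc, ← Real.exp_nat_mul, Real.exp_le_exp]
    linarith
  have := hsum.tsum_ofReal_ne_top
  apply this
  rw [← hle]
  refine tsum_congr (fun R => ?_)
  rw [ENNReal.ofReal_mul (by positivity), ENNReal.ofReal_pow hv.le]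
  simp

lemma isBoomerang_of_powers {G : Type*} [Group G] (Δ : Subgroup G)
    (h : ∀ g : G, ∃ n : ℕ, 1 ≤ n ∧ g ^ n ∈ Δ) : IsBoomerang Δ := by
  intro g
  obtain ⟨n, hn, hg⟩ := h g
  refine ⟨fun k => n * (k+1), ?_, ?_⟩
  · intro a b hab
    exact Nat.mul_lt_mul_of_pos_left (by omega) (by omega)
  · intro x
    refine Eventually.of_forall (fun k => ?_)
    have hk : g ^ (n * (k+1)) ∈ Δ := by rw [pow_mul]; exact Δ.pow_mem hg _
    constructor
    · rintro ⟨y, hy, rfl⟩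
      exact Δ.mul_mem (Δ.mul_mem hk hy) (Δ.inv_mem hk)
    · intro hx
      refine ⟨(g ^ (n * (k+1)))⁻¹ * x * g ^ (n * (k+1)), 
        Δ.mul_mem (Δ.mul_mem (Δ.inv_mem hk) hx) hk, ?_⟩
      generalize g ^ (n * (k+1)) = z
      change z * (z⁻¹ * x * z) * z⁻¹ = x
      group

end

section

open Filter
open scoped ENNReal
set_option autoImplicit false

section lcpsec
variable {α : Type*} [DecidableEq α]

/-- length of the longest common prefix -/
def lcp : List α → List α → ℕ
  | a :: l, b :: m => if a = b then lcp l m + 1 else 0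
  | [], _ => 0
  | _ :: _, [] => 0

lemma le_lcp_iff (l m : List α) (n : ℕ) :
    n ≤ lcp l m ↔ n ≤ l.length ∧ n ≤ m.length ∧ l.take n = m.take n := by
  induction l generalizing m n with
  | nil =>
    simp only [lcp, List.length_nil]
    constructor
    · intro h; obtain rfl : n = 0 := by omega
      simp
    · intro h; exact h.1
  | cons a l ih =>
    cases m with
    | nil =>
      simp only [lcp, List.length_nil]
      constructor
      · intro h; obtain rfl : n = 0 := by omega
        simp
      · intro h; exact h.2.1
    | cons b m =>
      cases n with
      | zero => simp
      | succ n =>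
        simp only [lcp, List.length_cons, List.take_succ_cons, List.cons.injEq]
        split_ifs with hab
        · have := ih m n
          simp only [add_le_add_iff_right, this, hab, true_and]
        · simp [hab]

lemma lcp_comm (l m : List α) : lcp l m = lcp m l := by
  apply le_antisymm
  · have := (le_lcp_iff l m _).1 le_rfl
    exact (le_lcp_iff m l _).2 ⟨this.2.1, this.1, this.2.2.symm⟩
  · have := (le_lcp_iff m l _).1 le_rfl
    exact (le_lcp_iff l m _).2 ⟨this.2.1, this.1, this.2.2.symm⟩

lemma lcp_tri (l m k : List α) : min (lcp l m) (lcp m k) ≤ lcp l k := by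
  obtain ⟨h1, h2, h3⟩ := (le_lcp_iff l m (min (lcp l m) (lcp m k))).1 (min_le_left _ _)
  obtain ⟨h4, h5, h6⟩ := (le_lcp_iff m k (min (lcp l m) (lcp m k))).1 (min_le_right _ _)
  exact (le_lcp_iff l k _).2 ⟨h1, h5, h3.trans h6⟩

lemma lcp_drop_head (l m : List α) :
    ∀ a ∈ (l.drop (lcp l m)).head?, ∀ b ∈ (m.drop (lcp l m)).head?, a ≠ b := by
  induction l generalizing m with
  | nil => simp
  | cons x l ih =>
    cases m with
    | nil => simp
    | cons y m =>
      simp only [lcp]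
      split_ifs with h
      · simpa using ih m
      · simpa using h

end lcpsec

variable {d : ℕ}

/-- Gromov product based at the identity -/
def gp (x y : FG d) : ℕ := lcp x.toWord y.toWord

lemma gp_comm (x y : FG d) : gp x y = gp y x := lcp_comm _ _
lemma gp_tri (x y z : FG d) : min (gp x y) (gp y z) ≤ gp x z := lcp_tri _ _ _
lemma gp_le_left (x y : FG d) : gp x y ≤ FreeGroup.norm x :=
  ((le_lcp_iff _ _ _).1 (le_refl (gp x y))).1
lemma gp_le_right (x y : FG d) : gp x y ≤ FreeGroup.norm y :=
  ((le_lcp_iff _ _ _).1 (le_refl (gp x y))).2.1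
lemma gp_take (x y : FG d) {n : ℕ} (h : n ≤ gp x y) : x.toWord.take n = y.toWord.take n :=
  ((le_lcp_iff _ _ _).1 h).2.2

lemma getLast_invRev (l : List (Fin d × Bool)) :
    (FreeGroup.invRev l).getLast? = l.head?.map (fun p => (p.1, !p.2)) := by
  cases l <;> simp [FreeGroup.invRev]

lemma isReduced_invRev_append (l m : List (Fin d × Bool)) (hl : FreeGroup.IsReduced l)
    (hm : FreeGroup.IsReduced m) (h : ∀ a ∈ l.head?, ∀ b ∈ m.head?, a ≠ b) :
    FreeGroup.IsReduced (FreeGroup.invRev l ++ m) := by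
  unfold FreeGroup.IsReduced
  rw [List.isChain_append]
  refine ⟨?_, hm, ?_⟩
  · have : FreeGroup.IsReduced (FreeGroup.invRev l) := by
      rw [FreeGroup.isReduced_iff_reduce_eq, FreeGroup.reduce_invRev, hl.reduce_eq]
    exact this
  · intro a ha b hb hab
    rw [getLast_invRev] at ha
    simp only [Option.mem_def, Option.map_eq_some_iff] at ha
    obtain ⟨c, hc, rfl⟩ := ha
    have := h c hc b hb
    simp only at hab ⊢
    by_contra hne
    apply this
    apply Prod.ext hab
    cases h1 : c.2 <;> cases h2 : b.2 <;> simp_all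

lemma toWord_inv_mul (x y : FG d) : (x⁻¹ * y).toWord =
    FreeGroup.invRev (x.toWord.drop (gp x y)) ++ y.toWord.drop (gp x y) := by
  have hx := FreeGroup.isReduced_toWord (x := x)
  have hy := FreeGroup.isReduced_toWord (x := y)
  have hred := isReduced_invRev_append (x.toWord.drop (gp x y)) (y.toWord.drop (gp x y))
    (hx.infix (List.drop_suffix _ _).isInfix) (hy.infix (List.drop_suffix _ _).isInfix)
    (lcp_drop_head _ _)
  rw [← hred.reduce_eq, ← FreeGroup.toWord_mk]
  congr 1
  have e1 : x = FreeGroup.mk (x.toWord.take (gp x y)) * FreeGroup.mk (x.toWord.drop (gp x y)) := by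
    rw [FreeGroup.mul_mk, List.take_append_drop, FreeGroup.mk_toWord]
  have e2 : y = FreeGroup.mk (y.toWord.take (gp x y)) * FreeGroup.mk (y.toWord.drop (gp x y)) := by
    rw [FreeGroup.mul_mk, List.take_append_drop, FreeGroup.mk_toWord]
  have e3 := gp_take x y le_rfl
  rw [← FreeGroup.mul_mk, ← FreeGroup.inv_mk]
  generalize gp x y = k at *
  nth_rewrite 1 [e1, e2]
  rw [e3]
  group

lemma fg_norm_inv_mul (x y : FG d) :
    FreeGroup.norm (x⁻¹ * y) + 2 * gp x y = FreeGroup.norm x + FreeGroup.norm y := by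
  have h := toWord_inv_mul x y
  have h1 := gp_le_left x y
  have h2 := gp_le_right x y
  have := congrArg List.length h
  simp only [List.length_append, FreeGroup.invRev_length, List.length_drop] at this
  unfold FreeGroup.norm at *
  omega

lemma norm_mul_gp (x y : FG d) :
    FreeGroup.norm (x * y) + 2 * gp x⁻¹ y = FreeGroup.norm x + FreeGroup.norm y := by
  have := fg_norm_inv_mul x⁻¹ y
  rwa [inv_inv, FreeGroup.norm_inv_eq] at this

lemma toWord_mul_of_gp (x y : FG d) (h : gp x⁻¹ y = 0) :
    (x * y).toWord = x.toWord ++ y.toWord := by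
  have := toWord_inv_mul x⁻¹ y
  rw [inv_inv, h] at this
  simpa [FreeGroup.toWord_inv] using this

/-- first letter -/
def hd (x : FG d) : Option (Fin d × Bool) := x.toWord.head?

lemma gp_eq_zero_of_hd {x y : FG d} (h : ∀ a ∈ hd x, ∀ b ∈ hd y, a ≠ b) : gp x y = 0 := by
  unfold gp hd at *
  cases hx : x.toWord <;> cases hy : y.toWord <;> simp_all [lcp]

lemma hd_mul_of_gp {x y : FG d} (h : gp x⁻¹ y = 0) (hx : x ≠ 1) : hd (x * y) = hd x := by
  unfold hd
  rw [toWord_mul_of_gp x y h, List.head?_append_of_ne_nil]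
  simpa using hx

lemma hd_eq_none {x : FG d} : hd x = none ↔ x = 1 := by
  simp [hd]

lemma hd_ne_one {x : FG d} (hx : x ≠ 1) : ∃ a, hd x = some a := by
  cases h : hd x with
  | none => exact absurd (hd_eq_none.1 h) hx
  | some a => exact ⟨a, rfl⟩

end

section

open Filter
open scoped ENNReal Pointwise
set_option autoImplicit false
variable {d : ℕ}

lemma pois_union_le (u : ℝ≥0∞) (X Y : Set (FG d)) : pois u (X ∪ Y) ≤ pois u X + pois u Y :=
  ENNReal.tsum_union_le (fun g : FG d => u ^ (FreeGroup.norm g)) X Y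

lemma pois_one (u : ℝ≥0∞) : pois u ({1} : Set (FG d)) = 1 := by
  unfold pois
  rw [tsum_singleton (1 : FG d) (fun g : FG d => u ^ (FreeGroup.norm g))]
  simp

lemma pois_empty (u : ℝ≥0∞) : pois u (∅ : Set (FG d)) = 0 := by
  unfold pois; simp

lemma pois_union (u : ℝ≥0∞) {X Y : Set (FG d)} (h : Disjoint X Y) :
    pois u (X ∪ Y) = pois u X + pois u Y :=
  ENNReal.summable.tsum_union_disjoint (f := fun g : FG d => u ^ (FreeGroup.norm g)) h
    ENNReal.summable

lemma pois_iUnion_le (u : ℝ≥0∞) (X : ℕ → Set (FG d)) (hX : Monotone X) (M : ℝ≥0∞)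
    (h : ∀ n, pois u (X n) ≤ M) : pois u (⋃ n, X n) ≤ M := by
  unfold pois
  rw [ENNReal.tsum_eq_iSup_sum]
  refine iSup_le (fun s => ?_)
  have : ∀ s : Finset (⋃ n, X n), ∃ n, ∀ g ∈ s, (g : FG d) ∈ X n := by
    intro s
    classical
    induction s using Finset.induction_on with
    | empty => exact ⟨0, by simp⟩
    | insert a s ha ih =>
      obtain ⟨n, hn⟩ := ih
      obtain ⟨m, hm⟩ := Set.mem_iUnion.1 a.2
      refine ⟨max n m, ?_⟩
      intro g hg
      rcases Finset.mem_insert.1 hg with rfl | hg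
      · exact hX (le_max_right _ _) hm
      · exact hX (le_max_left _ _) (hn g hg)
  obtain ⟨n, hn⟩ := this s
  refine le_trans ?_ (h n)
  have e : ∑ a ∈ s, u ^ FreeGroup.norm (a : FG d) =
      ∑ a ∈ s.map (Function.Embedding.subtype _), u ^ FreeGroup.norm (a : FG d) := by
    simp
  rw [e]
  have e2 : pois u (X n) ≥ pois u ((s.map (Function.Embedding.subtype _) : Finset (FG d)) : Set (FG d)) := by
    apply pois_mono
    intro g hg
    simp only [Finset.coe_map, Function.Embedding.subtype_apply, Set.mem_image] at hg
    obtain ⟨a, ha, rfl⟩ := hg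
    exact hn a ha
  refine le_trans (le_of_eq ?_) e2
  unfold pois
  exact (Finset.tsum_subtype' _ (fun g : FG d => u ^ (FreeGroup.norm g))).symm

lemma pois_mul_le (u c : ℝ≥0∞) (X Y : Set (FG d))
    (h : ∀ x ∈ X, ∀ y ∈ Y, u ^ (FreeGroup.norm (x * y)) ≤
      c * (u ^ (FreeGroup.norm x) * u ^ (FreeGroup.norm y))) :
    pois u (X * Y) ≤ c * (pois u X * pois u Y) := by
  unfold pois
  let f : X × Y → (X * Y : Set (FG d)) := fun p => ⟨p.1 * p.2, Set.mul_mem_mul p.1.2 p.2.2⟩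
  have hf : Function.Surjective f := by
    rintro ⟨g, x, hx, y, hy, rfl⟩
    exact ⟨(⟨x, hx⟩, ⟨y, hy⟩), rfl⟩
  refine (ENNReal.tsum_le_tsum_comp_of_surjective hf _).trans ?_
  rw [← ENNReal.tsum_mul_right, ← ENNReal.tsum_mul_left, ENNReal.tsum_prod']
  refine ENNReal.tsum_le_tsum (fun x => ?_)
  rw [← ENNReal.tsum_mul_left, ← ENNReal.tsum_mul_left]
  exact ENNReal.tsum_le_tsum (fun y => h x x.2 y y.2)

lemma pois_mul_eq (u : ℝ≥0∞) (X Y Z : Set (FG d))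
    (h : ∀ x ∈ X, ∀ y ∈ Y, FreeGroup.norm (x * y) = FreeGroup.norm x + FreeGroup.norm y)
    (hZ : X * Y = Z)
    (hi : ∀ x ∈ X, ∀ y ∈ Y, ∀ x' ∈ X, ∀ y' ∈ Y, x * y = x' * y' → x = x') :
    pois u Z = pois u X * pois u Y := by
  subst hZ
  unfold pois
  let f : X × Y → (X * Y : Set (FG d)) := fun p => ⟨p.1 * p.2, Set.mul_mem_mul p.1.2 p.2.2⟩
  have hf : Function.Surjective f := by
    rintro ⟨g, x, hx, y, hy, rfl⟩
    exact ⟨(⟨x, hx⟩, ⟨y, hy⟩), rfl⟩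
  have hinj : Function.Injective f := by
    rintro ⟨x, y⟩ ⟨x', y'⟩ hxy
    have h0 : (x : FG d) * y = x' * y' := congrArg (fun z => z.1) hxy
    have h1 := hi x x.2 y y.2 x' x'.2 y' y'.2 h0
    have h2 : (y : FG d) = y' := by rw [h1] at h0; exact mul_left_cancel h0
    exact Prod.ext (Subtype.ext h1) (Subtype.ext h2)
  rw [← (Equiv.ofBijective f ⟨hinj, hf⟩).tsum_eq]
  rw [← ENNReal.tsum_mul_right, ENNReal.tsum_prod']
  refine tsum_congr (fun x => ?_)
  rw [← ENNReal.tsum_mul_left]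
  refine tsum_congr (fun y => ?_)
  change u ^ FreeGroup.norm ((x : FG d) * (y : FG d)) = _
  rw [h x x.2 y y.2, pow_add]

/-- nontrivial elements -/
def nt (A : Subgroup (FG d)) : Set (FG d) := {x | x ∈ A ∧ x ≠ 1}

lemma pois_nt (u : ℝ≥0∞) (A : Subgroup (FG d)) : pois u (A : Set (FG d)) = 1 + pois u (nt A) := by
  have : (A : Set (FG d)) = {1} ∪ nt A := by
    ext x
    simp only [SetLike.mem_coe, nt, Set.singleton_union, Set.mem_insert_iff, Set.mem_ofPred_eq]
    constructor
    · intro h; by_cases hx : x = 1 <;> simp [hx, h]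
    · rintro (rfl | h)
      · exact A.one_mem
      · exact h.1
  rw [this, pois_union, pois_one]
  simp [nt]

/-- alternating words with at most `n` syllables starting with type `s` -/
def Wd (S : Bool → Subgroup (FG d)) : ℕ → Bool → Set (FG d)
  | 0, _ => ∅
  | n + 1, s => nt (S s) ∪ nt (S s) * Wd S n (!s)

lemma Wd_mono_succ (S : Bool → Subgroup (FG d)) (n : ℕ) (s : Bool) : Wd S n s ⊆ Wd S (n+1) s := by
  induction n generalizing s with
  | zero => simp [Wd]
  | succ n ih =>
    rw [Wd, Wd]
    exact Set.union_subset_union_right _ (Set.mul_subset_mul_left (ih _))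

lemma Wd_mono (S : Bool → Subgroup (FG d)) (s : Bool) : Monotone (fun n => Wd S n s) :=
  monotone_nat_of_le_succ (fun n => Wd_mono_succ S n s)

lemma Wd_left_mul (S : Bool → Subgroup (FG d)) (s : Bool) (x : FG d) (hx : x ∈ S s) (g : FG d)
    (hg : g = 1 ∨ ∃ n t, g ∈ Wd S n t) : x * g = 1 ∨ ∃ n t, x * g ∈ Wd S n t := by
  by_cases hx1 : x = 1
  · subst hx1; simpa using hg
  rcases hg with rfl | ⟨n, t, hg⟩
  · right; exact ⟨1, s, Or.inl ⟨by simpa using hx, by simpa using hx1⟩⟩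
  · by_cases hts : t = !s
    · subst hts
      right; exact ⟨n+1, s, Or.inr (Set.mul_mem_mul ⟨hx, hx1⟩ hg)⟩
    · obtain rfl : t = s := by cases t <;> cases s <;> simp_all
      cases n with
      | zero => simp [Wd] at hg
      | succ n =>
        rcases hg with hg | ⟨y, hy, z, hz, rfl⟩
        · by_cases hxg : x * g = 1
          · left; exact hxg
          · right; exact ⟨1, t, Or.inl ⟨(S t).mul_mem hx hg.1, hxg⟩⟩
        · simp only
          rw [← mul_assoc]
          by_cases hxy : x * y = 1
          · right; rw [hxy, one_mul]; exact ⟨n, _, hz⟩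
          · right
            exact ⟨n+1, t, Or.inr (Set.mul_mem_mul ⟨(S t).mul_mem hx hy.1, hxy⟩ hz)⟩

lemma mem_sup_Wd (S : Bool → Subgroup (FG d)) (g : FG d) (hg : g ∈ S true ⊔ S false) :
    g = 1 ∨ ∃ n t, g ∈ Wd S n t := by
  rw [← Subgroup.closure_eq (S true), ← Subgroup.closure_eq (S false),
    ← Subgroup.closure_union] at hg
  induction hg using Subgroup.closure_induction_left with
  | one => left; rfl
  | mul_left x hx y hy ih =>
    rcases hx with hx | hx
    · exact Wd_left_mul S true x hx y ih
    · exact Wd_left_mul S false x hx y ih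
  | inv_mul_cancel x hx y hy ih =>
    rcases hx with hx | hx
    · exact Wd_left_mul S true x⁻¹ ((S true).inv_mem hx) y ih
    · exact Wd_left_mul S false x⁻¹ ((S false).inv_mem hx) y ih

lemma Wd_sub_sup (S : Bool → Subgroup (FG d)) (n : ℕ) (s : Bool) (g : FG d) (hg : g ∈ Wd S n s) :
    g ∈ S true ⊔ S false := by
  have hle : ∀ s, S s ≤ S true ⊔ S false := by
    intro s; cases s
    · exact le_sup_right
    · exact le_sup_left
  induction n generalizing s g with
  | zero => simp [Wd] at hg
  | succ n ih =>
    rcases hg with hg | ⟨y, hy, z, hz, rfl⟩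
    · exact hle s hg.1
    · exact Subgroup.mul_mem _ (hle s hy.1) (ih _ z hz)

lemma pois_sup_le (S : Bool → Subgroup (FG d)) (u : ℝ≥0∞) (c M : Bool → ℝ≥0∞)
    (h : ∀ s n, ∀ x ∈ nt (S s), ∀ y ∈ Wd S n (!s), u ^ (FreeGroup.norm (x * y)) ≤
      c s * (u ^ (FreeGroup.norm x) * u ^ (FreeGroup.norm y)))
    (hM : ∀ s, pois u (nt (S s)) + c s * (pois u (nt (S s)) * M (!s)) ≤ M s) :
    pois u ((S true ⊔ S false : Subgroup (FG d)) : Set (FG d)) ≤ 1 + (M true + M false) := by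
  have key : ∀ n s, pois u (Wd S n s) ≤ M s := by
    intro n
    induction n with
    | zero => intro s; simp [Wd, pois_empty]
    | succ n ih =>
      intro s
      refine (pois_union_le _ _ _).trans (le_trans ?_ (hM s))
      gcongr
      refine (pois_mul_le u (c s) _ _ (h s n)).trans ?_
      gcongr
      exact ih _
  have hsub : ((S true ⊔ S false : Subgroup (FG d)) : Set (FG d)) ⊆
      {1} ∪ ((⋃ n, Wd S n true) ∪ (⋃ n, Wd S n false)) := by
    intro g hg
    rcases mem_sup_Wd S g hg with rfl | ⟨n, t, h⟩
    · left; rfl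
    · right
      cases t
      · right; exact Set.mem_iUnion.2 ⟨n, h⟩
      · left; exact Set.mem_iUnion.2 ⟨n, h⟩
  refine (pois_mono u hsub).trans ((pois_union_le _ _ _).trans ?_)
  rw [pois_one]
  gcongr
  refine (pois_union_le _ _ _).trans ?_
  gcongr
  · exact pois_iUnion_le u _ (Wd_mono S true) _ (fun n => key n true)
  · exact pois_iUnion_le u _ (Wd_mono S false) _ (fun n => key n false)

end

section

open Filter
open scoped ENNReal Pointwise
set_option autoImplicit false
variable {d : ℕ}

/-- all nontrivial elements start with a letter of `T` -/
def Supp (A : Subgroup (FG d)) (T : Set (Fin d × Bool)) : Prop := ∀ x ∈ A, ∀ a ∈ hd x, a ∈ T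

noncomputable def phi (u : ℝ≥0∞) (A : Subgroup (FG d)) : ℝ :=
  1 - ((pois u (A : Set (FG d)))⁻¹).toReal

lemma one_le_pois (u : ℝ≥0∞) (A : Subgroup (FG d)) : 1 ≤ pois u (A : Set (FG d)) := by
  rw [pois_nt]; exact le_self_add

lemma phi_nonneg (u : ℝ≥0∞) (A : Subgroup (FG d)) : 0 ≤ phi u A := by
  unfold phi
  have h1 : (pois u (A : Set (FG d)))⁻¹ ≤ 1 := ENNReal.inv_le_one.2 (one_le_pois u A)
  have := ENNReal.toReal_mono ENNReal.one_ne_top h1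
  simp only [ENNReal.toReal_one] at this
  linarith

lemma phi_le_one (u : ℝ≥0∞) (A : Subgroup (FG d)) : phi u A ≤ 1 := by
  unfold phi
  have : 0 ≤ ((pois u (A : Set (FG d)))⁻¹).toReal := ENNReal.toReal_nonneg
  linarith

lemma pois_ne_zero (u : ℝ≥0∞) (A : Subgroup (FG d)) : pois u (A : Set (FG d)) ≠ 0 :=
  (lt_of_lt_of_le one_pos (one_le_pois u A)).ne'

lemma phi_eq_one_iff (u : ℝ≥0∞) (A : Subgroup (FG d)) :
    phi u A = 1 ↔ pois u (A : Set (FG d)) = ∞ := by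
  unfold phi
  have h0 := pois_ne_zero u A
  constructor
  · intro h
    have : ((pois u (A : Set (FG d)))⁻¹).toReal = 0 := by linarith
    rw [ENNReal.toReal_eq_zero_iff] at this
    rcases this with h | h
    · simpa using h
    · exact absurd (ENNReal.inv_eq_top.1 h) h0
  · intro h; simp [h]

lemma phi_mono_u {u v : ℝ≥0∞} (h : u ≤ v) (A : Subgroup (FG d)) : phi u A ≤ phi v A := by
  unfold phi
  have h1 := pois_mono_u h (A : Set (FG d))
  have h2 : (pois v (A : Set (FG d)))⁻¹ ≤ (pois u (A : Set (FG d)))⁻¹ := ENNReal.inv_le_inv.2 h1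
  have := ENNReal.toReal_mono (by simpa using pois_ne_zero u A) h2
  linarith

/-- When finite, `phi = 1 - 1/P`. -/
lemma phi_real (u : ℝ≥0∞) (A : Subgroup (FG d)) :
    phi u A = 1 - ((pois u (A : Set (FG d))).toReal)⁻¹ := by
  unfold phi; rw [ENNReal.toReal_inv]

lemma gp_zero_of_supp {A : Subgroup (FG d)} {T : Set (Fin d × Bool)} (hA : Supp A T) {x y : FG d}
    (hx : x ∈ A) (hy : ∀ a ∈ hd y, a ∉ T) : gp x⁻¹ y = 0 := by
  apply gp_eq_zero_of_hd
  intro a ha b hb hab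
  subst hab
  exact hy a hb (hA _ (A.inv_mem hx) a ha)

section join
variable (S : Bool → Subgroup (FG d)) (T : Bool → Set (Fin d × Bool))

lemma Wd_hd (hS : ∀ s, Supp (S s) (T s))
    (hT : ∀ s, Disjoint (T s) (T (!s))) (n : ℕ) (s : Bool) (g : FG d) (hg : g ∈ Wd S n s) : ∃ a ∈ T s, hd g = some a := by
  induction n generalizing s g with
  | zero => simp [Wd] at hg
  | succ n ih =>
    rcases hg with hg | ⟨y, hy, z, hz, rfl⟩
    · obtain ⟨a, ha⟩ := hd_ne_one hg.2
      exact ⟨a, hS s g hg.1 a ha, ha⟩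
    · obtain ⟨b, hb, hb'⟩ := ih _ z hz
      have h0 : gp y⁻¹ z = 0 := by
        apply gp_zero_of_supp (hS s) hy.1
        intro a ha hat
        rw [hb'] at ha
        obtain rfl : b = a := by simpa using ha
        exact Set.disjoint_left.1 (hT s) hat hb
      obtain ⟨a, ha⟩ := hd_ne_one hy.2
      refine ⟨a, hS s y hy.1 a ha, ?_⟩
      simp only
      rw [hd_mul_of_gp h0 hy.2, ha]

lemma supp_sup (hS : ∀ s, Supp (S s) (T s))
    (hT : ∀ s, Disjoint (T s) (T (!s))) : Supp (S true ⊔ S false) (T true ∪ T false) := by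
  intro x hx a ha
  rcases mem_sup_Wd S x hx with rfl | ⟨n, t, h⟩
  · simp [hd] at ha
  · obtain ⟨b, hb, hb'⟩ := Wd_hd S T hS hT n t x h
    rw [hb'] at ha
    obtain rfl : b = a := by simpa using ha
    cases t
    · exact Or.inr hb
    · exact Or.inl hb

/-- elements of the join not starting in `T s` -/
def Qset (s : Bool) : Set (FG d) := {g | g ∈ S true ⊔ S false ∧ ∀ a ∈ hd g, a ∉ T s}

lemma pois_join_mul (hS : ∀ s, Supp (S s) (T s))
    (hT : ∀ s, Disjoint (T s) (T (!s))) (u : ℝ≥0∞) (s : Bool) :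
    pois u ((S true ⊔ S false : Subgroup (FG d)) : Set (FG d)) =
      pois u (S s : Set (FG d)) * pois u (Qset S T s) := by
  have hle : S s ≤ S true ⊔ S false := by
    cases s
    · exact le_sup_right
    · exact le_sup_left
  apply pois_mul_eq
  · intro x hx y hy
    have := norm_mul_gp x y
    rw [gp_zero_of_supp (hS s) hx hy.2] at this
    simpa using this
  · ext g
    constructor
    · rintro ⟨x, hx, y, hy, rfl⟩
      exact Subgroup.mul_mem _ (hle hx) hy.1
    · intro hg
      have hW : ∀ n z, z ∈ Wd S n (!s) → z ∈ Qset S T s := by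
        intro n z hz
        refine ⟨Wd_sub_sup S n _ z hz, ?_⟩
        intro a ha hat
        obtain ⟨b, hb, hb'⟩ := Wd_hd S T hS hT n (!s) z hz
        rw [hb'] at ha
        obtain rfl : b = a := by simpa using ha
        exact Set.disjoint_left.1 (hT s) hat hb
      have h1 : (1 : FG d) ∈ Qset S T s := ⟨Subgroup.one_mem _, by simp [hd]⟩
      rcases mem_sup_Wd S g hg with rfl | ⟨n, t, h⟩
      · exact ⟨1, (S s).one_mem, 1, h1, by simp⟩
      · by_cases hts : t = !s
        · subst hts
          exact ⟨1, (S s).one_mem, g, hW n g h, by simp⟩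
        · obtain rfl : t = s := by cases t <;> cases s <;> simp_all
          cases n with
          | zero => simp [Wd] at h
          | succ n =>
            rcases h with h | ⟨y, hy, z, hz, rfl⟩
            · exact ⟨g, h.1, 1, h1, by simp⟩
            · exact ⟨y, hy.1, z, hW n z hz, rfl⟩
  · intro x hx y hy x' hx' y' hy' he
    by_contra hne
    have h1 : x'⁻¹ * x ∈ S s := (S s).mul_mem ((S s).inv_mem hx') hx
    have h2 : x'⁻¹ * x ≠ 1 := by
      intro h; apply hne; exact (inv_mul_eq_one.1 h).symm
    have h3 : (x'⁻¹ * x) * y = y' := by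
      rw [mul_assoc, he]; group
    have h4 := hd_mul_of_gp (gp_zero_of_supp (hS s) h1 hy.2) h2
    rw [h3] at h4
    obtain ⟨a, ha⟩ := hd_ne_one h2
    exact hy'.2 a (h4.trans ha) (hS s _ h1 a ha)

lemma pois_join_add (hS : ∀ s, Supp (S s) (T s))
    (hT : ∀ s, Disjoint (T s) (T (!s))) (u : ℝ≥0∞) :
    pois u ((S true ⊔ S false : Subgroup (FG d)) : Set (FG d)) + 1 =
      pois u (Qset S T true) + pois u (Qset S T false) := by
  have hU : Qset S T true ∪ (Qset S T false \ {1}) =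
      ((S true ⊔ S false : Subgroup (FG d)) : Set (FG d)) := by
    ext g
    constructor
    · rintro (h | h)
      · exact h.1
      · exact h.1.1
    · intro hg
      by_cases hg1 : ∀ a ∈ hd g, a ∉ T true
      · left; exact ⟨hg, hg1⟩
      · push Not at hg1
        obtain ⟨a, ha, hat⟩ := hg1
        right
        refine ⟨⟨hg, ?_⟩, ?_⟩
        · intro b hb hbt
          obtain rfl : a = b := by
            rw [Option.mem_def] at ha hb
            rw [ha] at hb
            simpa using hb
          exact Set.disjoint_left.1 (hT true) hat hbt
        · rintro rfl
          simp [hd] at ha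
  have hD : Disjoint (Qset S T true) (Qset S T false \ {1}) := by
    rw [Set.disjoint_left]
    intro g hg hg'
    obtain ⟨a, ha⟩ := hd_ne_one hg'.2
    rcases supp_sup S T hS hT g hg.1 a ha with h | h
    · exact hg.2 a ha h
    · exact hg'.1.2 a ha h
  have h1 : (1 : FG d) ∈ Qset S T false := ⟨Subgroup.one_mem _, by simp [hd]⟩
  have hF : Qset S T false = (Qset S T false \ {1}) ∪ {1} := by
    rw [Set.sdiff_union_self, Set.union_eq_left.2]
    simpa using h1
  have hF' : pois u (Qset S T false) = pois u (Qset S T false \ {1}) + 1 := by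
    conv_lhs => rw [hF]
    rw [pois_union u Set.disjoint_sdiff_left, pois_one]
  rw [← hU, pois_union u hD, hF', add_assoc]

lemma phi_join_of_ne_top (hS : ∀ s, Supp (S s) (T s))
    (hT : ∀ s, Disjoint (T s) (T (!s))) (u : ℝ≥0∞)
    (h : pois u ((S true ⊔ S false : Subgroup (FG d)) : Set (FG d)) ≠ ∞) :
    phi u (S true ⊔ S false) = phi u (S true) + phi u (S false) := by
  have hA : pois u (S true : Set (FG d)) ≠ ∞ :=
    ne_top_of_le_ne_top h (pois_mono u (SetLike.coe_subset_coe.2 le_sup_left))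
  have hB : pois u (S false : Set (FG d)) ≠ ∞ :=
    ne_top_of_le_ne_top h (pois_mono u (SetLike.coe_subset_coe.2 le_sup_right))
  have hQ : ∀ s, pois u (Qset S T s) ≠ ∞ := fun s =>
    ne_top_of_le_ne_top h (pois_mono u (fun g hg => hg.1))
  have e1 := congrArg ENNReal.toReal (pois_join_mul S T hS hT u true)
  have e2 := congrArg ENNReal.toReal (pois_join_mul S T hS hT u false)
  have e3 := congrArg ENNReal.toReal (pois_join_add S T hS hT u)
  rw [ENNReal.toReal_mul] at e1 e2
  rw [ENNReal.toReal_add h ENNReal.one_ne_top, ENNReal.toReal_add (hQ _) (hQ _),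
    ENNReal.toReal_one] at e3
  rw [phi_real, phi_real, phi_real]
  have p1 := ENNReal.toReal_mono hA (one_le_pois u (S true))
  have p2 := ENNReal.toReal_mono hB (one_le_pois u (S false))
  have p3 := ENNReal.toReal_mono h (one_le_pois u (S true ⊔ S false))
  rw [ENNReal.toReal_one] at p1 p2 p3
  generalize (pois u (S true : Set (FG d))).toReal = a at *
  generalize (pois u (S false : Set (FG d))).toReal = b at *
  generalize (pois u ((S true ⊔ S false : Subgroup (FG d)) : Set (FG d))).toReal = p at *
  generalize (pois u (Qset S T true)).toReal = x at *
  generalize (pois u (Qset S T false)).toReal = y at *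
  have ha : a ≠ 0 := by linarith
  have hb : b ≠ 0 := by linarith
  have hp : p ≠ 0 := by linarith
  have hx : x = p / a := by field_simp; linarith
  have hy : y = p / b := by field_simp; linarith
  rw [hx, hy] at e3
  have h1 : a⁻¹ = (p / a) / p := by field_simp
  have h2 : b⁻¹ = (p / b) / p := by field_simp
  have h3 : (p/a)/p + (p/b)/p = (p+1)/p := by rw [e3]; ring
  have h4 : (p+1)/p = 1 + p⁻¹ := by field_simp
  rw [h1, h2]; linarith

lemma pois_join_ne_top (hS : ∀ s, Supp (S s) (T s))
    (hT : ∀ s, Disjoint (T s) (T (!s))) (u : ℝ≥0∞) (h : phi u (S true) + phi u (S false) < 1) :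
    pois u ((S true ⊔ S false : Subgroup (FG d)) : Set (FG d)) ≠ ∞ := by
  have n1 := phi_nonneg u (S true)
  have n2 := phi_nonneg u (S false)
  have hA : pois u (S true : Set (FG d)) ≠ ∞ := by
    intro h'; rw [← phi_eq_one_iff] at h'; linarith
  have hB : pois u (S false : Set (FG d)) ≠ ∞ := by
    intro h'; rw [← phi_eq_one_iff] at h'; linarith
  rw [phi_real, phi_real] at h
  have hp : pois u (nt (S true)) ≠ ∞ := by
    intro h'; apply hA; rw [pois_nt, h']; simp
  have hq : pois u (nt (S false)) ≠ ∞ := by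
    intro h'; apply hB; rw [pois_nt, h']; simp
  rw [pois_nt, pois_nt, ENNReal.toReal_add ENNReal.one_ne_top hp,
    ENNReal.toReal_add ENNReal.one_ne_top hq, ENNReal.toReal_one] at h
  have p0 : 0 ≤ (pois u (nt (S true))).toReal := ENNReal.toReal_nonneg
  have q0 : 0 ≤ (pois u (nt (S false))).toReal := ENNReal.toReal_nonneg
  set p := (pois u (nt (S true))).toReal with hpdef
  set q := (pois u (nt (S false))).toReal with hqdef
  have hpq : p * q < 1 := by
    have h1 : (1+p)⁻¹ + (1+q)⁻¹ > 1 := by linarith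
    have h2 : (1+p)⁻¹ + (1+q)⁻¹ = ((1+p)+(1+q)) / ((1+p)*(1+q)) := by field_simp; ring
    rw [h2, gt_iff_lt, lt_div_iff₀ (by positivity)] at h1
    nlinarith
  have hpo : pois u (nt (S true)) = ENNReal.ofReal p := (ENNReal.ofReal_toReal hp).symm
  have hqo : pois u (nt (S false)) = ENNReal.ofReal q := (ENNReal.ofReal_toReal hq).symm
  have hd0 : 0 < 1 - p * q := by linarith
  refine ne_top_of_le_ne_top ?_ (pois_sup_le S u (fun _ => 1)
    (fun s => if s then ENNReal.ofReal ((p + p * q) / (1 - p * q)) else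
      ENNReal.ofReal ((q + p * q) / (1 - p * q))) ?_ ?_)
  · simp [ENNReal.add_eq_top]
  · intro s n x hx y hy
    rw [one_mul, ← pow_add]
    have h0 : gp x⁻¹ y = 0 := by
      apply gp_zero_of_supp (hS s) hx.1
      intro a ha hat
      obtain ⟨b, hb, hb'⟩ := Wd_hd S T hS hT n (!s) y hy
      rw [hb'] at ha
      obtain rfl : b = a := by simpa using ha
      exact Set.disjoint_left.1 (hT s) hat hb
    have := norm_mul_gp x y
    rw [h0] at this
    rw [← this]; simp
  · intro s
    cases s
    · simp only [one_mul, Bool.not_false, if_true]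
      rw [hqo, ← ENNReal.ofReal_mul q0, ← ENNReal.ofReal_add q0 (by positivity)]
      simp only [Bool.false_eq_true, if_false]
      apply ENNReal.ofReal_le_ofReal
      apply le_of_eq
      obtain ⟨D, hD⟩ : ∃ D, D = 1 - p * q := ⟨_, rfl⟩
      rw [← hD] at hd0 ⊢
      field_simp
      rw [hD]
      ring
    · simp only [one_mul, Bool.not_true, if_true, Bool.false_eq_true, if_false]
      rw [hpo, ← ENNReal.ofReal_mul p0, ← ENNReal.ofReal_add p0 (by positivity)]
      apply ENNReal.ofReal_le_ofReal
      apply le_of_eq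
      obtain ⟨D, hD⟩ : ∃ D, D = 1 - p * q := ⟨_, rfl⟩
      rw [← hD] at hd0 ⊢
      field_simp
      rw [hD]
      ring

end join

lemma join_lemma {A B : Subgroup (FG d)} {T T' : Set (Fin d × Bool)} (hA : Supp A T)
    (hB : Supp B T') (h : Disjoint T T') : Supp (A ⊔ B) (T ∪ T') ∧
    ∀ u, phi u (A ⊔ B) = min 1 (phi u A + phi u B) := by
  let S : Bool → Subgroup (FG d) := fun s => if s then A else B
  let TT : Bool → Set (Fin d × Bool) := fun s => if s then T else T'
  have hS : ∀ s, Supp (S s) (TT s) := by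
    intro s; cases s
    · exact hB
    · exact hA
  have hT : ∀ s, Disjoint (TT s) (TT (!s)) := by
    intro s; cases s
    · exact h.symm
    · exact h
  refine ⟨supp_sup S TT hS hT, fun u => ?_⟩
  by_cases hp : pois u ((S true ⊔ S false : Subgroup (FG d)) : Set (FG d)) = ∞
  · have h1 : phi u (A ⊔ B) = 1 := (phi_eq_one_iff u _).2 hp
    rw [h1, min_eq_left]
    by_contra! hlt
    exact pois_join_ne_top S TT hS hT u hlt hp
  · have h1 : phi u (A ⊔ B) = phi u A + phi u B := phi_join_of_ne_top S TT hS hT u hp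
    rw [min_eq_right, h1]
    rw [← h1]; exact phi_le_one _ _

end

section

open Filter
open scoped ENNReal Pointwise
set_option autoImplicit false
variable {d : ℕ}

/-- the group element of a letter -/
def lt1 (l : Fin d × Bool) : FG d := FreeGroup.mk [l]
/-- inverse letter -/
def il (l : Fin d × Bool) : Fin d × Bool := (l.1, !l.2)

lemma toWord_lt1 (l : Fin d × Bool) : (lt1 l).toWord = [l] := by
  simp [lt1, FreeGroup.toWord_mk]

lemma toWord_lt1_inv (l : Fin d × Bool) : ((lt1 l)⁻¹).toWord = [il l] := by
  rw [FreeGroup.toWord_inv, toWord_lt1]; rfl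

lemma hd_lt1 (l : Fin d × Bool) : hd (lt1 l) = some l := by simp [hd, toWord_lt1]
lemma hd_lt1_inv (l : Fin d × Bool) : hd (lt1 l)⁻¹ = some (il l) := by
  rw [hd, toWord_lt1_inv]; rfl

lemma conj_word {l : Fin d × Bool} {a : FG d} (ha : a ≠ 1) (h1 : hd a ≠ some (il l))
    (h2 : hd a⁻¹ ≠ some (il l)) :
    (lt1 l * a * (lt1 l)⁻¹).toWord = l :: (a.toWord ++ [il l]) := by
  have g1 : gp (lt1 l)⁻¹ a = 0 := by
    apply gp_eq_zero_of_hd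
    intro x hx y hy hxy
    rw [hd_lt1_inv] at hx
    subst hxy
    exact h1 (by rw [Option.mem_def] at hx hy; rw [hy, hx])
  have g4 : gp (lt1 l * a)⁻¹ (lt1 l)⁻¹ = 0 := by
    apply gp_eq_zero_of_hd
    intro x hx y hy hxy
    subst hxy
    rw [hd_lt1_inv] at hy
    rw [mul_inv_rev] at hx
    have g5 : gp (a⁻¹)⁻¹ (lt1 l)⁻¹ = 0 := by
      rw [inv_inv, gp_comm]; exact g1
    rw [hd_mul_of_gp g5 (by simpa using ha)] at hx
    exact h2 (by rw [Option.mem_def] at hx hy; rw [hx, hy])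
  rw [toWord_mul_of_gp _ _ g4, toWord_mul_of_gp _ _ g1, toWord_lt1, toWord_lt1_inv]
  simp

/-- conjugate by a letter -/
def cj (l : Fin d × Bool) (A : Subgroup (FG d)) : Subgroup (FG d) :=
  A.map (MulAut.conj (lt1 l)).toMonoidHom

lemma mem_nt_cj (l : Fin d × Bool) (A : Subgroup (FG d)) :
    nt (cj l A) = (fun a => lt1 l * a * (lt1 l)⁻¹) '' nt A := by
  ext x
  constructor
  · rintro ⟨⟨a, ha, rfl⟩, hx⟩
    refine ⟨a, ⟨ha, ?_⟩, rfl⟩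
    rintro rfl
    simp at hx
  · rintro ⟨a, ⟨ha, ha1⟩, rfl⟩
    refine ⟨⟨a, ha, rfl⟩, ?_⟩
    simpa using ha1

lemma cj_word {l : Fin d × Bool} {A : Subgroup (FG d)} (hA : Supp A {il l}ᶜ) {a : FG d}
    (ha : a ∈ nt A) : (lt1 l * a * (lt1 l)⁻¹).toWord = l :: (a.toWord ++ [il l]) := by
  apply conj_word ha.2
  · intro h; exact hA a ha.1 _ h rfl
  · intro h; exact hA a⁻¹ (A.inv_mem ha.1) _ h rfl

lemma cj_supp {l : Fin d × Bool} {A : Subgroup (FG d)} (hA : Supp A {il l}ᶜ) :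
    Supp (cj l A) {l} := by
  intro x hx a ha
  by_cases h1 : x = 1
  · subst h1; simp [hd] at ha
  have : x ∈ nt (cj l A) := ⟨hx, h1⟩
  rw [mem_nt_cj] at this
  obtain ⟨b, hb, rfl⟩ := this
  simp only [hd] at ha
  rw [cj_word hA hb] at ha
  simpa using ha.symm

lemma cj_pois {l : Fin d × Bool} {A : Subgroup (FG d)} (hA : Supp A {il l}ᶜ) (u : ℝ≥0∞) :
    pois u (nt (cj l A)) = u ^ 2 * pois u (nt A) := by
  rw [mem_nt_cj]
  unfold pois
  rw [tsum_image (fun g : FG d => u ^ (FreeGroup.norm g)), ← ENNReal.tsum_mul_left]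
  · refine tsum_congr (fun a => ?_)
    have := cj_word hA a.2
    unfold FreeGroup.norm
    rw [this]
    simp only [List.length_cons, List.length_append, List.length_nil]
    ring
  · intro a _ b _ hab
    simpa using hab

/-- the effect of conjugation on `phi` -/
noncomputable def Tf (u x : ℝ) : ℝ := u ^ 2 * x / (1 - (1 - u ^ 2) * x)

lemma cj_phi {l : Fin d × Bool} {A : Subgroup (FG d)} (hA : Supp A {il l}ᶜ) (u : ℝ) (hu : 0 < u) :
    phi (ENNReal.ofReal u) (cj l A) = Tf u (phi (ENNReal.ofReal u) A) := by
  have hc := cj_pois hA (ENNReal.ofReal u)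
  by_cases h : pois (ENNReal.ofReal u) (A : Set (FG d)) = ∞
  · have h1 : pois (ENNReal.ofReal u) (nt A) = ∞ := by
      rw [pois_nt] at h; simpa using h
    rw [h1, ENNReal.mul_top (by simpa using hu)] at hc
    have h2 : pois (ENNReal.ofReal u) (cj l A : Set (FG d)) = ∞ := by
      rw [pois_nt, hc]; simp
    rw [(phi_eq_one_iff _ _).2 h, (phi_eq_one_iff _ _).2 h2]
    unfold Tf
    have : 1 - (1 - u^2) * 1 = u^2 := by ring
    rw [this]; field_simp
  · have h1 : pois (ENNReal.ofReal u) (nt A) ≠ ∞ := by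
      rw [pois_nt] at h; simpa using h
    rw [phi_real, phi_real, pois_nt, pois_nt, hc]
    rw [ENNReal.toReal_add ENNReal.one_ne_top (ENNReal.mul_ne_top (by simp) h1),
      ENNReal.toReal_add ENNReal.one_ne_top h1, ENNReal.toReal_mul, ENNReal.toReal_pow,
      ENNReal.toReal_ofReal hu.le, ENNReal.toReal_one]
    have p0 : 0 ≤ (pois (ENNReal.ofReal u) (nt A)).toReal := ENNReal.toReal_nonneg
    generalize (pois (ENNReal.ofReal u) (nt A)).toReal = p at *
    unfold Tf
    have e1 : 1 - (1 + p)⁻¹ = p / (1+p) := by field_simp; ring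
    have e2 : 1 - (1 - u^2) * (p / (1+p)) = (1 + u^2 * p) / (1+p) := by field_simp; ring
    rw [e1, e2]
    have : 0 < 1 + u^2 * p := by positivity
    field_simp
    ring

lemma fam_join {ι : Type*} [DecidableEq ι] (A : ι → Subgroup (FG d))
    (T : ι → Set (Fin d × Bool)) (hA : ∀ i, Supp (A i) (T i))
    (hT : ∀ i j, i ≠ j → Disjoint (T i) (T j)) (s : Finset ι) :
    Supp (s.sup A) (⋃ i ∈ s, T i) ∧ ∀ u, phi u (s.sup A) = min 1 (∑ i ∈ s, phi u (A i)) := by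
  induction s using Finset.induction_on with
  | empty =>
    constructor
    · intro x hx a ha
      simp only [Finset.sup_empty, Subgroup.mem_bot] at hx
      subst hx
      simp [hd] at ha
    · intro u
      simp [phi, pois_one]
  | insert i s hi ih =>
    obtain ⟨h1, h2⟩ := ih
    have hd : Disjoint (T i) (⋃ i ∈ s, T i) := by
      rw [Set.disjoint_iUnion₂_right]
      intro j hj
      apply hT
      rintro rfl
      exact hi hj
    obtain ⟨h3, h4⟩ := join_lemma (hA i) h1 hd
    rw [Finset.sup_insert]
    refine ⟨by simpa using h3, fun u => ?_⟩
    rw [h4, h2, Finset.sum_insert hi]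
    have := phi_nonneg u (A i)
    rcases le_total 1 (∑ i ∈ s, phi u (A i)) with h | h
    · rw [min_eq_left h, min_eq_left, min_eq_left] <;> linarith
    · rw [min_eq_right h]

/-- loop subgroup -/
def loopS (i : Fin d) : Subgroup (FG d) := Subgroup.zpowers (FreeGroup.of i)

lemma toWord_of_negpow (i : Fin d) (n : ℕ) :
    ((FreeGroup.of i ^ n)⁻¹).toWord = List.replicate n (i, false) := by
  rw [FreeGroup.toWord_inv, FreeGroup.toWord_of_pow]
  simp [FreeGroup.invRev]

lemma norm_of_zpow (i : Fin d) (n : ℤ) : FreeGroup.norm (FreeGroup.of i ^ n) = n.natAbs := by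
  cases n with
  | ofNat n => simp
  | negSucc n => rw [zpow_negSucc, FreeGroup.norm_inv_eq, FreeGroup.norm_of_pow]; rfl

lemma loop_supp (i : Fin d) : Supp (loopS i) {p | p.1 = i} := by
  rintro x ⟨n, rfl⟩ a ha
  simp only [hd] at ha
  cases n with
  | ofNat n =>
    simp only [Int.ofNat_eq_natCast, zpow_natCast, FreeGroup.toWord_of_pow] at ha
    have := List.mem_of_mem_head? ha
    rw [List.mem_replicate] at this
    simp [this.2]
  | negSucc n =>
    simp only [zpow_negSucc, toWord_of_negpow] at ha
    have := List.mem_of_mem_head? ha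
    rw [List.mem_replicate] at this
    simp [this.2]

lemma loop_pois (i : Fin d) (u : ℝ) (hu : 0 < u) (hu1 : u < 1) :
    pois (ENNReal.ofReal u) (loopS i : Set (FG d)) = ENNReal.ofReal ((1+u)/(1-u)) := by
  have hinj : Function.Injective (fun n : ℤ => FreeGroup.of i ^ n) := by
    apply injective_zpow_iff_not_isOfFinOrder.2
    rw [isOfFinOrder_iff_eq_one]
    exact FreeGroup.of_ne_one i
  have hset : (loopS i : Set (FG d)) = Set.range (fun n : ℤ => FreeGroup.of i ^ n) := rfl
  unfold pois
  rw [hset, tsum_range (fun g : FG d => (ENNReal.ofReal u) ^ (FreeGroup.norm g)) hinj]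
  have e : ∀ n : ℤ, (ENNReal.ofReal u) ^ (FreeGroup.norm (FreeGroup.of i ^ n)) =
      (ENNReal.ofReal u) ^ n.natAbs := fun n => by rw [norm_of_zpow]
  simp_rw [e]
  rw [tsum_of_nat_of_neg_add_one ENNReal.summable ENNReal.summable]
  have e2 : ∀ n : ℕ, (-((n:ℤ)+1)).natAbs = n + 1 := by intro n; omega
  simp_rw [e2, Int.natAbs_natCast]
  have h0 : 0 < 1 - u := by linarith
  have hs := summable_geometric_of_lt_one hu.le hu1
  have hs' := tsum_geometric_of_lt_one hu.le hu1
  have e3 : ∑' n : ℕ, (ENNReal.ofReal u) ^ n = ENNReal.ofReal ((1-u)⁻¹) := by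
    rw [← hs', ENNReal.ofReal_tsum_of_nonneg (fun n => by positivity) hs]
    exact tsum_congr (fun n => (ENNReal.ofReal_pow hu.le n).symm)
  have e4 : ∑' n : ℕ, (ENNReal.ofReal u) ^ (n+1) = ENNReal.ofReal (u * (1-u)⁻¹) := by
    rw [ENNReal.ofReal_mul hu.le, ← e3, ← ENNReal.tsum_mul_left]
    exact tsum_congr (fun n => by ring)
  rw [e3, e4, ← ENNReal.ofReal_add (by positivity) (by positivity)]
  congr 1
  field_simp

lemma loop_phi (i : Fin d) (u : ℝ) (hu : 0 < u) (hu1 : u < 1) :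
    phi (ENNReal.ofReal u) (loopS i : Subgroup (FG d)) = 2 * u / (1 + u) := by
  rw [phi_real, loop_pois i u hu hu1]
  have h0 : 0 < 1 - u := by linarith
  rw [ENNReal.toReal_ofReal (by positivity)]
  field_simp
  ring

lemma loop_fg (i : Fin d) : (loopS i : Subgroup (FG d)).FG := 
  ⟨{FreeGroup.of i}, by rw [Finset.coe_singleton, ← Subgroup.zpowers_eq_closure]; rfl⟩

lemma cj_fg (l : Fin d × Bool) {A : Subgroup (FG d)} (h : A.FG) : (cj l A).FG := by
  classical
  obtain ⟨S, rfl⟩ := h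
  refine ⟨S.image (MulAut.conj (lt1 l)).toMonoidHom, ?_⟩
  rw [cj, MonoidHom.map_closure]
  simp

end

section

open Filter
open scoped ENNReal Pointwise
set_option autoImplicit false

/-- realizable values -/
def Kset (d : ℕ) (u : ℝ) : Set ℝ := {x | x < 1 ∧ ∀ l : Fin d × Bool, ∃ A : Subgroup (FG d),
  A.FG ∧ Supp A {l}ᶜ ∧ phi (ENNReal.ofReal u) A = x}

/-- realizable values of pairs of opposite letters -/
def Pset (u : ℝ) (K : Set ℝ) : Set ℝ :=
  {p | (∃ k ∈ K, ∃ k' ∈ K, p = Tf u k + Tf u k') ∨ p = 2 * u / (1 + u)}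

lemma il_il {d : ℕ} (l : Fin d × Bool) : il (il l) = l := by simp [il]

lemma alpha_pos {u x : ℝ} (hu : 0 < u) (hu1 : u < 1) (hx1 : x ≤ 1) :
    0 < 1 - (1 - u ^ 2) * x := by
  nlinarith [mul_pos hu hu, mul_self_nonneg (1 - u^2), mul_nonneg (by nlinarith : 0 ≤ 1 - u^2) (sub_nonneg.2 hx1)]

lemma Tf_nonneg {u x : ℝ} (hu : 0 < u) (hu1 : u < 1) (hx : 0 ≤ x) (hx1 : x ≤ 1) : 0 ≤ Tf u x := by
  have := alpha_pos hu hu1 hx1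
  unfold Tf; positivity

lemma Tf_sub {u x y : ℝ} (hu : 0 < u) (hu1 : u < 1) (hx1 : x ≤ 1) (hy1 : y ≤ 1) :
    Tf u y - Tf u x = u ^ 2 * (y - x) / ((1 - (1 - u ^ 2) * x) * (1 - (1 - u ^ 2) * y)) := by
  have h1 := alpha_pos hu hu1 hx1
  have h2 := alpha_pos hu hu1 hy1
  unfold Tf
  rw [div_sub_div _ _ h2.ne' h1.ne', mul_comm (1 - (1 - u ^ 2) * x)]
  congr 1
  ring

lemma Tf_mono {u x y : ℝ} (hu : 0 < u) (hu1 : u < 1) (hxy : x ≤ y) (hy1 : y ≤ 1) :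
    Tf u x ≤ Tf u y := by
  have h1 := alpha_pos hu hu1 (hxy.trans hy1)
  have h2 := alpha_pos hu hu1 hy1
  have h3 := Tf_sub hu hu1 (hxy.trans hy1) hy1
  have : 0 ≤ u ^ 2 * (y - x) / ((1 - (1 - u ^ 2) * x) * (1 - (1 - u ^ 2) * y)) := by
    have : 0 ≤ y - x := by linarith
    positivity
  linarith

lemma Kset_nonneg {d : ℕ} (hd : 0 < d) {u x : ℝ} (hx : x ∈ Kset d u) : 0 ≤ x := by
  obtain ⟨A, _, _, h⟩ := hx.2 (⟨0, hd⟩, true)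
  rw [← h]; exact phi_nonneg _ _

lemma zero_mem_Kset {d : ℕ} {u : ℝ} : (0 : ℝ) ∈ Kset d u := by
  refine ⟨one_pos, fun l => ⟨⊥, Subgroup.FG.bot, ?_, ?_⟩⟩
  · intro x hx a ha
    rw [Subgroup.mem_bot] at hx
    subst hx
    simp [hd] at ha
  · simp [phi, pois_one]

lemma Pset_real {d : ℕ} (hd : 0 < d) {u : ℝ} (hu : 0 < u) (hu1 : u < 1) {p : ℝ}
    (hp : p ∈ Pset u (Kset d u)) (hp1 : p < 1) (i : Fin d) :
    ∃ A : Subgroup (FG d), A.FG ∧ Supp A {q | q.1 = i} ∧ phi (ENNReal.ofReal u) A = p := by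
  rcases hp with ⟨k, hk, k', hk', rfl⟩ | rfl
  · obtain ⟨A, hA1, hA2, hA3⟩ := hk.2 (il (i, true))
    obtain ⟨B, hB1, hB2, hB3⟩ := hk'.2 (il (i, false))
    have hdis : Disjoint ({(i, true)} : Set (Fin d × Bool)) {(i, false)} := by simp
    obtain ⟨h1, h2⟩ := join_lemma (cj_supp hA2) (cj_supp hB2) hdis
    refine ⟨_, (cj_fg (i, true) hA1).sup (cj_fg (i, false) hB1), ?_, ?_⟩
    · intro x hx a ha
      rcases h1 x hx a ha with h | h
      · simp only [Set.mem_singleton_iff] at h; simp [h]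
      · simp only [Set.mem_singleton_iff] at h; simp [h]
    · rw [h2, cj_phi hA2 u hu, cj_phi hB2 u hu, hA3, hB3, min_eq_right hp1.le]
  · exact ⟨loopS i, loop_fg i, loop_supp i, loop_phi i u hu hu1⟩

lemma Pset_nonneg {d : ℕ} (hd : 0 < d) {u : ℝ} (hu : 0 < u) (hu1 : u < 1) {p : ℝ}
    (hp : p ∈ Pset u (Kset d u)) : 0 ≤ p := by
  rcases hp with ⟨k, hk, k', hk', rfl⟩ | rfl
  · have := Tf_nonneg hu hu1 (Kset_nonneg hd hk) hk.1.le
    have := Tf_nonneg hu hu1 (Kset_nonneg hd hk') hk'.1.le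
    linarith
  · positivity

lemma Kset_closed {n : ℕ} {u : ℝ} (hu : 0 < u) (hu1 : u < 1) {y : ℝ} (hy : y ∈ Kset (n+1) u)
    (p : Fin n → ℝ) (hp : ∀ j, p j ∈ Pset u (Kset (n+1) u))
    (hlt : Tf u y + ∑ j, p j < 1) : Tf u y + ∑ j, p j ∈ Kset (n+1) u := by
  refine ⟨hlt, fun l => ?_⟩
  have hp0 : ∀ j, 0 ≤ p j := fun j => Pset_nonneg (Nat.succ_pos n) hu hu1 (hp j)
  have hy0 := Tf_nonneg hu hu1 (Kset_nonneg (Nat.succ_pos n) hy) hy.1.le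
  have hp1 : ∀ j, p j < 1 := by
    intro j
    have := Finset.single_le_sum (f := p) (fun i _ => hp0 i) (Finset.mem_univ j)
    linarith
  let T : Fin (n+1) → Set (Fin (n+1) × Bool) := fun i =>
    if i = l.1 then {il l} else {q | q.1 = i}
  let v : Fin (n+1) → ℝ := l.1.insertNth (Tf u y) p
  have hex : ∀ i, ∃ A : Subgroup (FG (n+1)), A.FG ∧ Supp A (T i) ∧
      phi (ENNReal.ofReal u) A = v i := by
    intro i
    rcases Fin.eq_self_or_eq_succAbove l.1 i with h | ⟨j, h⟩
    · obtain ⟨A, hA1, hA2, hA3⟩ := hy.2 (il (il l))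
      refine ⟨cj (il l) A, cj_fg _ hA1, ?_, ?_⟩
      · simp only [T, h, if_true]; exact cj_supp hA2
      · rw [cj_phi hA2 u hu, hA3, h]; simp [v]
    · obtain ⟨A, hA1, hA2, hA3⟩ := Pset_real (Nat.succ_pos n) hu hu1 (hp j) (hp1 j) i
      refine ⟨A, hA1, ?_, ?_⟩
      · have : i ≠ l.1 := by rw [h]; exact Fin.succAbove_ne _ _
        simp only [T, if_neg this]; exact hA2
      · rw [hA3, h]; simp [v]
  choose A hA1 hA2 hA3 using hex
  have hT1 : ∀ i, ∀ q ∈ T i, q.1 = i := by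
    intro i q hq
    simp only [T] at hq
    split_ifs at hq with h
    · simp only [Set.mem_singleton_iff] at hq; rw [hq, h]; rfl
    · exact hq
  have hT : ∀ i j, i ≠ j → Disjoint (T i) (T j) := by
    intro i j hij
    rw [Set.disjoint_left]
    intro q hq hq'
    exact hij ((hT1 i q hq).symm.trans (hT1 j q hq'))
  obtain ⟨h1, h2⟩ := fam_join A T hA2 hT Finset.univ
  refine ⟨_, Subgroup.FG.finset_sup Finset.univ A (fun i _ => hA1 i), ?_, ?_⟩
  · intro x hx a ha hal
    have hal : a = l := hal
    subst hal
    have := h1 x hx a ha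
    simp only [Set.mem_iUnion, Finset.mem_univ, exists_true_left] at this
    obtain ⟨i, hi⟩ := this
    have h3 := hT1 i a hi
    simp only [T, h3, if_true] at hi
    have : a = il a := by simpa using hi
    have := congrArg Prod.snd this
    simp [il] at this
  · rw [h2]
    have : ∑ i, phi (ENNReal.ofReal u) (A i) = Tf u y + ∑ j, p j := by
      simp_rw [hA3]
      rw [Fin.sum_univ_succAbove v l.1]
      simp [v]
    rw [this, min_eq_right hlt.le]

lemma root_lemma {d : ℕ} {u v : ℝ} (hu : 0 < u) (huv : u ≤ v) (hv1 : v < 1) {k : ℝ}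
    (hk : k ∈ Kset d u) : ∃ H : Subgroup (FG d), H.FG ∧
      phi (ENNReal.ofReal u) H = min 1 (2 * d * Tf u k) ∧
      min 1 (2 * d * Tf v k) ≤ phi (ENNReal.ofReal v) H := by
  choose A hA1 hA2 hA3 using fun l : Fin d × Bool => hk.2 (il l)
  obtain ⟨h1, h2⟩ := fam_join (fun l => cj l (A l)) (fun l => {l}) (fun l => cj_supp (hA2 l))
    (fun i j hij => by simpa using hij) Finset.univ
  refine ⟨_, Subgroup.FG.finset_sup Finset.univ (fun l => cj l (A l)) (fun i _ => cj_fg _ (hA1 i)),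
    ?_, ?_⟩
  · rw [h2]
    simp_rw [cj_phi (hA2 _) u hu, hA3]
    simp [mul_comm]
  · rw [h2]
    apply min_le_min le_rfl
    simp_rw [cj_phi (hA2 _) v (hu.trans_le huv)]
    have : 2 * d * Tf v k = ∑ l : Fin d × Bool, Tf v k := by simp [mul_comm]
    rw [this]
    refine Finset.sum_le_sum (fun l _ => Tf_mono (hu.trans_le huv) hv1 ?_ (phi_le_one _ _))
    rw [← hA3 l]
    exact phi_mono_u (ENNReal.ofReal_le_ofReal huv) _

end

section

open Filter
open scoped ENNReal Pointwise
set_option autoImplicit false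

def Chain (X : Set ℝ) (r s : ℝ) : Prop := ∀ z, 0 ≤ z → z < r → ∃ x ∈ X, z < x ∧ x ≤ z + s

lemma Chain.mono {X : Set ℝ} {r s s' : ℝ} (h : Chain X r s) (hs : s ≤ s') : Chain X r s' := by
  intro z hz hz'
  obtain ⟨x, hx, h1, h2⟩ := h z hz hz'
  exact ⟨x, hx, h1, by linarith⟩

lemma Chain.add {X Y : Set ℝ} {r r' s : ℝ} (hX : Chain X r s) (hY : Chain Y r' s)
    (hX0 : (0:ℝ) ∈ X) (hY0 : (0:ℝ) ∈ Y) (hr' : 0 ≤ r') : Chain (X + Y) (r + r') s := by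
  intro z hz hz'
  by_cases h : z < r'
  · obtain ⟨y, hy, h1, h2⟩ := hY z hz h
    exact ⟨0 + y, Set.add_mem_add hX0 hy, by linarith, by linarith⟩
  · push Not at h
    obtain ⟨x, hx, h1, h2⟩ := hX (z - r') (by linarith) (by linarith)
    by_cases hxz : z < x
    · exact ⟨x + 0, Set.add_mem_add hx hY0, by linarith, by linarith⟩
    · push Not at hxz
      obtain ⟨y, hy, h3, h4⟩ := hY (z - x) (by linarith) (by linarith)
      exact ⟨x + y, Set.add_mem_add hx hy, by linarith, by linarith⟩

/-- n-fold sums -/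
def nsum (P : Set ℝ) (n : ℕ) : Set ℝ := {x | ∃ p : Fin n → ℝ, (∀ j, p j ∈ P) ∧ x = ∑ j, p j}

lemma nsum_zero_mem {P : Set ℝ} (h : (0:ℝ) ∈ P) (n : ℕ) : (0:ℝ) ∈ nsum P n :=
  ⟨fun _ => 0, fun _ => h, by simp⟩

lemma nsum_chain {P : Set ℝ} {r s : ℝ} (hP : Chain P r s) (h0 : (0:ℝ) ∈ P) (hr : 0 ≤ r) (n : ℕ) :
    Chain (nsum P n) (n * r) s := by
  induction n with
  | zero => intro z hz hz'; simp at hz'; linarith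
  | succ n ih =>
    have := hP.add ih h0 (nsum_zero_mem h0 n) (by positivity)
    intro z hz hz'
    push_cast at hz'
    obtain ⟨x, ⟨p0, hp0, x', ⟨p, hp, rfl⟩, rfl⟩, h1, h2⟩ := this z hz (by linarith)
    refine ⟨_, ⟨Fin.cons p0 p, ?_, rfl⟩, ?_⟩
    · intro j
      refine Fin.cases ?_ (fun i => ?_) j
      · simpa using hp0
      · simpa using hp i
    · rw [Fin.sum_univ_succ]
      simpa using ⟨h1, h2⟩

set_option maxHeartbeats 1000000 in
/-- one refinement step -/
lemma refine_step (n : ℕ) (u b : ℝ) (hu : 0 < u) (hu1 : u < 1) (hb0 : 0 < b) (hb1 : b < 1)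
    (hb2 : u < 1 - (1 - u ^ 2) * b) (hb3 : 1 - (1 - u ^ 2) * b < (2 * n + 1) * u ^ 2)
    (K : Set ℝ) (h0 : (0:ℝ) ∈ K) (hK : ∀ k ∈ K, 0 ≤ k ∧ k < 1)
    (hcl : ∀ y ∈ K, ∀ p : Fin n → ℝ, (∀ j, p j ∈ Pset u K) → Tf u y + ∑ j, p j < 1 →
      Tf u y + ∑ j, p j ∈ K)
    (θ : ℝ) (hθ1 : u ^ 2 / (1 - (1 - u ^ 2) * b) ^ 2 ≤ θ)
    (hθ2 : u ^ 2 / (u ^ 2 + (1 - (1 - u ^ 2) * b - u) ^ 2 / 2) ≤ θ)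
    (hθ3 : 1 - (1 - (1 - u ^ 2) * b - u) ^ 2 / 2 ≤ θ)
    (G : ℝ) (hG : 0 < G) (hC : Chain (K ∪ Set.Ici 1) b G) : Chain (K ∪ Set.Ici 1) b (θ * G) := by
  have hu2 : 0 < 1 - u ^ 2 := by nlinarith
  obtain ⟨A, hA⟩ : ∃ A, A = 1 - (1 - u ^ 2) * b := ⟨_, rfl⟩
  rw [← hA] at hb2 hb3 hθ1 hθ2 hθ3
  have hA1 : A < 1 := by rw [hA]; nlinarith
  have hApos : 0 < A := by linarith
  have hθ1' : u ^ 2 / A ^ 2 * G ≤ θ * G := by gcongr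
  have hθ2' : u ^ 2 / (u ^ 2 + (A - u) ^ 2 / 2) * G ≤ θ * G := by gcongr
  have hθ3' : (1 - (A - u) ^ 2 / 2) * G ≤ θ * G := by gcongr
  -- the supremum
  obtain ⟨κ, hκle, hκb, hκ0, hκex⟩ : ∃ κ, (∀ k ∈ K, k ≤ b → k ≤ κ) ∧ κ ≤ b ∧ 0 ≤ κ ∧
      ∀ x, x < κ → ∃ k ∈ K, k ≤ b ∧ x < k := by
    have hne : (K ∩ Set.Iic b).Nonempty := ⟨0, h0, hb0.le⟩
    have hbd : BddAbove (K ∩ Set.Iic b) := ⟨b, fun x hx => hx.2⟩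
    refine ⟨sSup (K ∩ Set.Iic b), fun k hk hkb => le_csSup hbd ⟨hk, hkb⟩,
      csSup_le hne (fun x hx => hx.2), le_csSup hbd ⟨h0, hb0.le⟩, fun x hx => ?_⟩
    obtain ⟨k, hk, hxk⟩ := exists_lt_of_lt_csSup hne hx
    exact ⟨k, hk.1, hk.2, hxk⟩
  have hKl : ∀ x, x ≤ b → A ≤ 1 - (1 - u ^ 2) * x := by
    intro x hx; rw [hA]; nlinarith
  have hT0 : Tf u 0 = 0 := by simp [Tf]
  have hTlip : ∀ x y, x ≤ y → y ≤ b → Tf u y - Tf u x ≤ u ^ 2 / A ^ 2 * (y - x) := by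
    intro x y hxy hyb
    rw [Tf_sub hu hu1 (by linarith) (by linarith)]
    have h1 := hKl x (by linarith)
    have h2 := hKl y hyb
    have : A ^ 2 ≤ (1 - (1 - u ^ 2) * x) * (1 - (1 - u ^ 2) * y) := by
      rw [sq]; exact mul_le_mul h1 h2 hApos.le (by linarith)
    have h3 : 0 ≤ y - x := by linarith
    rw [div_mul_eq_mul_div]
    gcongr
  set X0 : Set ℝ := {t | ∃ k ∈ K, k ≤ b ∧ t = Tf u k} with hX0
  have hX00 : (0:ℝ) ∈ X0 := ⟨0, h0, hb0.le, hT0.symm⟩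
  have hTκ0 : 0 ≤ Tf u κ := Tf_nonneg hu hu1 hκ0 (by linarith)
  have hTb0 : 0 ≤ Tf u b := Tf_nonneg hu hu1 hb0.le (by linarith)
  have chX0 : Chain X0 (Tf u κ) (θ * G) := by
    intro z hz hz'
    have hD : 0 < u ^ 2 + (1 - u ^ 2) * z := by positivity
    obtain ⟨x, hx⟩ : ∃ x, x = z / (u ^ 2 + (1 - u ^ 2) * z) := ⟨_, rfl⟩
    have hx0 : 0 ≤ x := by rw [hx]; positivity
    have hTx : Tf u x = z := by
      unfold Tf
      have : 1 - (1 - u ^ 2) * x = u ^ 2 / (u ^ 2 + (1 - u ^ 2) * z) := by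
        rw [hx]; field_simp; ring
      rw [this, hx]; field_simp
    have hx1 : x ≤ 1 := by
      rw [hx, div_le_one hD]
      have : Tf u κ ≤ Tf u 1 := Tf_mono hu hu1 (by linarith) le_rfl
      have h1 : Tf u 1 = 1 := by
        unfold Tf
        have : 1 - (1 - u^2) * 1 = u^2 := by ring
        rw [this]; field_simp
      nlinarith [sq_nonneg u]
    have hxκ : x < κ := by
      by_contra! h
      have := Tf_mono hu hu1 h hx1
      linarith
    have hfin : ∃ k ∈ K, k ≤ b ∧ x < k ∧ k ≤ x + G := by
      obtain ⟨k, hk, h1, h2⟩ := hC x hx0 (by linarith)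
      by_cases hkb : k ≤ b
      · rcases hk with hk | hk
        · exact ⟨k, hk, hkb, h1, h2⟩
        · have : (1:ℝ) ≤ k := hk
          linarith
      · obtain ⟨k2, hk2, hk2b, hk2x⟩ := hκex x hxκ
        exact ⟨k2, hk2, hk2b, hk2x, by linarith⟩
    obtain ⟨k, hk, hkb, h1, h2⟩ := hfin
    refine ⟨Tf u k, ⟨k, hk, hkb, rfl⟩, ?_, ?_⟩
    · rw [← hTx]
      have h3 := alpha_pos hu hu1 hx1
      have h4 := alpha_pos hu hu1 (hK k hk).2.le
      have h5 := Tf_sub hu hu1 hx1 (hK k hk).2.le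
      have : 0 < u ^ 2 * (k - x) / ((1 - (1 - u ^ 2) * x) * (1 - (1 - u ^ 2) * k)) := by
        have : 0 < k - x := by linarith
        positivity
      linarith
    · have h3 := hTlip x k h1.le hkb
      have h4 : u ^ 2 / A ^ 2 * (k - x) ≤ u ^ 2 / A ^ 2 * G := by
        gcongr; linarith
      linarith
  have hXP : ∀ x ∈ X0 + X0, x ∈ Pset u K := by
    rintro x ⟨_, ⟨k, hk, _, rfl⟩, _, ⟨k', hk', _, rfl⟩, rfl⟩
    exact Or.inl ⟨k, hk, k', hk', rfl⟩
  have hP0 : (0:ℝ) ∈ Pset u K := Or.inl ⟨0, h0, 0, h0, by simp [hT0]⟩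
  have chXX := chX0.add chX0 hX00 hX00 hTκ0
  have chP : Chain (Pset u K) (2 * Tf u b) (θ * G) := by
    rcases eq_or_lt_of_le hκb with hκeq | hκlt
    · intro z hz hz'
      rw [hκeq] at chXX
      obtain ⟨x, hx, h1, h2⟩ := chXX z hz (by linarith)
      exact ⟨x, hXP x hx, h1, h2⟩
    · obtain ⟨k', hk', hk1, hk2⟩ := hC κ hκ0 hκlt
      have hk'b : b < k' := by
        by_contra! h
        rcases hk' with hk' | hk'
        · have := hκle k' hk' h
          linarith
        · have : (1:ℝ) ≤ k' := hk'
          linarith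
      obtain ⟨a, ha⟩ : ∃ a, a = 1 - (1 - u ^ 2) * κ := ⟨_, rfl⟩
      have haA : A ≤ a := by rw [ha]; exact hKl κ hκb
      have ha1 : a ≤ 1 := by rw [ha]; nlinarith
      have ha0 : 0 < a := by linarith
      by_cases hcase : k' < 1 ∧ u ^ 2 + (A - u) ^ 2 / 2 ≤ a * (1 - (1 - u ^ 2) * k')
      · obtain ⟨hk'1, hcase⟩ := hcase
        have hk'K : k' ∈ K := by
          rcases hk' with hk' | hk'
          · exact hk'
          · have : (1:ℝ) ≤ k' := hk'
            linarith
        have hdiff : Tf u k' - Tf u κ ≤ θ * G := by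
          rw [Tf_sub hu hu1 (by linarith) hk'1.le, ← ha]
          refine le_trans ?_ hθ2'
          rw [div_mul_eq_mul_div]
          have h3 : 0 ≤ k' - κ := by linarith
          have h4 : k' - κ ≤ G := by linarith
          gcongr
        set TK : Set ℝ := {t | ∃ k ∈ K, t = Tf u k} with hTK
        have hTK0 : (0:ℝ) ∈ TK := ⟨0, h0, hT0.symm⟩
        have chTK : Chain TK (Tf u b) (θ * G) := by
          intro z hz hz'
          by_cases hzκ : z < Tf u κ
          · obtain ⟨x, ⟨k, hk, _, hx⟩, h1, h2⟩ := chX0 z hz hzκ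
            exact ⟨x, ⟨k, hk, hx⟩, h1, h2⟩
          · push Not at hzκ
            refine ⟨Tf u k', ⟨k', hk'K, rfl⟩, ?_, by linarith⟩
            have := Tf_mono hu hu1 hk'b.le hk'1.le
            linarith
        have ch2 := chTK.add chTK hTK0 hTK0 hTb0
        intro z hz hz'
        obtain ⟨x, ⟨_, ⟨k, hk, rfl⟩, _, ⟨k2, hk2, rfl⟩, rfl⟩, h1, h2⟩ := ch2 z hz (by linarith)
        exact ⟨_, Or.inl ⟨k, hk, k2, hk2, rfl⟩, h1, h2⟩
      · have hsm : a * (1 - (1 - u ^ 2) * k') ≤ u ^ 2 + (A - u) ^ 2 / 2 := by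
          by_cases hk'1 : k' < 1
          · by_contra! h
            exact hcase ⟨hk'1, h.le⟩
          · push Not at hk'1
            have h1 : 1 - (1 - u ^ 2) * k' ≤ u ^ 2 := by nlinarith
            have h2 : a * (1 - (1 - u ^ 2) * k') ≤ a * u ^ 2 := by gcongr
            nlinarith [sq_nonneg (A - u), sq_nonneg u]
        obtain ⟨e, he⟩ : ∃ e, e = (A - u) ^ 2 / 2 := ⟨_, rfl⟩
        rw [← he] at hsm hθ3'
        have he0 : 0 ≤ e := by rw [he]; positivity
        have hea : 2 * e ≤ (a - u) ^ 2 := by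
          have : (A - u) ^ 2 ≤ (a - u) ^ 2 := pow_le_pow_left₀ (by linarith) (by linarith) 2
          linarith
        have hGe : a ^ 2 - u ^ 2 - e ≤ a * (1 - u ^ 2) * G := by
          have : a * (1 - u ^ 2) * (k' - κ) ≤ a * (1 - u ^ 2) * G := by
            gcongr; linarith
          have h5 : a * (1 - u ^ 2) * (k' - κ) = a * a - a * (1 - (1 - u ^ 2) * k') := by
            have : (1 - u ^ 2) * κ = 1 - a := by linarith
            linear_combination (-a) * this
          linarith [sq a]
        have he1 : e ≤ 1 := by
          have : (A - u) ^ 2 ≤ 1 := pow_le_one₀ (by linarith) (by linarith)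
          linarith
        have hc : 2 * u / (1 + u) - 2 * Tf u κ = 2 * u * (a - u) / (a * (1 - u ^ 2)) := by
          have hκa : κ = (1 - a) / (1 - u ^ 2) := by
            rw [ha]; field_simp; ring
          unfold Tf
          rw [← ha, hκa]
          have h1u : 0 < 1 - u := by linarith
          have : 1 - u ^ 2 = (1 - u) * (1 + u) := by ring
          rw [this]
          field_simp
          ring
        have hfin : 2 * u / (1 + u) - 2 * Tf u κ ≤ θ * G := by
          refine le_trans ?_ hθ3'
          rw [hc, div_le_iff₀ (by positivity)]
          have h6 : (1 - e) * (a ^ 2 - u ^ 2 - e) ≤ (1 - e) * (a * (1 - u ^ 2) * G) := by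
            apply mul_le_mul_of_nonneg_left hGe; linarith
          have h7 : 2 * u * (a - u) ≤ (1 - e) * (a ^ 2 - u ^ 2 - e) := by
            have h8 : a ^ 2 - u ^ 2 - e ≤ 1 := by
              have := pow_le_one₀ ha0.le ha1 (n := 2)
              linarith [sq_nonneg u]
            have h9 : e * (a ^ 2 - u ^ 2 - e) ≤ e * 1 := mul_le_mul_of_nonneg_left h8 he0
            linarith [h9, hea, (by ring : (a - u) ^ 2 = a ^ 2 - u ^ 2 - 2 * u * (a - u)),
              (by ring : (1 - e) * (a ^ 2 - u ^ 2 - e) = (a ^ 2 - u ^ 2 - e) - e * (a ^ 2 - u ^ 2 - e))]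
          calc _ ≤ _ := h7
            _ ≤ _ := h6
            _ = _ := by ring
        have hcb : 2 * Tf u b ≤ 2 * u / (1 + u) := by
          have hbb : Tf u b = u / (1 - u ^ 2) * ((u - u * A) / A) := by
            have hba : b = (1 - A) / (1 - u ^ 2) := by
              rw [hA]; field_simp; ring
            unfold Tf
            rw [← hA, hba]
            field_simp
          have h9 : 2 * u / (1 + u) = 2 * (u / (1 - u^2) * (1 - u)) := by
            have h1u : 0 < 1 - u := by linarith
            have : 1 - u ^ 2 = (1 - u) * (1 + u) := by ring
            rw [this]
            field_simp
          rw [hbb, h9]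
          have : (u - u * A) / A ≤ 1 - u := by
            rw [div_le_iff₀ hApos]; nlinarith
          gcongr
        intro z hz hz'
        by_cases hzκ : z < 2 * Tf u κ
        · obtain ⟨x, hx, h1, h2⟩ := chXX z hz (by linarith)
          exact ⟨x, hXP x hx, h1, h2⟩
        · push Not at hzκ
          exact ⟨_, Or.inr rfl, by linarith, by linarith⟩
  have chS := chX0.add (nsum_chain chP hP0 (by positivity) n) hX00 (nsum_zero_mem hP0 n)
    (by positivity)
  have hbig : κ < Tf u κ + n * (2 * Tf u b) := by
    have h1 := hTlip κ b hκb le_rfl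
    have h2 : u ^ 2 / A ^ 2 * (b - κ) ≤ 1 * (b - κ) := by
      apply mul_le_mul_of_nonneg_right _ (by linarith)
      rw [div_le_one (by positivity)]
      gcongr
    have h3 : b < (2 * n + 1) * Tf u b := by
      unfold Tf
      rw [← hA, mul_div_assoc', lt_div_iff₀ hApos]
      nlinarith
    linarith
  have hmem : ∀ x ∈ X0 + nsum (Pset u K) n, x ∈ K ∪ Set.Ici 1 := by
    rintro x ⟨_, ⟨k, hk, _, rfl⟩, _, ⟨p, hp, rfl⟩, rfl⟩
    by_cases h : Tf u k + ∑ j, p j < 1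
    · exact Or.inl (hcl k hk p hp h)
    · exact Or.inr (not_lt.1 h)
  intro y hy hyb
  by_cases hyκ : y < κ
  · obtain ⟨x, hx, h1, h2⟩ := chS y hy (by linarith)
    exact ⟨x, hmem x hx, h1, h2⟩
  · push Not at hyκ
    obtain ⟨x, hx, h1, h2⟩ := chS κ hκ0 hbig
    refine ⟨x, hmem x hx, ?_, by linarith⟩
    rcases hmem x hx with hxK | hx1
    · by_contra! h
      have := hκle x hxK (by linarith)
      linarith
    · have : (1:ℝ) ≤ x := hx1
      linarith

lemma dense_K (n : ℕ) (u : ℝ) (hu : 0 < u) (hu1 : u < 1) (hq : 1 < (2 * n + 1) * u)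
    (K : Set ℝ) (h0 : (0:ℝ) ∈ K) (hK : ∀ k ∈ K, 0 ≤ k ∧ k < 1)
    (hcl : ∀ y ∈ K, ∀ p : Fin n → ℝ, (∀ j, p j ∈ Pset u K) → Tf u y + ∑ j, p j < 1 →
      Tf u y + ∑ j, p j ∈ K) (y ε : ℝ) (hy : 0 ≤ y) (hy1 : y < 1 / (1 + (2 * n + 1) * u ^ 2))
    (hε : 0 < ε) : ∃ k ∈ K ∪ Set.Ici 1, y < k ∧ k ≤ y + ε := by
  have hu2 : 0 < 1 - u ^ 2 := by nlinarith
  have hqu : u < (2 * n + 1) * u ^ 2 := by nlinarith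
  obtain ⟨b, hb1, hb2⟩ : ∃ b, max (max 0 ((1 - (2 * n + 1) * u ^ 2) / (1 - u ^ 2)))
      (1 / (1 + (2 * n + 1) * u ^ 2)) < b ∧ b < 1 / (1 + u) := by
    apply exists_between
    refine max_lt (max_lt (by positivity) ?_) ?_
    · rw [div_lt_div_iff₀ hu2 (by positivity)]
      nlinarith
    · apply one_div_lt_one_div_of_lt (by positivity); linarith
  have hb0 : 0 < b := lt_of_le_of_lt (le_max_of_le_left (le_max_left _ _)) hb1
  have hbx : (1 - (2 * n + 1) * u ^ 2) / (1 - u ^ 2) < b :=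
    lt_of_le_of_lt (le_max_of_le_left (le_max_right _ _)) hb1
  have hbz : 1 / (1 + (2 * n + 1) * u ^ 2) < b := lt_of_le_of_lt (le_max_right _ _) hb1
  rw [div_lt_iff₀ hu2] at hbx
  rw [lt_div_iff₀ (by positivity)] at hb2
  have hblt1 : b < 1 := by nlinarith
  have hA1 : u < 1 - (1 - u ^ 2) * b := by nlinarith
  have hA2 : 1 - (1 - u ^ 2) * b < (2 * n + 1) * u ^ 2 := by linarith
  obtain ⟨A, hA⟩ : ∃ A, A = 1 - (1 - u ^ 2) * b := ⟨_, rfl⟩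
  have hAu : u < A := by rw [hA]; exact hA1
  have hApos : 0 < A := by linarith
  obtain ⟨θ, hθ⟩ : ∃ θ, θ = max (u ^ 2 / A ^ 2) (max (u ^ 2 / (u ^ 2 + (A - u) ^ 2 / 2))
    (1 - (A - u) ^ 2 / 2)) := ⟨_, rfl⟩
  have hsq : 0 < (A - u) ^ 2 := by
    have : 0 < A - u := by linarith
    positivity
  have hθlt : θ < 1 := by
    rw [hθ]
    refine max_lt ?_ (max_lt ?_ (by linarith))
    · rw [div_lt_one (by positivity)]; gcongr
    · rw [div_lt_one (by positivity)]; linarith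
  have hθ0 : 0 < θ := by
    rw [hθ]; exact lt_max_of_lt_left (by positivity)
  have key : ∀ m : ℕ, Chain (K ∪ Set.Ici 1) b (θ ^ m) := by
    intro m
    induction m with
    | zero =>
      intro z hz hz'
      exact ⟨1, Or.inr (Set.mem_Ici.2 le_rfl), by linarith, by simp; linarith⟩
    | succ m ih =>
      rw [pow_succ']
      refine refine_step n u b hu hu1 hb0 hblt1 hA1 hA2 K h0 hK hcl θ ?_ ?_ ?_ _ (by positivity) ih
      · rw [← hA, hθ]; exact le_max_left _ _
      · rw [← hA, hθ]; exact le_max_of_le_right (le_max_left _ _)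
      · rw [← hA, hθ]; exact le_max_of_le_right (le_max_right _ _)
  obtain ⟨m, hm⟩ := exists_pow_lt_of_lt_one hε hθlt
  exact ((key m).mono hm.le) y hy (by linarith)

/-- Existence of a finitely generated seed. -/
lemma seed {d : ℕ} (hd : 2 ≤ d) (u v : ℝ) (hu : 0 < u) (huv : u < v) (hv1 : v < 1)
    (hq : 1 < (2 * (d:ℝ) - 1) * u) : ∃ H : Subgroup (FG d), H.FG ∧
      pois (ENNReal.ofReal u) (H : Set (FG d)) ≠ ∞ ∧
      pois (ENNReal.ofReal v) (H : Set (FG d)) = ∞ := by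
  obtain ⟨n, rfl⟩ : ∃ n, d = n + 1 := ⟨d - 1, by omega⟩
  have hu1 : u < 1 := huv.trans hv1
  push_cast at hq
  have hq' : 1 < (2 * (n:ℝ) + 1) * u := by linarith
  have hv0 : 0 < v := hu.trans huv
  have hlt : 1 / (1 + (2 * (n:ℝ) + 1) * v ^ 2) < 1 / (1 + (2 * (n:ℝ) + 1) * u ^ 2) := by
    apply one_div_lt_one_div_of_lt (by positivity)
    gcongr
  obtain ⟨k, hk, hk1, hk2⟩ := dense_K n u hu hu1 hq' (Kset (n+1) u) zero_mem_Kset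
    (fun k hk => ⟨Kset_nonneg (Nat.succ_pos n) hk, hk.1⟩)
    (fun y hy p hp h => Kset_closed hu hu1 hy p hp h)
    (1 / (1 + (2 * (n:ℝ) + 1) * v ^ 2))
    ((1 / (1 + (2 * (n:ℝ) + 1) * u ^ 2) - 1 / (1 + (2 * (n:ℝ) + 1) * v ^ 2)) / 2)
    (by positivity) hlt (by linarith)
  have hku : k < 1 / (1 + (2 * (n:ℝ) + 1) * u ^ 2) := by linarith
  have hz1 : 1 / (1 + (2 * (n:ℝ) + 1) * u ^ 2) ≤ 1 := by
    rw [div_le_one (by positivity)]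
    have : 0 ≤ (2 * (n:ℝ) + 1) * u ^ 2 := by positivity
    linarith
  have hkK : k ∈ Kset (n+1) u := by
    rcases hk with hk | hk
    · exact hk
    · have : (1:ℝ) ≤ k := hk
      linarith
  obtain ⟨H, hfg, h1, h2⟩ := root_lemma hu huv.le hv1 hkK
  refine ⟨H, hfg, ?_, ?_⟩
  · intro h
    rw [← phi_eq_one_iff, h1] at h
    have hk1' : k ≤ 1 := hkK.1.le
    have ha := alpha_pos hu hu1 hk1'
    have : 2 * ((n + 1 : ℕ) : ℝ) * Tf u k < 1 := by
      unfold Tf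
      rw [mul_div_assoc', div_lt_one ha]
      rw [lt_div_iff₀ (by positivity)] at hku
      push_cast
      nlinarith
    have := lt_of_le_of_lt (min_le_right 1 _) this
    linarith
  · rw [← phi_eq_one_iff]
    apply le_antisymm (phi_le_one _ _)
    refine le_trans (le_of_eq ?_) h2
    rw [min_eq_left]
    have hk1' : k ≤ 1 := hkK.1.le
    have ha := alpha_pos hv0 hv1 hk1'
    unfold Tf
    rw [mul_div_assoc', le_div_iff₀ ha]
    rw [div_lt_iff₀ (by positivity)] at hk1
    push_cast
    nlinarith

end

section

open Filter
open scoped ENNReal Pointwise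
set_option autoImplicit false
variable {d : ℕ}

/-- prefix -/
def pre (n : ℕ) (x : FG d) : FG d := FreeGroup.mk (x.toWord.take n)

lemma norm_inv_mul_pre (n : ℕ) (x : FG d) :
    FreeGroup.norm (x⁻¹ * pre n x) ≤ FreeGroup.norm x - n := by
  have h : x = pre n x * FreeGroup.mk (x.toWord.drop n) := by
    unfold pre
    rw [FreeGroup.mul_mk, List.take_append_drop, FreeGroup.mk_toWord]
  have h2 : x⁻¹ * pre n x = (FreeGroup.mk (x.toWord.drop n))⁻¹ := by
    nth_rewrite 1 [h]
    group
  rw [h2, FreeGroup.norm_inv_eq]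
  refine FreeGroup.norm_mk_le.trans ?_
  rw [List.length_drop]; rfl

lemma norm_pre (n : ℕ) (x : FG d) (h : n ≤ FreeGroup.norm x) : FreeGroup.norm (pre n x) = n := by
  have hr : FreeGroup.IsReduced (x.toWord.take n) :=
    FreeGroup.isReduced_toWord.infix (List.take_prefix _ _).isInfix
  unfold pre FreeGroup.norm
  rw [FreeGroup.toWord_mk, hr.reduce_eq, List.length_take]
  exact min_eq_left h

lemma pre_eq_of_gp {n : ℕ} {x y : FG d} (h : n ≤ gp x y) : pre n x = pre n y := by
  unfold pre; rw [gp_take x y h]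

def QC (H : Subgroup (FG d)) (D : ℕ) : Prop :=
  ∀ h ∈ H, ∀ n, ∃ h' ∈ H, FreeGroup.norm (h'⁻¹ * pre n h) ≤ D

lemma QC_mono {H : Subgroup (FG d)} {D D' : ℕ} (h : QC H D) (hD : D ≤ D') : QC H D' := by
  intro x hx n
  obtain ⟨h', h1, h2⟩ := h x hx n
  exact ⟨h', h1, h2.trans hD⟩

lemma exists_QC (H : Subgroup (FG d)) (hH : H.FG) : ∃ D, QC H D := by
  obtain ⟨S, rfl⟩ := hH
  refine ⟨S.sup FreeGroup.norm, ?_⟩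
  have step : ∀ h ∈ Subgroup.closure (S : Set (FG d)), ∀ s ∈ Subgroup.closure (S : Set (FG d)),
      FreeGroup.norm s ≤ S.sup FreeGroup.norm →
      (∀ n, ∃ h' ∈ Subgroup.closure (S : Set (FG d)),
        FreeGroup.norm (h'⁻¹ * pre n h) ≤ S.sup FreeGroup.norm) →
      (∀ n, ∃ h' ∈ Subgroup.closure (S : Set (FG d)),
        FreeGroup.norm (h'⁻¹ * pre n (h * s)) ≤ S.sup FreeGroup.norm) := by
    intro h hh s hs hsn ih n
    by_cases hn : n ≤ gp h (h * s)
    · rw [← pre_eq_of_gp hn]; exact ih n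
    · refine ⟨h * s, Subgroup.mul_mem _ hh hs, (norm_inv_mul_pre _ _).trans ?_⟩
      have h1 := fg_norm_inv_mul h (h * s)
      rw [inv_mul_cancel_left] at h1
      have h2 := gp_le_left h (h * s)
      omega
  intro h hh
  induction hh using Subgroup.closure_induction_right with
  | one => intro n; exact ⟨1, Subgroup.one_mem _, by simp [pre, ← FreeGroup.one_eq_mk]⟩
  | mul_right x hx y hy ih =>
    exact step x hx y (Subgroup.subset_closure hy) (Finset.le_sup (f := FreeGroup.norm) hy) ih
  | mul_inv_cancel x hx y hy ih =>
    refine step x hx y⁻¹ (Subgroup.inv_mem _ (Subgroup.subset_closure hy)) ?_ ih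
    rw [FreeGroup.norm_inv_eq]; exact (Finset.le_sup (f := FreeGroup.norm) hy)

lemma gp_bounded (A B : Subgroup (FG d)) (hA : A.FG) (hB : B.FG) (hAB : A ⊓ B = ⊥) :
    ∃ C, ∀ a ∈ A, ∀ b ∈ B, gp a b ≤ C := by
  obtain ⟨D1, hD1⟩ := exists_QC A hA
  obtain ⟨D2, hD2⟩ := exists_QC B hB
  obtain ⟨D, hD⟩ : ∃ D, D = max D1 D2 := ⟨_, rfl⟩
  replace hD1 := QC_mono hD1 (hD ▸ le_max_left _ _ : D1 ≤ D)
  replace hD2 := QC_mono hD2 (hD ▸ le_max_right _ _ : D2 ≤ D)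
  have hfin := ball_finite_s1 (d := d) (2 * D)
  obtain ⟨N, hN⟩ : ∃ N, N = hfin.toFinset.card := ⟨_, rfl⟩
  refine ⟨N * (2 * D + 1), fun a ha b hb => ?_⟩
  by_contra! hlt
  choose f hf hf' using hD1 a ha
  choose k hk hk' using hD2 b hb
  have hp : ∀ i ≤ N, pre (i * (2 * D + 1)) a = pre (i * (2 * D + 1)) b := by
    intro i hi
    apply pre_eq_of_gp
    refine le_trans ?_ hlt.le
    gcongr
  have hpn : ∀ i ≤ N, FreeGroup.norm (pre (i * (2 * D + 1)) a) = i * (2 * D + 1) := by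
    intro i hi
    apply norm_pre
    refine le_trans ?_ (hlt.le.trans (gp_le_left a b))
    gcongr
  have hmaps : ∀ i ∈ Finset.range (N + 1),
      (f (i * (2 * D + 1)))⁻¹ * k (i * (2 * D + 1)) ∈ hfin.toFinset := by
    intro i hi
    have hi' : i ≤ N := by simp at hi; omega
    rw [Set.Finite.mem_toFinset]
    have h1 := hf' (i * (2 * D + 1))
    have h2 := hk' (i * (2 * D + 1))
    rw [← hp i hi', ← FreeGroup.norm_inv_eq] at h2
    have h3 := FreeGroup.norm_mul_le ((f (i * (2 * D + 1)))⁻¹ * pre (i * (2 * D + 1)) a)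
      ((k (i * (2 * D + 1)))⁻¹ * pre (i * (2 * D + 1)) a)⁻¹
    have h4 : (f (i * (2 * D + 1)))⁻¹ * pre (i * (2 * D + 1)) a *
      ((k (i * (2 * D + 1)))⁻¹ * pre (i * (2 * D + 1)) a)⁻¹ =
      (f (i * (2 * D + 1)))⁻¹ * k (i * (2 * D + 1)) := by group
    rw [h4] at h3
    change FreeGroup.norm _ ≤ 2 * D
    omega
  obtain ⟨i, hi, j, hj, hij, heq⟩ := Finset.exists_ne_map_eq_of_card_lt_of_maps_to
    (by rw [Finset.card_range, ← hN]; omega) hmaps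
  simp only [Finset.mem_range] at hi hj
  -- wlog
  have hbot : f (j * (2 * D + 1)) * (f (i * (2 * D + 1)))⁻¹ ∈ A ⊓ B := by
    refine ⟨A.mul_mem (hf _) (A.inv_mem (hf _)), ?_⟩
    have : f (j * (2 * D + 1)) * (f (i * (2 * D + 1)))⁻¹ =
      k (j * (2 * D + 1)) * (k (i * (2 * D + 1)))⁻¹ := by
      have h5 : (f (i * (2 * D + 1)))⁻¹ = (f (j * (2 * D + 1)))⁻¹ * k (j * (2 * D + 1)) *
          (k (i * (2 * D + 1)))⁻¹ := by rw [← heq]; group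
      rw [h5]; group
    rw [this]
    exact B.mul_mem (hk _) (B.inv_mem (hk _))
  rw [hAB, Subgroup.mem_bot, mul_inv_eq_one] at hbot
  have h1 := hf' (i * (2 * D + 1))
  have h2 := hf' (j * (2 * D + 1))
  rw [hbot] at h2
  obtain ⟨z, hz⟩ : ∃ z, z = f (i * (2 * D + 1)) := ⟨_, rfl⟩
  rw [← hz] at h1 h2
  have key : ∀ i j, i ≤ N → j ≤ N → i < j →
      FreeGroup.norm (z⁻¹ * pre (i * (2 * D + 1)) a) ≤ D →
      FreeGroup.norm (z⁻¹ * pre (j * (2 * D + 1)) a) ≤ D → False := by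
    intro i j hi hj hij h1 h2
    rw [← FreeGroup.norm_inv_eq] at h1
    have h3 := FreeGroup.norm_mul_le (z⁻¹ * pre (i * (2 * D + 1)) a)⁻¹
      (z⁻¹ * pre (j * (2 * D + 1)) a)
    have h4 : (z⁻¹ * pre (i * (2 * D + 1)) a)⁻¹ * (z⁻¹ * pre (j * (2 * D + 1)) a) =
      (pre (i * (2 * D + 1)) a)⁻¹ * pre (j * (2 * D + 1)) a := by group
    rw [h4] at h3
    have h5 := FreeGroup.norm_mul_le (pre (i * (2 * D + 1)) a)
      ((pre (i * (2 * D + 1)) a)⁻¹ * pre (j * (2 * D + 1)) a)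
    rw [mul_inv_cancel_left, hpn i hi, hpn j hj] at h5
    have h6 : (i + 1) * (2 * D + 1) ≤ j * (2 * D + 1) := by gcongr; omega
    rw [add_mul, one_mul] at h6
    omega
  rcases lt_or_gt_of_ne hij with h | h
  · exact key i j (by omega) (by omega) h h1 h2
  · exact key j i (by omega) (by omega) h h2 h1

lemma norm_pow_ge (g : FG d) (hg : g ≠ 1) (n : ℕ) : n ≤ FreeGroup.norm (g ^ n) := by
  have hr := FreeGroup.reduceCyclically.reduce_flatten_replicate
    (FreeGroup.isReduced_toWord (x := g)) n
  unfold FreeGroup.norm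
  rw [FreeGroup.toWord_pow, hr]
  have hL : 1 ≤ (FreeGroup.reduceCyclically g.toWord).length := by
    rw [Nat.one_le_iff_ne_zero]
    intro h0
    have h1 := FreeGroup.reduceCyclically.conj_conjugator_reduceCyclically g.toWord
    rw [List.length_eq_zero_iff] at h0
    rw [h0, List.append_nil] at h1
    apply hg
    rw [← FreeGroup.mk_toWord (x := g), ← h1, ← FreeGroup.mul_mk, ← FreeGroup.inv_mk]
    exact mul_inv_cancel _
  split_ifs with h
  · omega
  · simp only [List.length_append, List.length_flatten, List.map_replicate, List.sum_replicate,
      smul_eq_mul]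
    nlinarith

lemma norm_zpow_ge (g : FG d) (hg : g ≠ 1) (n : ℤ) : n.natAbs ≤ FreeGroup.norm (g ^ n) := by
  rcases Int.eq_nat_or_neg n with ⟨k, rfl | rfl⟩
  · simpa using norm_pow_ge g hg k
  · simpa [FreeGroup.norm_inv_eq] using norm_pow_ge g hg k

/-- `gp x (x*y)` -/
lemma gp_mul_self (x y : FG d) : gp x (x * y) + gp x⁻¹ y = FreeGroup.norm x := by
  have h1 := fg_norm_inv_mul x (x * y)
  rw [inv_mul_cancel_left] at h1
  have h2 := norm_mul_gp x y
  omega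

lemma zpow_conj_trivial (H : Subgroup (FG d)) (g : FG d) (hg : g ≠ 1) (C : ℕ)
    (hC : ∀ a ∈ H, ∀ b ∈ Subgroup.zpowers g, gp a b ≤ C) (h : FG d) (hh : h ∈ H) (h1 : h ≠ 1) :
    Subgroup.zpowers g ⊓ Subgroup.zpowers (h * g * h⁻¹) = ⊥ := by
  rw [eq_bot_iff]
  rintro x ⟨⟨a, ha⟩, ⟨b, hb⟩⟩
  simp only at ha hb
  rw [Subgroup.mem_bot]
  by_contra hx
  have ha0 : a ≠ 0 := by rintro rfl; simp at ha; exact hx ha.symm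
  have hab : h * g ^ b * h⁻¹ = g ^ a := by
    rw [← conj_zpow, hb, ha]
  have hpow : ∀ n : ℕ, ∀ m : ℤ, h ^ n * g ^ (b ^ n * m) * (h ^ n)⁻¹ = g ^ (a ^ n * m) := by
    intro n
    induction n with
    | zero => intro m; simp
    | succ n ih =>
      intro m
      have e1 : h ^ (n+1) * g ^ (b ^ (n+1) * m) * (h ^ (n+1))⁻¹ =
          h * (h ^ n * g ^ (b ^ n * (b * m)) * (h ^ n)⁻¹) * h⁻¹ := by
        rw [pow_succ' h, show b ^ (n+1) * m = b ^ n * (b * m) by ring]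
        group
      rw [e1, ih, show a ^ n * (b * m) = b * (a ^ n * m) by ring, zpow_mul, ← conj_zpow, hab,
        ← zpow_mul]
      congr 1; ring
  obtain ⟨n, hn⟩ : ∃ n : ℕ, n = 2 * C + 1 := ⟨_, rfl⟩
  have hp := hpow n n
  have hcomm : h ^ n * g ^ (b ^ n * n) = g ^ (a ^ n * n) * h ^ n := by
    rw [← hp]; group
  have hhn := norm_pow_ge h h1 n
  have hgn := norm_zpow_ge g hg (a ^ n * n)
  have hgn2 : n ≤ (a ^ n * (n:ℤ)).natAbs := by
    rw [Int.natAbs_mul, Int.natAbs_natCast, Int.natAbs_pow]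
    have : 1 ≤ a.natAbs ^ n := Nat.one_le_pow _ _ (Int.natAbs_pos.2 ha0)
    nlinarith
  have q1 := gp_mul_self (h ^ n) (g ^ (b ^ n * (n:ℤ)))
  have q2 := gp_mul_self (g ^ (a ^ n * (n:ℤ))) (h ^ n)
  rw [← hcomm] at q2
  have q3 := hC (h ^ n)⁻¹ (H.inv_mem (H.pow_mem hh _)) (g ^ (b ^ n * (n:ℤ))) ⟨_, rfl⟩
  have q4 := hC (h ^ n) (H.pow_mem hh _) (g ^ (a ^ n * (n:ℤ)))⁻¹
    (Subgroup.inv_mem _ ⟨_, rfl⟩)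
  rw [gp_comm] at q4
  have q5 := hC (h ^ n) (H.pow_mem hh _) (g ^ (a ^ n * (n:ℤ))) ⟨_, rfl⟩
  have q6 := gp_tri (h ^ n) (h ^ n * g ^ (b ^ n * (n:ℤ))) (g ^ (a ^ n * (n:ℤ)))
  rw [gp_comm _ (g ^ (a ^ n * (n:ℤ)))] at q6
  omega

lemma zpowers_FG (g : FG d) : (Subgroup.zpowers g).FG :=
  ⟨{g}, by simp [Subgroup.zpowers_eq_closure]⟩

lemma exists_consts (H : Subgroup (FG d)) (hH : H.FG) (g : FG d)
    (hg : ∀ n : ℕ, 1 ≤ n → g ^ n ∉ H) : ∃ C,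
      (∀ a ∈ H, ∀ b ∈ Subgroup.zpowers g, gp a b ≤ C) ∧
      (∀ a ∈ H, a ≠ 1 → ∀ b ∈ Subgroup.zpowers g, ∀ b' ∈ Subgroup.zpowers g,
        gp b (a * b') ≤ C) := by
  have hg1 : g ≠ 1 := by
    rintro rfl; exact hg 1 le_rfl (by simp)
  have hbot : H ⊓ Subgroup.zpowers g = ⊥ := by
    rw [eq_bot_iff]
    rintro x ⟨hx, ⟨n, hn⟩⟩
    simp only at hn
    subst hn
    rw [Subgroup.mem_bot]
    by_cases h0 : n = 0
    · subst h0; simp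
    · exfalso
      refine hg n.natAbs (Int.natAbs_pos.2 h0) ?_
      rcases Int.natAbs_eq n with h | h
      · rw [h, zpow_natCast] at hx; exact hx
      · rw [h, zpow_neg, zpow_natCast] at hx; exact H.inv_mem_iff.1 hx
  obtain ⟨C, hC⟩ := gp_bounded H (Subgroup.zpowers g) hH (zpowers_FG g) hbot
  have hsm : ∀ h : FG d, ∃ E, h ∈ H → h ≠ 1 → ∀ b ∈ Subgroup.zpowers g, ∀ b' ∈ Subgroup.zpowers g,
      gp b (h * b') ≤ E := by
    intro h
    by_cases hh : h ∈ H ∧ h ≠ 1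
    · obtain ⟨E, hE⟩ := gp_bounded _ _ (zpowers_FG g) (zpowers_FG (h * g * h⁻¹))
        (zpow_conj_trivial H g hg1 C hC h hh.1 hh.2)
      refine ⟨E + FreeGroup.norm h, fun _ _ b hb b' hb' => ?_⟩
      obtain ⟨k, rfl⟩ := hb'
      simp only
      have h1 := hE b hb (h * g ^ k * h⁻¹) ⟨k, by simp only [conj_zpow]⟩
      have h2 := gp_tri b (h * g ^ k) (h * g ^ k * h⁻¹)
      have h3 := gp_mul_self (h * g ^ k) h⁻¹
      have h4 := gp_le_right (h * g ^ k)⁻¹ h⁻¹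
      rw [FreeGroup.norm_inv_eq] at h4
      have h5 := gp_le_right b (h * g ^ k)
      omega
    · exact ⟨0, fun h1 h2 => absurd ⟨h1, h2⟩ hh⟩
  choose E hE using hsm
  obtain ⟨M, hM⟩ := ((ball_finite_s1 (d := d) (2 * C)).image E).bddAbove
  refine ⟨max C M, fun a ha b hb => (hC a ha b hb).trans (le_max_left _ _), ?_⟩
  intro a ha ha1 b hb b' hb'
  by_cases hn : FreeGroup.norm a ≤ 2 * C
  · exact (hE a ha ha1 b hb b' hb').trans ((hM ⟨a, hn, rfl⟩).trans (le_max_right _ _))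
  · have h1 := gp_mul_self a b'
    have h2 := hC a⁻¹ (H.inv_mem ha) b' hb'
    have h3 := hC a ha b hb
    have h4 := gp_tri b (a * b') a
    rw [gp_comm (a * b') a, gp_comm b a] at h4
    have : gp b (a * b') ≤ C := by omega
    exact this.trans (le_max_left _ _)

lemma pingpong (S : Bool → Subgroup (FG d)) (C : ℕ)
    (h1 : ∀ a ∈ S true, ∀ b ∈ S false, gp a b ≤ C)
    (h2 : ∀ a ∈ S true, a ≠ 1 → ∀ b ∈ S false, ∀ b' ∈ S false, gp b (a * b') ≤ C)
    (h3 : ∀ b ∈ S false, b ≠ 1 → 4 * C < FreeGroup.norm b) (n : ℕ) :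
    (∀ y ∈ Wd S n true, ∀ b ∈ S false, gp b y ≤ C) ∧
    (∀ y ∈ Wd S n false, ∃ b ∈ S false, b ≠ 1 ∧ FreeGroup.norm b ≤ gp y b + C) := by
  induction n with
  | zero => simp [Wd]
  | succ n ih =>
    obtain ⟨ihA, ihB⟩ := ih
    constructor
    · rintro y (⟨hy, hy1⟩ | ⟨a, ⟨ha, ha1⟩, y', hy', rfl⟩) b hb
      · rw [gp_comm]; exact h1 y hy b hb
      · simp only
        obtain ⟨b', hb', hb1, hb2⟩ := ihB y' hy'
        have e1 := h3 b' hb' hb1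
        have e2 := h1 a⁻¹ (Subgroup.inv_mem _ ha) b' hb'
        have e3 : gp a⁻¹ y' ≤ C := by
          have := gp_tri a⁻¹ y' b'
          omega
        have e4 := norm_mul_gp a y'
        have e5 := norm_mul_gp a b'
        have e6 := fg_norm_inv_mul (a * y') (a * b')
        have e7 : (a * y')⁻¹ * (a * b') = y'⁻¹ * b' := by group
        rw [e7] at e6
        have e8 := fg_norm_inv_mul y' b'
        have e9 := h2 a ha ha1 b hb b' hb'
        have e10 := gp_tri b (a * y') (a * b')
        omega
    · rintro y (⟨hy, hy1⟩ | ⟨b, ⟨hb, hb1⟩, y', hy', rfl⟩)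
      · refine ⟨y, hy, hy1, ?_⟩
        have := fg_norm_inv_mul y y
        simp at this
        omega
      · refine ⟨b, hb, hb1, ?_⟩
        have e1 := ihA y' hy' b⁻¹ (Subgroup.inv_mem _ hb)
        have e2 := gp_mul_self b y'
        simp only
        rw [gp_comm]
        omega

lemma pingpong_gp (S : Bool → Subgroup (FG d)) (C : ℕ)
    (h1 : ∀ a ∈ S true, ∀ b ∈ S false, gp a b ≤ C)
    (h2 : ∀ a ∈ S true, a ≠ 1 → ∀ b ∈ S false, ∀ b' ∈ S false, gp b (a * b') ≤ C)
    (h3 : ∀ b ∈ S false, b ≠ 1 → 4 * C < FreeGroup.norm b) (s : Bool) (n : ℕ) (x : FG d)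
    (hx : x ∈ nt (S s)) (y : FG d) (hy : y ∈ Wd S n (!s)) :
    FreeGroup.norm x + FreeGroup.norm y ≤ FreeGroup.norm (x * y) + 2 * C := by
  obtain ⟨pA, pB⟩ := pingpong S C h1 h2 h3 n
  have e := norm_mul_gp x y
  suffices gp x⁻¹ y ≤ C by omega
  cases s
  · exact pA y hy _ (Subgroup.inv_mem _ hx.1)
  · obtain ⟨b', hb', hb1, hb2⟩ := pB y hy
    have e1 := h3 b' hb' hb1
    have e2 := h1 x⁻¹ (Subgroup.inv_mem _ hx.1) b' hb'
    have := gp_tri x⁻¹ y b'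
    omega

end

section

open Filter
open scoped ENNReal Pointwise
set_option autoImplicit false
variable {d : ℕ}

lemma pois_range_le (u : ℝ≥0∞) (hu : u ≤ 1) (f : ℕ → FG d) (m : ℕ)
    (hf : ∀ n, m + n ≤ FreeGroup.norm (f n)) :
    pois u (Set.range f) ≤ u ^ m * (1 - u)⁻¹ := by
  have h1 : pois u (Set.range f) ≤ ∑' n : ℕ, u ^ (FreeGroup.norm (f n)) := by
    unfold pois
    have hinj : Function.Injective (Set.rangeSplitting f) := Set.rangeSplitting_injective f
    have := ENNReal.tsum_comp_le_tsum_of_injective hinj (fun n => u ^ (FreeGroup.norm (f n)))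
    simpa [Set.apply_rangeSplitting] using this
  refine h1.trans ?_
  rw [← ENNReal.tsum_geometric, ← ENNReal.tsum_mul_left]
  refine ENNReal.tsum_le_tsum (fun n => ?_)
  rw [← pow_add]
  exact pow_le_pow_right_of_le_one' hu (hf n)

lemma norm_zpowers_ge (g : FG d) (hg : g ≠ 1) (m : ℕ) (b : FG d)
    (hb : b ∈ Subgroup.zpowers (g ^ m)) (hb1 : b ≠ 1) : m ≤ FreeGroup.norm b := by
  obtain ⟨k, rfl⟩ := hb
  simp only at hb1 ⊢
  have hk : k ≠ 0 := by rintro rfl; simp at hb1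
  have h := norm_zpow_ge g hg (m * k)
  rw [zpow_mul, zpow_natCast] at h
  refine le_trans ?_ h
  rw [Int.natAbs_mul, Int.natAbs_natCast]
  have : 1 ≤ k.natAbs := Int.natAbs_pos.2 hk
  nlinarith

lemma pois_zpowers_le (u : ℝ≥0∞) (hu : u ≤ 1) (g : FG d) (hg : g ≠ 1) (m : ℕ) (hm : 1 ≤ m) :
    pois u (nt (Subgroup.zpowers (g ^ m))) ≤ u ^ m * (2 * (1 - u)⁻¹) := by
  have hsub : nt (Subgroup.zpowers (g ^ m)) ⊆ Set.range (fun n : ℕ => g ^ (m * (n + 1))) ∪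
      Set.range (fun n : ℕ => (g ^ (m * (n + 1)))⁻¹) := by
    rintro x ⟨⟨k, rfl⟩, hx⟩
    simp only at hx
    have hk : k ≠ 0 := by rintro rfl; simp at hx
    have hk1 : 1 ≤ k.natAbs := Int.natAbs_pos.2 hk
    rcases Int.natAbs_eq k with h | h
    · left; refine ⟨k.natAbs - 1, ?_⟩
      simp only
      rw [Nat.sub_add_cancel hk1]; nth_rewrite 2 [h]; rw [zpow_natCast, pow_mul]
    · right; refine ⟨k.natAbs - 1, ?_⟩
      simp only
      rw [Nat.sub_add_cancel hk1]; nth_rewrite 2 [h]; rw [zpow_neg, zpow_natCast, pow_mul]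
  have hn : ∀ n, m + n ≤ FreeGroup.norm (g ^ (m * (n + 1))) := by
    intro n
    refine le_trans ?_ (norm_pow_ge g hg _)
    nlinarith
  calc _ ≤ _ := pois_mono u hsub
    _ ≤ _ := pois_union_le _ _ _
    _ ≤ u ^ m * (1 - u)⁻¹ + u ^ m * (1 - u)⁻¹ := add_le_add (pois_range_le u hu _ m hn)
        (pois_range_le u hu _ m (fun n => by rw [FreeGroup.norm_inv_eq]; exact hn n))
    _ = _ := by ring

lemma choose_t (p c B : ℝ≥0∞) (hc : c ≠ ∞) (hp : p < B) :
    ∃ t : ℝ≥0∞, 0 < t ∧ t ≠ ∞ ∧ p + c * (p * t) + t < B := by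
  have hp' : p ≠ ∞ := hp.ne_top
  have hcont : Tendsto (fun t : ℝ≥0∞ => p + c * (p * t) + t) (nhds 0)
      (nhds (p + c * (p * 0) + 0)) := by
    refine Tendsto.add (Tendsto.add tendsto_const_nhds ?_) tendsto_id
    refine ENNReal.Tendsto.const_mul ?_ (Or.inr hc)
    exact ENNReal.Tendsto.const_mul tendsto_id (Or.inr hp')
  simp only [mul_zero, add_zero] at hcont
  have h1 := hcont.eventually_lt_const hp
  rw [ENNReal.nhds_zero_basis.eventually_iff] at h1
  obtain ⟨ε, hε, h2⟩ := h1
  obtain ⟨t, ht0, ht⟩ := exists_between hε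
  exact ⟨t, ht0, ht.ne_top, h2 ht⟩

lemma step_lemma (H : Subgroup (FG d)) (hH : H.FG) (u : ℝ≥0∞) (hu0 : u ≠ 0) (hu1 : u < 1)
    (B : ℝ≥0∞) (hB : pois u (H : Set (FG d)) < B) (g : FG d) :
    ∃ H' : Subgroup (FG d), H ≤ H' ∧ H'.FG ∧ pois u (H' : Set (FG d)) < B ∧
      ∃ n, 1 ≤ n ∧ g ^ n ∈ H' := by
  by_cases hg : ∃ n, 1 ≤ n ∧ g ^ n ∈ H
  · exact ⟨H, le_rfl, hH, hB, hg⟩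
  push Not at hg
  have hg1 : g ≠ 1 := by
    rintro rfl; exact hg 1 le_rfl (by simp)
  obtain ⟨C, hC1, hC2⟩ := exists_consts H hH g hg
  obtain ⟨c, hc⟩ : ∃ c : ℝ≥0∞, c = (u ^ (2 * C))⁻¹ := ⟨_, rfl⟩
  have hct : c ≠ ∞ := by rw [hc]; simp [hu0]
  obtain ⟨p, hp⟩ : ∃ p, p = pois u (nt H) := ⟨_, rfl⟩
  rw [pois_nt, ← hp] at hB
  have hpB : p < B - 1 := by
    rw [lt_tsub_iff_left]; exact hB
  obtain ⟨t, ht0, htt, ht⟩ := choose_t p c (B - 1) hct hpB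
  have hp' : p ≠ ∞ := hpB.ne_top
  obtain ⟨MA, hMA⟩ : ∃ MA, MA = p + c * (p * t) := ⟨_, rfl⟩
  have hMAt : MA ≠ ∞ := by
    rw [hMA]; exact ENNReal.add_ne_top.2 ⟨hp', ENNReal.mul_ne_top hct (ENNReal.mul_ne_top hp' htt)⟩
  have hlim : Tendsto (fun m : ℕ => u ^ m * (2 * (1 - u)⁻¹) * (1 + c * MA)) atTop (nhds 0) := by
    have h0 := ENNReal.tendsto_pow_atTop_nhds_zero_of_lt_one hu1
    have hK : 2 * (1 - u)⁻¹ ≠ ∞ := by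
      refine ENNReal.mul_ne_top (by simp) ?_
      rw [ENNReal.inv_ne_top]
      exact (tsub_pos_of_lt hu1).ne'
    have hK2 : 1 + c * MA ≠ ∞ := ENNReal.add_ne_top.2 ⟨by simp, ENNReal.mul_ne_top hct hMAt⟩
    have := ENNReal.Tendsto.mul_const (ENNReal.Tendsto.mul_const h0 (Or.inr hK)) (Or.inr hK2)
    simpa using this
  obtain ⟨m, hm1, hm2⟩ := ((hlim.eventually_lt_const ht0).and
    (eventually_gt_atTop (4 * C))).exists
  let S : Bool → Subgroup (FG d) := fun s => if s then H else Subgroup.zpowers (g ^ m)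
  have hSt : S true = H := rfl
  have hSf : S false = Subgroup.zpowers (g ^ m) := rfl
  have hle : Subgroup.zpowers (g ^ m) ≤ Subgroup.zpowers g := by
    rw [Subgroup.zpowers_le]; exact Subgroup.pow_mem _ (Subgroup.mem_zpowers g) _
  refine ⟨H ⊔ Subgroup.zpowers (g ^ m), le_sup_left, hH.sup (zpowers_FG _), ?_, m, by omega,
    Subgroup.mem_sup_right (Subgroup.mem_zpowers _)⟩
  have hmain := pois_sup_le S u (fun _ => c) (fun s => if s then MA else t) ?_ ?_
  · refine lt_of_le_of_lt hmain ?_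
    rw [lt_tsub_iff_left] at ht
    rw [← hMA] at ht
    simpa using ht
  · intro s n x hx y hy
    have h := pingpong_gp S C (fun a ha b hb => hC1 a ha b (hle hb))
      (fun a ha ha1 b hb b' hb' => hC2 a ha ha1 b (hle hb) b' (hle hb'))
      (fun b hb hb1 => lt_of_lt_of_le hm2 (norm_zpowers_ge g hg1 m b hb hb1)) s n x hx y hy
    rw [hc, mul_comm, ← div_eq_mul_inv, ENNReal.le_div_iff_mul_le (Or.inl (pow_ne_zero _ hu0))
      (Or.inl (ENNReal.pow_ne_top hu1.ne_top)), ← pow_add, ← pow_add]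
    exact pow_le_pow_right_of_le_one' hu1.le h
  · intro s
    cases s
    · change pois u (nt (Subgroup.zpowers (g ^ m))) + c * (pois u (nt (Subgroup.zpowers (g ^ m))) * MA) ≤ t
      have h := pois_zpowers_le u hu1.le g hg1 m (by omega)
      calc _ = pois u (nt (Subgroup.zpowers (g ^ m))) * (1 + c * MA) := by ring
        _ ≤ u ^ m * (2 * (1 - u)⁻¹) * (1 + c * MA) := by gcongr
        _ ≤ t := hm1.le
    · change pois u (nt H) + c * (pois u (nt H) * t) ≤ MA
      rw [← hp, hMA]

lemma exists_power_group (H : Subgroup (FG d)) (hH : H.FG) (u : ℝ≥0∞) (hu0 : u ≠ 0) (hu1 : u < 1)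
    (hB : pois u (H : Set (FG d)) ≠ ∞) :
    ∃ Δ : Subgroup (FG d), H ≤ Δ ∧ pois u (Δ : Set (FG d)) ≠ ∞ ∧ ∀ g, ∃ n, 1 ≤ n ∧ g ^ n ∈ Δ := by
  obtain ⟨B, hB1, hB2⟩ := exists_between (lt_top_iff_ne_top.2 hB)
  obtain ⟨e, he⟩ := exists_surjective_nat (FG d)
  let T := {K : Subgroup (FG d) // K.FG ∧ pois u (K : Set (FG d)) < B}
  have hst : ∀ (K : T) (g : FG d), ∃ K' : T, K.1 ≤ K'.1 ∧ ∃ n, 1 ≤ n ∧ g ^ n ∈ K'.1 := by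
    intro K g
    obtain ⟨K', h1, h2, h3, h4⟩ := step_lemma K.1 K.2.1 u hu0 hu1 B K.2.2 g
    exact ⟨⟨K', h2, h3⟩, h1, h4⟩
  choose nx hnx1 hnx2 using hst
  let ch : ℕ → T := fun n => Nat.rec ⟨H, hH, hB1⟩ (fun i K => nx K (e i)) n
  have hmono : Monotone (fun n => (ch n).1) := monotone_nat_of_le_succ (fun n => hnx1 (ch n) (e n))
  have hcoe : ((⨆ n, (ch n).1 : Subgroup (FG d)) : Set (FG d)) = ⋃ n, ((ch n).1 : Set (FG d)) :=
    Subgroup.coe_iSup_of_directed hmono.directed_le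
  refine ⟨⨆ n, (ch n).1, le_iSup (fun n => (ch n).1) 0, ?_, ?_⟩
  · rw [hcoe]
    exact ne_top_of_le_ne_top hB2.ne (pois_iUnion_le u _ (fun i j hij => hmono hij) B
      (fun n => (ch n).2.2.le))
  · intro g
    obtain ⟨i, rfl⟩ := he g
    obtain ⟨n, hn, hm⟩ := hnx2 (ch i) (e i)
    exact ⟨n, hn, (le_iSup (fun n => (ch n).1) (i + 1)) hm⟩

lemma exists_boomerang (hd : 2 ≤ d) (u v : ℝ) (hu : 0 < u) (huv : u < v) (hv1 : v < 1)
    (hq : 1 < (2 * (d : ℝ) - 1) * u) :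
    ∃ Δ : Subgroup (FG d), IsBoomerang Δ ∧ -Real.log v ≤ critExp Δ ∧ critExp Δ ≤ -Real.log u := by
  obtain ⟨H, h1, h2, h3⟩ := seed hd u v hu huv hv1 hq
  obtain ⟨Δ, h4, h5, h6⟩ := exists_power_group H h1 (ENNReal.ofReal u)
    (by simpa using hu) (by simpa using huv.trans hv1) h2
  have h7 : pois (ENNReal.ofReal v) (Δ : Set (FG d)) = ∞ :=
    top_le_iff.1 (h3 ▸ pois_mono _ h4)
  exact ⟨Δ, isBoomerang_of_powers Δ h6, le_critExp Δ u hu (huv.trans hv1) h5 v (hu.trans huv) h7,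
    critExp_le_s1 Δ u hu (huv.trans hv1) h5⟩

lemma dense_one (hd : 2 ≤ d) : Set.Icc (0 : ℝ) (Real.log (2 * (d : ℝ) - 1)) ⊆
      closure {x : ℝ | ∃ Δ : Subgroup (FreeGroup (Fin d)), IsBoomerang Δ ∧ critExp Δ = x} := by
  have hd' : (2:ℝ) ≤ d := by exact_mod_cast hd
  obtain ⟨L, hL⟩ : ∃ L, L = Real.log (2 * (d : ℝ) - 1) := ⟨_, rfl⟩
  have hL0 : 0 < L := by rw [hL]; exact Real.log_pos (by linarith)
  rintro x ⟨hx0, hx1⟩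
  rw [← hL] at hx1
  rw [Metric.mem_closure_iff]
  intro ε hε
  obtain ⟨s, hs1, hs2⟩ : ∃ s, max 0 (x - ε) < s ∧ s < min L (x + ε) := by
    apply exists_between
    rw [max_lt_iff, lt_min_iff, lt_min_iff]
    exact ⟨⟨hL0, by linarith⟩, by linarith, by linarith⟩
  obtain ⟨t, ht1, ht2⟩ := exists_between hs2
  rw [max_lt_iff] at hs1
  rw [lt_min_iff] at ht2
  obtain ⟨Δ, h1, h2, h3⟩ := exists_boomerang hd (Real.exp (-t)) (Real.exp (-s)) (Real.exp_pos _)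
    (by rw [Real.exp_lt_exp]; linarith) (by rw [Real.exp_lt_one_iff]; linarith) (by
      have : 2 * (d : ℝ) - 1 = Real.exp L := by
        rw [hL, Real.exp_log (by linarith)]
      rw [this, ← Real.exp_add, Real.one_lt_exp_iff]; linarith)
  rw [Real.log_exp, neg_neg] at h2 h3
  refine ⟨critExp Δ, ⟨Δ, h1, rfl⟩, ?_⟩
  rw [Real.dist_eq, abs_lt]
  constructor <;> linarith

end

theorem boomerang_critExp_dense (d : ℕ) (hd : 2 ≤ d) :
    (Set.Icc (0 : ℝ) (Real.log (2 * (d : ℝ) - 1)) ⊆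
      closure {x : ℝ | ∃ Δ : Subgroup (FreeGroup (Fin d)), IsBoomerang Δ ∧ critExp Δ = x}) ∧
    (Set.Icc (1 : ℝ) (2 * (d : ℝ) - 1) ⊆
      closure {y : ℝ | ∃ Δ : Subgroup (FreeGroup (Fin d)),
        IsBoomerang Δ ∧ Real.exp (critExp Δ) = y}) := by
  refine ⟨dense_one hd, ?_⟩
  rintro y ⟨hy1, hy2⟩
  have hy0 : 0 < y := by linarith
  have h := dense_one hd ⟨Real.log_nonneg hy1, Real.log_le_log hy0 hy2⟩
  have h2 := image_closure_subset_closure_image Real.continuous_exp ⟨_, h, rfl⟩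
  rw [Real.exp_log hy0] at h2
  refine closure_mono ?_ h2
  rintro _ ⟨_, ⟨Δ, hΔ, rfl⟩, rfl⟩
  exact ⟨Δ, hΔ, rfl⟩
end
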